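/- Every semidihedral group SD_{8n} with n ≥ 3 is a Burnside group: every finite permutation group containing a regular subgroup isomorphic to SD_{8n} is either 2-transitive or imprimitive. -/

import Mathlib

/-- `G` is the semidihedral group `SD_{8n}`. -/
def IsSemidihedral (n : ℕ) (G : Type*) [Group G] : Prop :=
  Nat.card G = 8 * n ∧ ∃ a b : G, orderOf a = 4 * n ∧ orderOf b = 2 ∧
    b⁻¹ * a * b = a ^ (2 * n - 1) ∧ Subgroup.closure {a, b} = ⊤

/-- 2-transitivity of the action of `G` on `Ω`. -/
def IsTwoTransitive (G Ω : Type*) [Group G] [MulAction G Ω] : Prop :=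
  ∀ α β α' β' : Ω, α ≠ β → α' ≠ β' → ∃ g : G, g • α = α' ∧ g • β = β'

set_option linter.unusedSectionVars false

/-- The group ring `k[M]` of a finite abelian group, as coefficient functions. -/
@[ext] structure Lam (M k : Type) where
  c : M → k

namespace Lam
section basic
variable {M : Type} [AddCommGroup M] [Fintype M] [DecidableEq M]
variable {k : Type} [CommRing k]

instance : Zero (Lam M k) := ⟨⟨fun _ => 0⟩⟩
instance : One (Lam M k) := ⟨⟨fun x => if x = 0 then 1 else 0⟩⟩
instance : Add (Lam M k) := ⟨fun f g => ⟨fun x => f.c x + g.c x⟩⟩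
instance : Neg (Lam M k) := ⟨fun f => ⟨fun x => - f.c x⟩⟩
instance : Mul (Lam M k) := ⟨fun f g => ⟨fun x => ∑ y, f.c y * g.c (x - y)⟩⟩

@[simp] lemma zero_c (x : M) : (0 : Lam M k).c x = 0 := rfl
lemma one_c (x : M) : (1 : Lam M k).c x = if x = 0 then 1 else 0 := rfl
@[simp] lemma add_c (f g : Lam M k) (x : M) : (f + g).c x = f.c x + g.c x := rfl
@[simp] lemma neg_c (f : Lam M k) (x : M) : (-f).c x = - f.c x := rfl
lemma mul_c (f g : Lam M k) (x : M) : (f * g).c x = ∑ y, f.c y * g.c (x - y) := rfl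

protected lemma mul_comm' (f g : Lam M k) : f * g = g * f := by
  ext x
  rw [mul_c, mul_c]
  refine Fintype.sum_equiv (Equiv.subLeft x) _ _ ?_
  intro y
  simp [mul_comm]

protected lemma mul_assoc' (f g h : Lam M k) : f * g * h = f * (g * h) := by
  ext x
  simp only [mul_c, Finset.sum_mul, Finset.mul_sum]
  rw [Finset.sum_comm]
  refine Finset.sum_congr rfl fun y _ => ?_
  refine Fintype.sum_equiv (Equiv.subRight y) _ _ ?_
  intro w
  simp [mul_assoc]

protected lemma one_mul' (f : Lam M k) : 1 * f = f := by
  ext x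
  rw [mul_c, Finset.sum_eq_single 0]
  · simp [one_c]
  · intro b _ hb; simp [one_c, hb]
  · simp

instance : CommRing (Lam M k) where
  add_assoc a b c := by ext; simp [add_assoc]
  zero_add a := by ext; simp
  add_zero a := by ext; simp
  add_comm a b := by ext; simp [add_comm]
  neg_add_cancel a := by ext; simp
  nsmul := nsmulRec
  zsmul := zsmulRec
  mul_assoc := Lam.mul_assoc'
  mul_comm := Lam.mul_comm'
  one_mul := Lam.one_mul'
  mul_one a := by rw [Lam.mul_comm', Lam.one_mul']
  left_distrib a b c := by ext; simp [mul_c, mul_add, Finset.sum_add_distrib]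
  right_distrib a b c := by ext; simp [mul_c, add_mul, Finset.sum_add_distrib]
  zero_mul a := by ext; simp [mul_c]
  mul_zero a := by ext; simp [mul_c]

@[simp] lemma sub_c (f g : Lam M k) (x : M) : (f - g).c x = f.c x - g.c x := by
  rw [sub_eq_add_neg, add_c, neg_c, sub_eq_add_neg]

/-- coefficient as an additive map -/
def cHom (x : M) : Lam M k →+ k where
  toFun f := f.c x
  map_zero' := rfl
  map_add' _ _ := rfl

@[simp] lemma cHom_apply (x : M) (f : Lam M k) : cHom x f = f.c x := rfl

@[simp] lemma sum_c {ι : Type*} (s : Finset ι) (f : ι → Lam M k) (x : M) :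
    (∑ i ∈ s, f i).c x = ∑ i ∈ s, (f i).c x := by
  rw [← cHom_apply, map_sum]; rfl

/-- constants -/
def C : k →+* Lam M k where
  toFun a := ⟨fun x => if x = 0 then a else 0⟩
  map_one' := rfl
  map_zero' := by ext; simp
  map_add' a b := by ext x; simp only [add_c]; split_ifs <;> simp
  map_mul' a b := by
    ext x
    rw [mul_c, Finset.sum_eq_single 0]
    · simp
    · intro b _ hb; simp [hb]
    · simp

lemma C_c (a : k) (x : M) : (C a : Lam M k).c x = if x = 0 then a else 0 := rfl

@[simp] lemma C_mul_c (a : k) (f : Lam M k) (x : M) : (C a * f).c x = a * f.c x := by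
  rw [mul_c, Finset.sum_eq_single 0]
  · simp [C_c]
  · intro b _ hb; simp [C_c, hb]
  · simp

@[simp] lemma natCast_mul_c (j : ℕ) (f : Lam M k) (x : M) : ((j : Lam M k) * f).c x = j * f.c x := by
  rw [← map_natCast (C (M := M) (k := k)), C_mul_c]

@[simp] lemma ofNat_mul_c (j : ℕ) [j.AtLeastTwo] (f : Lam M k) (x : M) :
    ((ofNat(j) : Lam M k) * f).c x = (ofNat(j) : k) * f.c x := by
  have := natCast_mul_c j f x
  exact_mod_cast this

lemma natCast_c (j : ℕ) (x : M) : ((j : Lam M k)).c x = if x = 0 then (j : k) else 0 := by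
  rw [← map_natCast (C (M := M) (k := k)), C_c]

/-- basis element -/
def d (x : M) : Lam M k := ⟨fun y => if y = x then 1 else 0⟩

lemma d_c (x y : M) : (d x : Lam M k).c y = if y = x then 1 else 0 := rfl

@[simp] lemma d_mul_c (x : M) (f : Lam M k) (y : M) : (d x * f).c y = f.c (y - x) := by
  rw [mul_c, Finset.sum_eq_single x]
  · simp [d_c]
  · intro b _ hb; simp [d_c, hb]
  · simp

lemma d_zero : (d 0 : Lam M k) = 1 := rfl

lemma d_mul_d (x y : M) : (d x * d y : Lam M k) = d (x + y) := by
  ext w; simp [d_c, sub_eq_iff_eq_add, add_comm]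

lemma d_pow (x : M) (j : ℕ) : (d x : Lam M k) ^ j = d (j • x) := by
  induction j with
  | zero => simp [d_zero]
  | succ j ih => rw [pow_succ, ih, d_mul_d, succ_nsmul]

lemma eq_sum (f : Lam M k) : f = ∑ x, C (f.c x) * d x := by
  ext y
  simp [d_c]

/-- augmentation -/
def aug : Lam M k →+* k where
  toFun f := ∑ x, f.c x
  map_one' := by simp [one_c]
  map_zero' := by simp
  map_add' f g := by simp [Finset.sum_add_distrib]
  map_mul' f g := by
    simp only [mul_c]
    rw [Finset.sum_comm, Finset.sum_mul]
    refine Finset.sum_congr rfl fun y _ => ?_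
    rw [Finset.mul_sum]
    exact Fintype.sum_equiv (Equiv.subRight y) _ _ (fun w => by simp)

lemma aug_apply (f : Lam M k) : aug f = ∑ x, f.c x := rfl
@[simp] lemma aug_d (x : M) : aug (d x : Lam M k) = 1 := by simp [aug_apply, d_c]
@[simp] lemma aug_C (a : k) : aug (C a : Lam M k) = a := by simp [aug_apply, C_c]

/-- the all ones element -/
def all : Lam M k := ⟨fun _ => 1⟩
@[simp] lemma all_c (x : M) : (all : Lam M k).c x = 1 := rfl
lemma mul_all (f : Lam M k) : f * all = C (aug f) * all := by
  ext x; rw [C_mul_c, mul_c]; simp [aug_apply]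

/-- push-forward along an endomorphism -/
def push {N : Type} [AddCommGroup N] [Fintype N] [DecidableEq N] (φ : M →+ N) : Lam M k →+* Lam N k where
  toFun f := ⟨fun y => ∑ x, if φ x = y then f.c x else 0⟩
  map_one' := by
    ext y
    change ∑ x, (if φ x = y then (1 : Lam M k).c x else 0) = (1 : Lam N k).c y
    rw [Finset.sum_eq_single 0]
    · simp [one_c, eq_comm]
    · intro b _ hb; simp [one_c, hb]
    · simp
  map_zero' := by ext; simp
  map_add' f g := by
    ext y
    simp only [add_c, ← Finset.sum_add_distrib]
    refine Finset.sum_congr rfl fun x _ => ?_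
    split_ifs <;> simp
  map_mul' f g := by
    ext y
    simp only [mul_c, Finset.sum_mul]
    have h1 : ∀ x : M, (if φ x = y then ∑ w, f.c w * g.c (x - w) else 0)
        = ∑ w, if φ x = y then f.c w * g.c (x - w) else 0 := by
      intro x; split_ifs <;> simp
    simp only [h1]
    rw [Finset.sum_comm]
    conv_rhs => rw [Finset.sum_comm]
    refine Finset.sum_congr rfl fun w _ => ?_
    rw [Finset.sum_eq_single (φ w)]
    · rw [if_pos rfl, Finset.mul_sum]
      refine Fintype.sum_equiv (Equiv.subRight w) _ _ (fun x => ?_)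
      simp [sub_left_inj]
    · intro b _ hb; simp [Ne.symm hb]
    · simp

lemma push_c {N : Type} [AddCommGroup N] [Fintype N] [DecidableEq N] (φ : M →+ N) (f : Lam M k) (y : N) :
    (push φ f).c y = ∑ x, if φ x = y then f.c x else 0 := rfl

@[simp] lemma push_d {N : Type} [AddCommGroup N] [Fintype N] [DecidableEq N] (φ : M →+ N) (x : M) :
    push φ (d x : Lam M k) = d (φ x) := by
  ext y
  rw [push_c, Finset.sum_eq_single x]
  · simp [d_c, eq_comm]
  · intro b _ hb; simp [d_c, hb]
  · simp

@[simp] lemma push_C {N : Type} [AddCommGroup N] [Fintype N] [DecidableEq N] (φ : M →+ N) (a : k) :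
    push φ (C a : Lam M k) = C a := by
  ext y
  rw [push_c, Finset.sum_eq_single 0]
  · simp [C_c, eq_comm]
  · intro b _ hb; simp [C_c, hb]
  · simp

/-- inversion -/
def inv : Lam M k →+* Lam M k where
  toFun f := ⟨fun x => f.c (-x)⟩
  map_one' := by ext; simp [one_c]
  map_zero' := rfl
  map_add' _ _ := rfl
  map_mul' f g := by
    ext x
    simp only [mul_c]
    exact Fintype.sum_equiv (Equiv.neg M) _ _ (fun w => by
      simp only [Equiv.neg_apply, neg_neg]; congr 2; abel)

@[simp] lemma inv_c (f : Lam M k) (x : M) : (inv f).c x = f.c (-x) := rfl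
@[simp] lemma inv_inv (f : Lam M k) : inv (inv f) = f := by ext; simp
@[simp] lemma inv_d (x : M) : inv (d x : Lam M k) = d (-x) := by ext; simp [d_c, neg_eq_iff_eq_neg]
@[simp] lemma aug_inv (f : Lam M k) : aug (inv f) = aug f := by
  simp only [aug_apply, inv_c]
  exact Fintype.sum_equiv (Equiv.neg M) _ _ (fun w => by simp)

/-- coefficientwise ring map -/
def pmap {k' : Type} [CommRing k'] (φ : k →+* k') : Lam M k →+* Lam M k' where
  toFun f := ⟨fun x => φ (f.c x)⟩
  map_one' := by ext; simp [one_c, apply_ite φ]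
  map_zero' := by ext; simp
  map_add' _ _ := by ext; simp
  map_mul' f g := by ext x; simp [mul_c]

@[simp] lemma pmap_c {k' : Type} [CommRing k'] (φ : k →+* k') (f : Lam M k) (x : M) :
    (pmap φ f).c x = φ (f.c x) := rfl

instance (p : ℕ) [CharP k p] : CharP (Lam M k) p :=
  charP_of_injective_ringHom (f := (C : k →+* Lam M k)) (by
    intro a b h
    have := congrArg (fun f => f.c 0) h
    simpa [C_c] using this) p

/-- Frobenius -/
lemma pow_char (ℓ : ℕ) [Fact ℓ.Prime] (f : Lam M (ZMod ℓ)) (φ : M →+ M) (hφ : ∀ x, φ x = ℓ • x) :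
    f ^ ℓ = push φ f := by
  have : ExpChar (Lam M (ZMod ℓ)) ℓ := ExpChar.prime Fact.out
  conv_lhs => rw [eq_sum f]
  conv_rhs => rw [eq_sum f]
  rw [sum_pow_char, map_sum]
  refine Finset.sum_congr rfl fun x _ => ?_
  rw [mul_pow, ← map_pow, ZMod.pow_card, d_pow, map_mul, push_C, push_d, hφ]

/-- coset sum lemma -/
lemma sum_eq_of_periodic (u : M) (p : ℕ) (hp : addOrderOf u = p) (f : M → k)
    (hf : ∀ x, f (x + u) = f x) : ∃ t, ∑ x, f x = p * t := by
  classical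
  have hfz : ∀ x, ∀ y ∈ AddSubgroup.zmultiples u, f (x + y) = f x := by
    intro x y hy
    obtain ⟨i, rfl⟩ := AddSubgroup.mem_zmultiples_iff.1 hy
    clear hy
    induction i using Int.induction_on with
    | zero => simp
    | succ i ih => rw [add_zsmul, one_zsmul, ← add_assoc, hf, ih]
    | pred i ih => rw [← ih, ← hf]; congr 1; rw [sub_zsmul, one_zsmul]; abel
  let e := AddSubgroup.addGroupEquivQuotientProdAddSubgroup (s := AddSubgroup.zmultiples u)
  refine ⟨∑ q : M ⧸ AddSubgroup.zmultiples u, f q.out, ?_⟩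
  rw [Fintype.sum_equiv e f (fun z => f z.1.out), Fintype.sum_prod_type]
  · simp only [Finset.sum_const, Finset.card_univ, nsmul_eq_mul, ← Finset.mul_sum]
    rw [← hp, ← Nat.card_zmultiples u, Nat.card_eq_fintype_card]
  · intro x
    have h : ((e x).1 : M ⧸ AddSubgroup.zmultiples u) = QuotientAddGroup.mk x := by
      rfl
    rw [h]
    obtain ⟨z, hz⟩ := QuotientAddGroup.mk_out_eq_add (AddSubgroup.zmultiples u) x
    rw [hz, hfz _ _ z.2]

lemma mul_eq_zero_of_periodic (u : M) (p : ℕ) (hp : addOrderOf u = p) [CharP k p] (f g : Lam M k)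
    (hf : d u * f = f) (hg : d u * g = g) : f * g = 0 := by
  ext x
  rw [mul_c]
  obtain ⟨t, ht⟩ := sum_eq_of_periodic u p hp (fun y => f.c y * g.c (x - y)) (by
    intro y
    congr 1
    · conv_rhs => rw [← add_sub_cancel_right y u, ← d_mul_c, hf]
    · conv_rhs => rw [← hg, d_mul_c]
      congr 1; abel)
  rw [ht]; simp

end basic

/-- trace of a prime power of a 2x2 matrix. -/
lemma trace_pow_char {R : Type*} [CommRing R] (ℓ : ℕ) [Fact ℓ.Prime] [CharP R ℓ]
    (N : Matrix (Fin 2) (Fin 2) R) : (N ^ ℓ).trace = N.trace ^ ℓ := by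
  have : ExpChar R ℓ := ExpChar.prime Fact.out
  have h1 : ∀ N : Matrix (Fin 2) (Fin 2) R, N + N.adjugate = Matrix.scalar (Fin 2) N.trace := by
    intro N
    rw [Matrix.adjugate_fin_two]
    ext i j
    fin_cases i <;> fin_cases j <;> simp [Matrix.trace_fin_two, add_comm]
  have hc : Commute N N.adjugate := by
    rw [Commute, SemiconjBy, Matrix.mul_adjugate, Matrix.adjugate_mul]
  have h2 : N ^ ℓ + (N ^ ℓ).adjugate = Matrix.scalar (Fin 2) (N.trace ^ ℓ) := by
    rw [Matrix.adjugate_pow, ← add_pow_char_of_commute _ hc, h1, ← map_pow]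
  rw [h1] at h2
  have := congrFun (congrFun h2 0) 0
  simpa using this

end Lam

set_option linter.unusedSectionVars false
set_option linter.unusedVariables false
set_option linter.unusedSimpArgs false
open Lam

abbrev Zm (n : ℕ) := ZMod (4 * n)

section arith
variable {n : ℕ} [NeZero n]

/-- parity -/
def par : Zm n →+* ZMod 2 := ZMod.castHom (by omega : 2 ∣ 4 * n) (ZMod 2)
/-- the central involution exponent -/
def zz : Zm n := ((2 * n : ℕ) : ZMod (4 * n))

lemma par_cases (x : Zm n) : par x = 0 ∨ par x = 1 := by
  generalize par x = t
  revert t; decide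

lemma ne_zero_iff_par (x : Zm n) : par x ≠ 0 ↔ par x = 1 := by
  generalize par x = t
  revert t; decide

lemma par_natCast (j : ℕ) : par (j : Zm n) = (j : ZMod 2) := by simp

lemma par_zero_iff (x : Zm n) : par x = 0 ↔ ∃ y, x = 2 * y := by
  constructor
  · intro h
    have hx : x = ((x.val : ℕ) : Zm n) := by simp
    rw [hx, par_natCast, ZMod.natCast_eq_zero_iff] at h
    obtain ⟨y, hy⟩ := h
    refine ⟨(y : Zm n), ?_⟩
    rw [hx, hy]; push_cast; rfl
  · rintro ⟨y, rfl⟩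
    rw [map_mul]
    have : par (2 : Zm n) = 0 := by
      have := par_natCast (n := n) 2
      push_cast at this; rw [this]; decide
    rw [this, zero_mul]

lemma par_one_iff (x : Zm n) : par x = 1 ↔ ∃ y, x = 2 * y + 1 := by
  have h := par_zero_iff (x - 1)
  rw [map_sub, map_one, sub_eq_zero] at h
  rw [h]
  constructor <;> rintro ⟨y, hy⟩ <;> exact ⟨y, by linear_combination hy⟩

lemma zz_eq : (zz : Zm n) = 2 * (n : Zm n) := by simp [zz]
lemma four_n : (4 * (n : Zm n)) = 0 := by
  have : ((4 * n : ℕ) : ZMod (4 * n)) = 0 := ZMod.natCast_self _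
  push_cast at this; exact this
lemma two_zz : (2 * zz : Zm n) = 0 := by
  rw [zz_eq]; linear_combination (four_n (n := n))
lemma zz_add : (zz + zz : Zm n) = 0 := by rw [← two_mul, two_zz]
@[simp] lemma neg_zz : (-zz : Zm n) = zz := by
  rw [neg_eq_iff_add_eq_zero, zz_add]
@[simp] lemma par_zz : par (zz : Zm n) = 0 := (par_zero_iff _).2 ⟨_, zz_eq⟩
lemma zz_ne : (zz : Zm n) ≠ 0 := by
  have hn := NeZero.pos n
  rw [zz, Ne, ZMod.natCast_eq_zero_iff]
  intro h
  have := Nat.le_of_dvd (by omega) h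
  omega

lemma natCast_eq_zero_iff' (j : ℕ) : (j : Zm n) = 0 ↔ 4 * n ∣ j := ZMod.natCast_eq_zero_iff _ _

lemma two_mul_eq_zero (x : Zm n) : 2 * x = 0 ↔ x = 0 ∨ x = zz := by
  constructor
  · intro h
    have hx : x = ((x.val : ℕ) : Zm n) := by simp
    have hlt : x.val < 4 * n := ZMod.val_lt x
    have h2 : ((2 * x.val : ℕ) : Zm n) = 0 := by push_cast; rw [← hx]; exact h
    rw [natCast_eq_zero_iff'] at h2
    obtain ⟨t, ht⟩ := h2
    have htl : t < 2 := by
      by_contra hge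
      push Not at hge
      have : 4 * n * 2 ≤ 4 * n * t := Nat.mul_le_mul_left _ hge
      omega
    interval_cases t
    · left; rw [hx]; have : x.val = 0 := by omega
      rw [this]; simp
    · right; rw [hx, zz]; congr 1; omega
  · rintro (rfl | rfl)
    · simp
    · exact two_zz

lemma two_mul_eq_iff (x y : Zm n) : 2 * x = 2 * y ↔ x = y ∨ x = y + zz := by
  rw [← sub_eq_zero, ← mul_sub, two_mul_eq_zero, sub_eq_zero, sub_eq_iff_eq_add, add_comm zz]

lemma addOrderOf_zz : addOrderOf (zz : Zm n) = 2 :=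
  addOrderOf_eq_prime (by rw [two_nsmul, zz_add]) zz_ne

/-- the unit `2n-1` -/
def sgU : (Zm n)ˣ where
  val := 2 * n - 1
  inv := 2 * n - 1
  val_inv := by linear_combination ((n : Zm n) - 1) * (four_n (n := n))
  inv_val := by linear_combination ((n : Zm n) - 1) * (four_n (n := n))

lemma sgU_val : ((sgU : (Zm n)ˣ) : Zm n) = 2 * n - 1 := rfl
lemma sg_even {x : Zm n} (h : par x = 0) : ((sgU : (Zm n)ˣ) : Zm n) * x = -x := by
  obtain ⟨y, rfl⟩ := (par_zero_iff x).1 h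
  rw [sgU_val]; linear_combination y * (four_n (n := n))
lemma sg_odd {x : Zm n} (h : par x = 1) : ((sgU : (Zm n)ˣ) : Zm n) * x = -x + zz := by
  obtain ⟨y, rfl⟩ := (par_one_iff x).1 h
  rw [sgU_val, zz_eq]; linear_combination y * (four_n (n := n))
lemma sg_sg (x : Zm n) : (sgU : (Zm n)ˣ) * ((sgU : (Zm n)ˣ) * x) = x := by
  rw [sgU_val]; linear_combination ((n : Zm n) - 1) * x * (four_n (n := n))
end arith

namespace Lam
section parity
variable {n : ℕ} [NeZero n] {k : Type} [CommRing k]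

/-- composition with multiplication by a unit -/
def tw (u : (Zm n)ˣ) : Lam (Zm n) k →+* Lam (Zm n) k where
  toFun f := ⟨fun x => f.c (u * x)⟩
  map_one' := by ext x; simp [one_c]
  map_zero' := rfl
  map_add' _ _ := rfl
  map_mul' f g := by
    ext x
    simp only [mul_c]
    exact (Fintype.sum_equiv (Units.mulLeft u) _ _ (fun w => by simp [mul_sub])).symm

@[simp] lemma tw_c (u : (Zm n)ˣ) (f : Lam (Zm n) k) (x : Zm n) : (tw u f).c x = f.c (u * x) := rfl

/-- even part -/
def ev (f : Lam (Zm n) k) : Lam (Zm n) k := ⟨fun x => if par x = 0 then f.c x else 0⟩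
/-- odd part -/
def od (f : Lam (Zm n) k) : Lam (Zm n) k := ⟨fun x => if par x = 0 then 0 else f.c x⟩

/-- The element `z` of the group ring. -/
def Z : Lam (Zm n) k := d zz

@[simp] lemma Z_mul_c (f : Lam (Zm n) k) (x : Zm n) : (Z * f).c x = f.c (x + zz) := by
  rw [Z, d_mul_c, sub_eq_add_neg, neg_zz]
lemma Z_mul_Z : (Z * Z : Lam (Zm n) k) = 1 := by rw [Z, d_mul_d, zz_add, d_zero]
@[simp] lemma Z_mul_Z_mul (f : Lam (Zm n) k) : Z * (Z * f) = f := by rw [← mul_assoc, Z_mul_Z, one_mul]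
@[simp] lemma inv_Z : inv (Z : Lam (Zm n) k) = Z := by rw [Z, inv_d, neg_zz]
lemma aug_Z : aug (Z : Lam (Zm n) k) = 1 := aug_d _

def IsEv (f : Lam (Zm n) k) : Prop := ∀ x, par x = 1 → f.c x = 0
def IsOd (f : Lam (Zm n) k) : Prop := ∀ x, par x = 0 → f.c x = 0

lemma ev_add_od (f : Lam (Zm n) k) : ev f + od f = f := by
  ext x; simp only [add_c, ev, od]; split_ifs <;> simp

lemma isEv_ev (f : Lam (Zm n) k) : IsEv (ev f) := fun x hx => by simp [ev, hx]
lemma isOd_od (f : Lam (Zm n) k) : IsOd (od f) := fun x hx => by simp [od, hx]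

lemma ev_eq {f a b : Lam (Zm n) k} (h : f = a + b) (ha : IsEv a) (hb : IsOd b) : ev f = a := by
  subst h; ext x
  rcases par_cases x with hx | hx
  · simp [ev, hx, hb x hx]
  · simp [ev, hx, ha x hx]
lemma od_eq {f a b : Lam (Zm n) k} (h : f = a + b) (ha : IsEv a) (hb : IsOd b) : od f = b := by
  subst h; ext x
  rcases par_cases x with hx | hx
  · simp [od, hx, hb x hx]
  · simp [od, hx, ha x hx]

lemma IsEv.add {a b : Lam (Zm n) k} (ha : IsEv a) (hb : IsEv b) : IsEv (a + b) := fun x hx => by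
  simp [ha x hx, hb x hx]
lemma IsOd.add {a b : Lam (Zm n) k} (ha : IsOd a) (hb : IsOd b) : IsOd (a + b) := fun x hx => by
  simp [ha x hx, hb x hx]
lemma IsEv.mul {a b : Lam (Zm n) k} (ha : IsEv a) (hb : IsEv b) : IsEv (a * b) := fun x hx => by
  rw [mul_c]; refine Finset.sum_eq_zero fun y _ => ?_
  rcases par_cases y with hy | hy
  · rw [hb (x - y) (by rw [map_sub, hx, hy]; decide), mul_zero]
  · rw [ha y hy, zero_mul]
lemma IsOd.mul {a b : Lam (Zm n) k} (ha : IsOd a) (hb : IsOd b) : IsEv (a * b) := fun x hx => by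
  rw [mul_c]; refine Finset.sum_eq_zero fun y _ => ?_
  rcases par_cases y with hy | hy
  · rw [ha y hy, zero_mul]
  · rw [hb (x - y) (by rw [map_sub, hx, hy]; decide), mul_zero]
lemma IsEv.mul_od {a b : Lam (Zm n) k} (ha : IsEv a) (hb : IsOd b) : IsOd (a * b) := fun x hx => by
  rw [mul_c]; refine Finset.sum_eq_zero fun y _ => ?_
  rcases par_cases y with hy | hy
  · rw [hb (x - y) (by rw [map_sub, hx, hy]; decide), mul_zero]
  · rw [ha y hy, zero_mul]
lemma IsOd.mul_ev {a b : Lam (Zm n) k} (ha : IsOd a) (hb : IsEv b) : IsOd (a * b) := by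
  rw [mul_comm]; exact hb.mul_od ha
lemma IsEv.inv {a : Lam (Zm n) k} (ha : IsEv a) : IsEv (Lam.inv a) := fun x hx => by
  rw [inv_c, ha]; rw [map_neg, hx]; decide
lemma IsOd.inv {a : Lam (Zm n) k} (ha : IsOd a) : IsOd (Lam.inv a) := fun x hx => by
  rw [inv_c, ha]; rw [map_neg, hx]; decide
lemma isEv_C (a : k) : IsEv (C a : Lam (Zm n) k) := fun x hx => by
  rw [C_c, if_neg]; rintro rfl; simp at hx
lemma isEv_Z : IsEv (Z : Lam (Zm n) k) := fun x hx => by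
  rw [Z, d_c, if_neg]; rintro rfl; simp at hx
lemma isEv_zero : IsEv (0 : Lam (Zm n) k) := fun x hx => rfl
lemma isOd_zero : IsOd (0 : Lam (Zm n) k) := fun x hx => rfl

@[simp] lemma ev_add (f g : Lam (Zm n) k) : ev (f + g) = ev f + ev g := by
  ext x; simp only [add_c, ev]; split_ifs <;> simp
@[simp] lemma od_add (f g : Lam (Zm n) k) : od (f + g) = od f + od g := by
  ext x; simp only [add_c, od]; split_ifs <;> simp

@[simp] lemma ev_mul (f g : Lam (Zm n) k) : ev (f * g) = ev f * ev g + od f * od g := by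
  refine ev_eq (b := ev f * od g + od f * ev g) ?_ ?_ ?_
  · conv_lhs => rw [← ev_add_od f, ← ev_add_od g]
    ring
  · exact ((isEv_ev _).mul (isEv_ev _)).add ((isOd_od _).mul (isOd_od _))
  · exact ((isEv_ev _).mul_od (isOd_od _)).add ((isOd_od _).mul_ev (isEv_ev _))
@[simp] lemma od_mul (f g : Lam (Zm n) k) : od (f * g) = ev f * od g + od f * ev g := by
  refine od_eq (a := ev f * ev g + od f * od g) ?_ ?_ ?_
  · conv_lhs => rw [← ev_add_od f, ← ev_add_od g]
    ring
  · exact ((isEv_ev _).mul (isEv_ev _)).add ((isOd_od _).mul (isOd_od _))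
  · exact ((isEv_ev _).mul_od (isOd_od _)).add ((isOd_od _).mul_ev (isEv_ev _))

@[simp] lemma ev_inv (f : Lam (Zm n) k) : ev (inv f) = inv (ev f) := by
  ext x; simp [ev]
@[simp] lemma od_inv (f : Lam (Zm n) k) : od (inv f) = inv (od f) := by
  ext x; simp [od]
@[simp] lemma ev_sg (f : Lam (Zm n) k) : ev (tw sgU f) = inv (ev f) := by
  ext x
  rcases par_cases x with hx | hx
  · simp [ev, hx, sg_even hx]
  · simp [ev, hx]
@[simp] lemma od_sg (f : Lam (Zm n) k) : od (tw sgU f) = Z * inv (od f) := by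
  ext x
  rcases par_cases x with hx | hx
  · simp [od, hx]
  · simp only [od, hx, tw_c, sg_odd hx, Z_mul_c, inv_c]
    simp [hx, add_comm]
@[simp] lemma ev_C (a : k) : ev (C a : Lam (Zm n) k) = C a := by
  refine ev_eq (b := 0) (by simp) (isEv_C a) isOd_zero
@[simp] lemma od_C (a : k) : od (C a : Lam (Zm n) k) = 0 := by
  refine od_eq (a := C a) (by simp) (isEv_C a) isOd_zero
@[simp] lemma ev_zero : ev (0 : Lam (Zm n) k) = 0 := by ext; simp [ev]
@[simp] lemma od_zero : od (0 : Lam (Zm n) k) = 0 := by ext; simp [od]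
lemma ev_c_even {f : Lam (Zm n) k} {x : Zm n} (h : par x = 0) : (ev f).c x = f.c x := by simp [ev, h]
lemma od_c_odd {f : Lam (Zm n) k} {x : Zm n} (h : par x = 1) : (od f).c x = f.c x := by simp [od, h]
lemma tw_sg_eq (f : Lam (Zm n) k) : tw sgU f = inv (ev f) + Z * inv (od f) := by
  rw [← ev_add_od (tw sgU f), ev_sg, od_sg]
lemma tw_sg_sg (f : Lam (Zm n) k) : tw sgU (tw sgU f) = f := by ext x; simp [sg_sg]

/-- fibres of doubling -/
lemma push_two_c (f : Lam (Zm n) k) (φ : Zm n →+ Zm n) (hφ : ∀ x, φ x = 2 • x) (x : Zm n) :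
    (push φ f).c (2 * x) = f.c x + f.c (x + zz) := by
  rw [push_c, ← Finset.sum_filter]
  have : (Finset.univ.filter fun y => φ y = 2 * x) = {x, x + zz} := by
    ext y
    simp only [Finset.mem_filter, Finset.mem_univ, true_and, Finset.mem_insert, Finset.mem_singleton,
      hφ, two_nsmul, ← two_mul, two_mul_eq_iff]
  rw [this, Finset.sum_pair]
  intro h; exact zz_ne (n := n) (by simpa using h)

lemma sq_c (f : Lam (Zm n) (ZMod 2)) (x : Zm n) : (f ^ 2).c (2 * x) = f.c x + f.c (x + zz) := by
  have : Fact (Nat.Prime 2) := ⟨Nat.prime_two⟩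
  rw [pow_char 2 f (nsmulAddMonoidHom 2) (fun _ => rfl), push_two_c _ _ (fun _ => rfl)]

end parity
end Lam

set_option linter.unusedSectionVars false
set_option linter.unusedVariables false
set_option linter.unusedSimpArgs false
open Lam

/-- Elements of the group ring of the semidihedral group. -/
@[ext] structure El (n : ℕ) (k : Type) where
  R : Lam (Zm n) k
  S : Lam (Zm n) k

namespace El
section
variable {n : ℕ} [NeZero n] {k : Type} [CommRing k]

instance : Mul (El n k) := ⟨fun y y' => ⟨y.R * y'.R + y.S * tw sgU y'.S, y.R * y'.S + y.S * tw sgU y'.R⟩⟩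
instance : One (El n k) := ⟨⟨1, 0⟩⟩

lemma mul_R (y y' : El n k) : (y * y').R = y.R * y'.R + y.S * tw sgU y'.S := rfl
lemma mul_S (y y' : El n k) : (y * y').S = y.R * y'.S + y.S * tw sgU y'.R := rfl
lemma one_R : (1 : El n k).R = 1 := rfl
lemma one_S : (1 : El n k).S = 0 := rfl

/-- matrix representation -/
def mat (y : El n k) : Matrix (Fin 2) (Fin 2) (Lam (Zm n) k) :=
  !![y.R, y.S; tw sgU y.S, tw sgU y.R]

lemma mat_inj {y y' : El n k} (h : y.mat = y'.mat) : y = y' := by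
  have h0 := congrFun (congrFun h 0) 0
  have h1 := congrFun (congrFun h 0) 1
  simp [mat] at h0 h1
  exact El.ext h0 h1

lemma mat_mul (y y' : El n k) : (y * y').mat = y.mat * y'.mat := by
  simp only [mat, mul_R, mul_S, map_add, map_mul, tw_sg_sg, Matrix.mul_fin_two]
  congr 1
  ext i j
  fin_cases i <;> fin_cases j <;> simp <;> ring

lemma mat_one : (1 : El n k).mat = 1 := by
  simp only [mat, one_R, one_S, map_one, map_zero, Matrix.one_fin_two]

instance : Monoid (El n k) where
  mul_assoc a b c := mat_inj (by simp only [mat_mul, mul_assoc])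
  one_mul a := mat_inj (by simp only [mat_mul, mat_one, one_mul])
  mul_one a := mat_inj (by simp only [mat_mul, mat_one, mul_one])

lemma mat_pow (y : El n k) (j : ℕ) : (y ^ j).mat = y.mat ^ j := by
  induction j with
  | zero => simp [mat_one]
  | succ j ih => rw [pow_succ, mat_mul, ih, pow_succ]

lemma mat_trace (y : El n k) : y.mat.trace = y.R + tw sgU y.R := by
  simp [mat, Matrix.trace_fin_two]

/-- coefficient -/
def val {k : Type} (y : El n k) : Zm n × Bool → k := fun g => if g.2 then y.S.c g.1 else y.R.c g.1
@[simp] lemma val_f {k : Type} (y : El n k) (x : Zm n) : y.val (x, false) = y.R.c x := rfl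
@[simp] lemma val_t {k : Type} (y : El n k) (x : Zm n) : y.val (x, true) = y.S.c x := rfl

lemma ext_val {k : Type} {y y' : El n k} (h : ∀ g, y.val g = y'.val g) : y = y' := by
  ext x
  · exact h (x, false)
  · exact h (x, true)

/-- from a function -/
def of {k : Type} (f : Zm n × Bool → k) : El n k := ⟨⟨fun x => f (x, false)⟩, ⟨fun x => f (x, true)⟩⟩
@[simp] lemma of_val {k : Type} (f : Zm n × Bool → k) (g) : (of f).val g = f g := by
  obtain ⟨x, i⟩ := g
  cases i <;> rfl

/-- pointwise map -/
def map {k k' : Type} (φ : k → k') (y : El n k) : El n k' := of (fun g => φ (y.val g))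
@[simp] lemma map_val {k k' : Type} (φ : k → k') (y : El n k) (g) : (y.map φ).val g = φ (y.val g) := by
  simp [map]
@[simp] lemma map_R {k k' : Type} (φ : k → k') (y : El n k) (x) : (y.map φ).R.c x = φ (y.R.c x) := rfl
@[simp] lemma map_S {k k' : Type} (φ : k → k') (y : El n k) (x) : (y.map φ).S.c x = φ (y.S.c x) := rfl

protected lemma map_mul {k' : Type} [CommRing k'] (φ : k →+* k') (y y' : El n k) :
    (y * y').map φ = y.map φ * y'.map φ := by
  have h1 : ∀ y : El n k, (y.map φ).R = pmap φ y.R := fun y => rfl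
  have h2 : ∀ y : El n k, (y.map φ).S = pmap φ y.S := fun y => rfl
  have h3 : ∀ f : Lam (Zm n) k, tw sgU (pmap φ f) = pmap φ (tw sgU f) := fun y => rfl
  ext1 <;> simp only [mul_R, mul_S, h1, h2, h3, ← _root_.map_mul, ← map_add]

lemma map_one' {k' : Type} [CommRing k'] (φ : k →+* k') : (1 : El n k).map φ = 1 := by
  have h1 : ((1 : El n k).map φ).R = pmap φ 1 := rfl
  have h2 : ((1 : El n k).map φ).S = pmap φ 0 := rfl
  ext1
  · rw [h1, map_one]; rfl
  · rw [h2, map_zero]; rfl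

protected lemma map_pow {k' : Type} [CommRing k'] (φ : k →+* k') (y : El n k) (j : ℕ) :
    (y ^ j).map φ = y.map φ ^ j := by
  induction j with
  | zero => simp [map_one']
  | succ j ih => rw [pow_succ, El.map_mul, ih, pow_succ]

/-- parts -/
def E (y : El n k) := ev y.R
def O (y : El n k) := od y.R
def P (y : El n k) := ev y.S
def Q (y : El n k) := od y.S
lemma R_eq (y : El n k) : y.R = y.E + y.O := (ev_add_od _).symm
lemma S_eq (y : El n k) : y.S = y.P + y.Q := (ev_add_od _).symm

/-- inversion of group elements -/
def ginv (g : Zm n × Bool) : Zm n × Bool := if g.2 then (-(((sgU : (Zm n)ˣ) : Zm n) * g.1), true) else (-g.1, false)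

/-- symmetric elements -/
structure Sym (y : El n k) : Prop where
  E : inv y.E = y.E
  O : inv y.O = y.O
  Q : Z * y.Q = y.Q

lemma sym_of (y : El n k) (h : ∀ g, y.val (ginv g) = y.val g) : y.Sym := by
  have hR : inv y.R = y.R := by
    ext x; exact h (x, false)
  have hS : inv (tw sgU y.S) = y.S := by
    ext x
    have := h (x, true)
    simp only [ginv, val_t, if_true] at this
    simpa using this
  refine ⟨?_, ?_, ?_⟩
  · rw [E, ← ev_inv, hR]
  · rw [O, ← od_inv, hR]
  · conv_rhs => rw [Q, ← hS, od_inv, od_sg]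
    rw [_root_.map_mul, Lam.inv_inv, inv_Z]; rfl

lemma Sym.twR {y : El n k} (h : y.Sym) : tw sgU y.R = y.E + Z * y.O := by
  rw [tw_sg_eq]; change inv y.E + Z * inv y.O = _; rw [h.E, h.O]
lemma Sym.Qi {y : El n k} (h : y.Sym) : Z * inv y.Q = inv y.Q := by
  conv_rhs => rw [← h.Q, _root_.map_mul, inv_Z]
lemma Sym.twS {y : El n k} (h : y.Sym) : tw sgU y.S = inv y.P + inv y.Q := by
  rw [tw_sg_eq]; change inv y.P + Z * inv y.Q = _; rw [h.Qi]

lemma mul_E (y y' : El n k) : (y * y').E = y.E * y'.E + y.O * y'.O + y.P * inv y'.P + y.Q * (Z * inv y'.Q) := by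
  simp only [E, O, P, Q, mul_R, ev_add, ev_mul, ev_sg, od_sg]; ring
lemma mul_O (y y' : El n k) : (y * y').O = y.E * y'.O + y.O * y'.E + y.P * (Z * inv y'.Q) + y.Q * inv y'.P := by
  simp only [E, O, P, Q, mul_R, od_add, od_mul, ev_sg, od_sg]; ring
lemma mul_P (y y' : El n k) : (y * y').P = y.E * y'.P + y.O * y'.Q + y.P * inv y'.E + y.Q * (Z * inv y'.O) := by
  simp only [E, O, P, Q, mul_S, ev_add, ev_mul, ev_sg, od_sg]; ring
lemma mul_Q (y y' : El n k) : (y * y').Q = y.E * y'.Q + y.O * y'.P + y.P * (Z * inv y'.O) + y.Q * inv y'.E := by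
  simp only [E, O, P, Q, mul_S, od_add, od_mul, ev_sg, od_sg]; ring

lemma Sym.sq_E {y : El n k} (h : y.Sym) : (y * y).E = y.E ^ 2 + y.O ^ 2 + y.P * inv y.P + y.Q * inv y.Q := by
  rw [mul_E, h.Qi]; ring
lemma Sym.sq_O {y : El n k} (h : y.Sym) : (y * y).O = 2 * (y.E * y.O) + y.P * inv y.Q + y.Q * inv y.P := by
  rw [mul_O, h.Qi]; ring
lemma Sym.sq_P {y : El n k} (h : y.Sym) : (y * y).P = 2 * (y.E * y.P) + 2 * (y.O * y.Q) := by
  rw [mul_P, h.E, h.O]; linear_combination y.O * h.Q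
lemma Sym.sq_Q {y : El n k} (h : y.Sym) : (y * y).Q = 2 * (y.E * y.Q) + (1 + Z) * (y.O * y.P) := by
  rw [mul_Q, h.E, h.O]; ring

/-- constant off the identity -/
def Triv {k : Type} (y : El n k) : Prop := ∃ c, ∀ g, g ≠ (0, false) → y.val g = c

/-- zero-one valued -/
def IsSet (y : El n ℤ) : Prop := ∀ g, y.val g = 0 ∨ y.val g = 1

/-- shift the value at the identity -/
def add1 (y : El n k) (c : k) : El n k := ⟨y.R + C c, y.S⟩
lemma add1_val (y : El n k) (c : k) (g) : (y.add1 c).val g = y.val g + if g = (0, false) then c else 0 := by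
  obtain ⟨x, i⟩ := g
  cases i <;> simp [add1, val, C_c]

open Classical in
/-- indicator function -/
noncomputable def ind {k : Type} (k' : Type) [CommRing k'] (v : k) : k → k' := fun t => if t = v then 1 else 0

lemma ind_eq {k : Type} {k' : Type} [CommRing k'] [Nontrivial k'] {v t : k} (h : ind k' v t = 1) : t = v := by
  unfold ind at h; by_contra h'; simp [h'] at h
@[simp] lemma ind_self {k : Type} {k' : Type} [CommRing k'] (v : k) : ind k' v v = 1 := by simp [ind]
lemma ind_ne {k : Type} {k' : Type} [CommRing k'] {v t : k} (h : t ≠ v) : ind k' v t = 0 := by simp [ind, h]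

lemma triv_of_ind {k : Type} (k' : Type) [CommRing k'] [Nontrivial k'] (y : El n k)
    (h : ∀ v, Triv (y.map (ind k' v))) : Triv y := by
  refine ⟨y.val (0, true), fun g hg => ?_⟩
  obtain ⟨c, hc⟩ := h (y.val (0, true))
  have h1 := hc g hg
  have h2 := hc (0, true) (by simp)
  simp only [map_val] at h1 h2
  rw [← h1] at h2
  exact ind_eq (k' := k') (by rw [← h2, ind_self])

lemma isSet_ind {k : Type} (y : El n k) (v : k) : IsSet (y.map (ind ℤ v)) := by
  intro g
  rw [map_val]; unfold ind; split_ifs <;> simp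

end
end El

set_option linter.unusedSectionVars false
set_option linter.unusedVariables false
set_option linter.unusedSimpArgs false
open Lam El

/-- invariance under a relation -/
def Mem {n : ℕ} {k : Type} (r : Zm n × Bool → Zm n × Bool → Prop) (y : El n k) : Prop :=
  ∀ g h, r g h → y.val g = y.val h

/-- Schur ring data over the semidihedral group coming from a primitive group. -/
structure SR (n : ℕ) [NeZero n] where
  r : Zm n × Bool → Zm n × Bool → Prop
  eqv : Equivalence r
  one_cls : ∀ g, r (0, false) g → g = (0, false)
  mul_mem : ∀ {k : Type} [CommRing k] (y y' : El n k), Mem r y → Mem r y' → Mem r (y * y')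
  star_mem : ∀ g h, r g h → r (ginv g) (ginv h)
  prim1 : ∀ {k : Type} [CommRing k] (y : El n k) (u : Zm n), u ≠ 0 → Mem r y → d u * y.R = y.R →
    d u * y.S = y.S → ∃ c, ∀ g, y.val g = c
  prim2 : ∀ {k : Type} [CommRing k] (y : El n k), Mem r y → y.S = 0 → ∃ c, y.R = C c
  prim3 : ∀ {k : Type} [CommRing k] (y : El n k) (x : Zm n), Mem r y →
    (∀ g, g ≠ (x, true) → y.val g = 0) → y.val (x, true) = 0

namespace SR
section
variable {n : ℕ} [NeZero n] (A : SR n) {k : Type} [CommRing k]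

lemma map_mem {k k' : Type} {y : El n k} (h : Mem A.r y) (φ : k → k') : Mem A.r (y.map φ) := by
  intro g g' hg; simp [h g g' hg]

lemma one_mem : Mem A.r (1 : El n k) := by
  intro g h hgh
  by_cases hg : g = (0, false)
  · subst hg; rw [A.one_cls h hgh]
  · by_cases hh : h = (0, false)
    · subst hh; exact absurd (A.one_cls g (A.eqv.symm hgh)) hg
    · have : ∀ g : Zm n × Bool, g ≠ (0, false) → (1 : El n k).val g = 0 := by
        rintro ⟨x, i⟩ hg
        cases i
        · simp at hg; simp [one_R, one_c, hg]
        · simp [one_S]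
      rw [this g hg, this h hh]

lemma pow_mem {y : El n k} (h : Mem A.r y) (j : ℕ) : Mem A.r (y ^ j) := by
  induction j with
  | zero => rw [pow_zero]; exact A.one_mem
  | succ j ih => rw [pow_succ]; exact A.mul_mem _ _ ih h

lemma add1_mem {y : El n k} (h : Mem A.r y) (c : k) : Mem A.r (y.add1 c) := by
  intro g g' hg
  rw [add1_val, add1_val, h g g' hg]
  congr 1
  by_cases h1 : g = (0, false)
  · subst h1; rw [A.one_cls g' hg]
  · by_cases hh : g' = (0, false)
    · subst hh; exact absurd (A.one_cls g (A.eqv.symm hg)) h1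
    · simp [h1, hh]

lemma odd_periodic_of_sq {f : Lam (Zm n) (ZMod 2)} {c : ZMod 2} (h : f ^ 2 = C c) (x : Zm n) (h0 : x ≠ 0)
    (hz : x ≠ zz) : f.c (x + zz) = f.c x := by
  have h1 := sq_c f x
  rw [h, C_c, if_neg (by rw [two_mul_eq_zero]; tauto)] at h1
  have : ∀ a b : ZMod 2, 0 = a + b → b = a := by decide
  exact this _ _ h1

lemma two_lam (f : Lam (Zm n) (ZMod 2)) : 2 * f = 0 := by
  rw [two_mul, CharTwo.add_self_eq_zero]

/-- L1 -/
lemma r_ginv (g : Zm n × Bool) : A.r g (ginv g) := by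
  classical
  let T : El n (ZMod 2) := El.of (fun h => if A.r g h then 1 else 0)
  have hT : Mem A.r T := by
    intro a b hab
    simp only [T, of_val]
    have : A.r g a ↔ A.r g b := ⟨fun h => A.eqv.trans h hab, fun h => A.eqv.trans h (A.eqv.symm hab)⟩
    simp [this]
  let K : El n (ZMod 2) := El.of (fun h => T.val h + T.val (ginv h))
  have hK : Mem A.r K := by
    intro a b hab
    simp only [K, of_val]
    rw [hT a b hab, hT _ _ (A.star_mem a b hab)]
  have hKR : K.R = T.R + inv T.R := rfl
  have hKS : K.S = T.S + inv (tw sgU T.S) := by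
    ext x; simp [K, El.of, ginv, val]
  have hcc : ∀ f : Lam (Zm n) (ZMod 2), f + f = 0 := fun f => CharTwo.add_self_eq_zero f
  have hP : K.P = 0 := by
    rw [El.P, hKS, ev_add, ev_inv, ev_sg, Lam.inv_inv, hcc]
  have hQ : Z * K.Q = K.Q := by
    rw [El.Q, hKS, od_add, od_inv, od_sg, map_mul, Lam.inv_inv, inv_Z, mul_add, Z_mul_Z_mul, add_comm]
  have hS : K.Sym := by
    refine ⟨?_, ?_, hQ⟩
    · rw [El.E, hKR, ev_add, ev_inv, map_add, Lam.inv_inv, add_comm]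
    · rw [El.O, hKR, od_add, od_inv, map_add, Lam.inv_inv, add_comm]
  have h2P : (K * K).P = 0 := by rw [hS.sq_P, two_lam, two_lam, add_zero]
  have h2Q : (K * K).Q = 0 := by rw [hS.sq_Q, hP, two_lam, mul_zero, mul_zero, add_zero]
  have h2S : (K * K).S = 0 := by rw [S_eq, h2P, h2Q, add_zero]
  obtain ⟨c, hc⟩ := A.prim2 _ (A.mul_mem _ _ hK hK) h2S
  have hQQ : K.Q * inv K.Q = 0 := mul_eq_zero_of_periodic zz 2 addOrderOf_zz _ _ hS.Q hS.Qi
  have hR2 : K.R ^ 2 = C c := by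
    rw [← hc, R_eq (K * K), hS.sq_E, hS.sq_O, hP, hQQ, R_eq K]
    simp; ring
  have hZR : Z * K.R = K.R := by
    ext x
    rw [Z_mul_c]
    have h0 : K.R.c 0 = 0 := by
      rw [hKR]; simp [CharTwo.add_self_eq_zero]
    have hz : K.R.c zz = 0 := by
      rw [hKR]; simp [CharTwo.add_self_eq_zero]
    by_cases hx0 : x = 0
    · rw [hx0, zero_add, h0, hz]
    by_cases hxz : x = zz
    · rw [hxz, zz_add, h0, hz]
    exact odd_periodic_of_sq hR2 x hx0 hxz
  obtain ⟨t, ht⟩ := A.prim1 K zz zz_ne hK hZR (by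
    change Z * K.S = K.S
    rw [S_eq, hP, zero_add, hQ])
  have ht0 : t = 0 := by
    rw [← ht (0, false)]; simp [hKR, CharTwo.add_self_eq_zero]
  have h1 := ht g
  rw [ht0] at h1
  simp only [K, T, of_val] at h1
  rw [if_pos (A.eqv.refl g)] at h1
  by_contra hne
  rw [if_neg hne] at h1
  exact absurd h1 (by decide)

lemma sym {y : El n k} (h : Mem A.r y) : y.Sym :=
  sym_of y (fun g => (h _ _ (A.r_ginv g)).symm)

lemma ZS {y : El n k} (h : Mem A.r y) (hP : Z * y.P = y.P) : Z * y.S = y.S := by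
  rw [S_eq, mul_add, hP, (A.sym h).Q]

/-- L2 -/
lemma bal {y : El n k} (h : Mem A.r y) (hS : Z * y.S = y.S)
    (hR : ∀ x, x ≠ 0 → x ≠ zz → y.R.c (x + zz) = y.R.c x) : Triv y := by
  obtain ⟨c, hc⟩ := A.prim1 (y.add1 (y.R.c zz - y.R.c 0)) zz zz_ne (A.add1_mem h _) (by
    change Z * (y.R + C _) = y.R + C _
    ext x
    rw [Z_mul_c, add_c, add_c, C_c, C_c]
    by_cases h0 : x = 0
    · subst h0; simp [zz_ne]
    by_cases hz : x = zz
    · subst hz; simp [zz_add, zz_ne]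
    · rw [hR x h0 hz, if_neg h0, if_neg (by rw [← eq_neg_iff_add_eq_zero, neg_zz]; exact hz)]) hS
  refine ⟨c, fun g hg => ?_⟩
  have := hc g
  rwa [add1_val, if_neg hg, add_zero] at this

lemma periodic_inv {f : Lam (Zm n) k} (h : Z * f = f) : Z * inv f = inv f := by
  conv_rhs => rw [← h, map_mul, inv_Z]

/-- L3 -/
lemma sq_two {y : El n (ZMod 2)} (h : Mem A.r y) : ∃ t, (y * y).R = C t ∧ (y * y).S = 0 := by
  have hS := A.sym h
  have h2 := A.mul_mem _ _ h h
  have h4 := A.mul_mem _ _ h2 h2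
  have hS2 := A.sym h2
  have hP2 : (y * y).P = 0 := by rw [hS.sq_P, two_lam, two_lam, add_zero]
  have hQ2 : (y * y).Q * inv (y * y).Q = 0 :=
    mul_eq_zero_of_periodic zz 2 addOrderOf_zz _ _ hS2.Q hS2.Qi
  have hS4 : (y * y * (y * y)).S = 0 := by
    rw [S_eq, hS2.sq_P, hS2.sq_Q, hP2, two_lam, two_lam, two_lam]; simp
  obtain ⟨c, hc⟩ := A.prim2 _ h4 hS4
  have hR : (y * y).R ^ 2 = C c := by
    rw [← hc, R_eq (y * y * (y * y)), hS2.sq_E, hS2.sq_O, hP2, hQ2, R_eq (y * y)]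
    simp; ring
  obtain ⟨e, he⟩ := A.bal h2 (A.ZS h2 (by rw [hP2, mul_zero])) (odd_periodic_of_sq hR)
  have he0 : e = 0 := by
    rw [← he (0, true) (by simp), val_t, S_eq, hP2, add_c, zero_c, zero_add]
    exact isOd_od _ _ (map_zero _)
  subst he0
  refine ⟨(y * y).R.c 0, ?_, ?_⟩
  · ext x
    rw [C_c]
    split_ifs with hx
    · rw [hx]
    · exact he (x, false) (by simp [hx])
  · ext x
    exact he (x, true) (by simp)

lemma periodic_iff {f : Lam (Zm n) k} : Z * f = f ↔ ∀ x, f.c (x + zz) = f.c x := by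
  constructor
  · intro h x
    rw [← Z_mul_c, h]
  · intro h; ext x; rw [Z_mul_c, h]

lemma par_add_zz (x : Zm n) : par (x + zz) = par x := by simp

lemma ev_periodic_iff {f : Lam (Zm n) k} : Z * ev f = ev f ↔ ∀ x, par x = 0 → f.c (x + zz) = f.c x := by
  rw [periodic_iff]
  constructor
  · intro h x hx
    have := h x
    simpa [ev, hx] using this
  · intro h x
    simp only [ev, par_add_zz]
    split_ifs with hx
    · exact h x hx
    · rfl
lemma od_periodic_iff {f : Lam (Zm n) k} : Z * od f = od f ↔ ∀ x, par x = 1 → f.c (x + zz) = f.c x := by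
  rw [periodic_iff]
  constructor
  · intro h x hx
    have := h x
    simpa [od, hx] using this
  · intro h x
    simp only [od, par_add_zz]
    split_ifs with hx
    · rfl
    · exact h x ((ne_zero_iff_par x).1 hx)

/-- L4 -/
lemma LZ {y : El n k} (h : Mem A.r y) (hO : Z * y.O = y.O) (hP : Z * y.P = y.P) : Triv y := by
  refine triv_of_ind (ZMod 2) y fun v => ?_
  set w := y.map (ind (ZMod 2) v) with hw
  have hm : Mem A.r w := A.map_mem h _
  have hO' : Z * w.O = w.O := by
    refine od_periodic_iff.2 fun x hx => ?_
    rw [hw, map_R, map_R, od_periodic_iff.1 hO x hx]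
  have hP' : Z * w.P = w.P := by
    refine ev_periodic_iff.2 fun x hx => ?_
    rw [hw, map_S, map_S, ev_periodic_iff.1 hP x hx]
  have hS := A.sym hm
  obtain ⟨t, ht, -⟩ := A.sq_two hm
  have hE : w.E ^ 2 = C t := by
    have h1 : (w * w).E = C t := by rw [El.E, ht, ev_C]
    rw [hS.sq_E, pow_two w.O, mul_eq_zero_of_periodic zz 2 addOrderOf_zz _ _ hO' hO',
      mul_eq_zero_of_periodic zz 2 addOrderOf_zz _ _ hP' (periodic_inv hP'),
      mul_eq_zero_of_periodic zz 2 addOrderOf_zz _ _ hS.Q hS.Qi] at h1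
    simpa using h1
  refine A.bal hm (A.ZS hm hP') fun x h0 hz => ?_
  rw [R_eq, add_c, add_c, odd_periodic_of_sq hE x h0 hz, periodic_iff.1 hO']

lemma sq_triv {y : El n k} (h : Mem A.r y) (hE : Z * y.E = y.E) : Triv (y * y) := by
  have hS := A.sym h
  refine A.LZ (A.mul_mem _ _ h h) ?_ ?_
  · rw [hS.sq_O]
    linear_combination 2 * y.O * hE + y.P * hS.Qi + inv y.P * hS.Q
  · rw [hS.sq_P]
    linear_combination 2 * y.P * hE + 2 * y.O * hS.Q

end
end SR

set_option linter.unusedSectionVars false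
set_option linter.unusedVariables false
set_option linter.unusedSimpArgs false
open Lam El

namespace Lam
variable {n : ℕ} [NeZero n]
/-- zero-one coefficients -/
def Bin (f : Lam (Zm n) ℤ) : Prop := ∀ x, f.c x = 0 ∨ f.c x = 1

lemma aug_ev_all {k : Type} [CommRing k] : aug (ev all : Lam (Zm n) k) = 2 * n := by
  have h : (Finset.univ.filter fun x : Zm n => par x = 0).card = 2 * n := by
    have h1 : (Finset.univ.filter fun x : Zm n => par x = 0).card =
        (Finset.univ.filter fun x : Zm n => ¬ par x = 0).card := by
      refine Finset.card_bij (fun x _ => x + 1) ?_ ?_ ?_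
      · intro x hx; simp at hx ⊢; rw [hx]; simp
      · intro x _ y _ h; simpa using h
      · intro y hy; simp at hy
        refine ⟨y - 1, ?_, by simp⟩
        have := (ne_zero_iff_par y).1 hy
        simp [this]
    have h2 := Finset.card_filter_add_card_filter_not (s := (Finset.univ : Finset (Zm n))) (fun x : Zm n => par x = 0)
    rw [Finset.card_univ, ZMod.card] at h2
    omega
  rw [aug_apply]
  simp only [ev, all_c]
  rw [Finset.sum_boole, h]; push_cast; ring

lemma aug_all {k : Type} [CommRing k] : aug (all : Lam (Zm n) k) = 4 * n := by
  rw [aug_apply]; simp [ZMod.card]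

lemma aug_od_all {k : Type} [CommRing k] : aug (od all : Lam (Zm n) k) = 2 * n := by
  have h : aug (ev all : Lam (Zm n) k) + aug (od all : Lam (Zm n) k) = 4 * n := by
    rw [← map_add, ev_add_od, aug_all (n := n)]
  rw [aug_ev_all] at h
  linear_combination h

lemma Bin.sq {f : Lam (Zm n) ℤ} (h : Bin f) : (f * inv f).c 0 = aug f := by
  rw [mul_c, aug_apply]
  refine Finset.sum_congr rfl fun x _ => ?_
  rcases h x with hx | hx <;> simp [hx]

lemma Bin.nonneg {f : Lam (Zm n) ℤ} (h : Bin f) (x : Zm n) : 0 ≤ f.c x := by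
  rcases h x with hx | hx <;> simp [hx]
lemma Bin.le_one {f : Lam (Zm n) ℤ} (h : Bin f) (x : Zm n) : f.c x ≤ 1 := by
  rcases h x with hx | hx <;> simp [hx]
lemma Bin.aug_nonneg {f : Lam (Zm n) ℤ} (h : Bin f) : 0 ≤ aug f :=
  Finset.sum_nonneg fun x _ => h.nonneg x
lemma Bin.ev {f : Lam (Zm n) ℤ} (h : Bin f) : Bin (ev f) := by
  intro x; simp only [Lam.ev]; split_ifs
  · exact h x
  · simp
lemma Bin.od {f : Lam (Zm n) ℤ} (h : Bin f) : Bin (od f) := by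
  intro x; simp only [Lam.od]; split_ifs
  · simp
  · exact h x
lemma Bin.aug_ev_le {f : Lam (Zm n) ℤ} (h : Bin f) : aug (Lam.ev f) ≤ 2 * n := by
  rw [← aug_ev_all (n := n) (k := ℤ)]
  refine Finset.sum_le_sum fun x _ => ?_
  simp only [Lam.ev]
  split_ifs
  · simpa using h.le_one x
  · simp
lemma Bin.aug_od_le {f : Lam (Zm n) ℤ} (h : Bin f) : aug (Lam.od f) ≤ 2 * n := by
  rw [← aug_od_all (n := n) (k := ℤ)]
  refine Finset.sum_le_sum fun x _ => ?_
  simp only [Lam.od]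
  split_ifs
  · simp
  · simpa using h.le_one x
lemma Bin.eq_zero_of_aug {f : Lam (Zm n) ℤ} (h : Bin f) (h0 : aug f = 0) : f = 0 := by
  ext x
  rw [aug_apply, Finset.sum_eq_zero_iff_of_nonneg (fun x _ => h.nonneg x)] at h0
  exact h0 x (Finset.mem_univ _)
lemma Bin.single_of_aug {f : Lam (Zm n) ℤ} (h : Bin f) (h0 : aug f = 1) :
    ∃ x, f.c x = 1 ∧ ∀ y, y ≠ x → f.c y = 0 := by
  have : ∃ x, f.c x ≠ 0 := by
    by_contra hne; push Not at hne
    rw [aug_apply, Finset.sum_eq_zero (fun x _ => hne x)] at h0; omega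
  obtain ⟨x, hx⟩ := this
  have hx1 : f.c x = 1 := (h x).resolve_left hx
  refine ⟨x, hx1, fun y hy => ?_⟩
  rw [aug_apply, ← Finset.add_sum_erase _ _ (Finset.mem_univ x), hx1] at h0
  have h1 : ∑ y ∈ Finset.univ.erase x, f.c y = 0 := by omega
  rw [Finset.sum_eq_zero_iff_of_nonneg (fun x _ => h.nonneg x)] at h1
  exact h1 y (by simp [hy])
end Lam

namespace El
variable {n : ℕ} [NeZero n]
lemma IsSet.R {T : El n ℤ} (h : IsSet T) : Bin T.R := fun x => h (x, false)
lemma IsSet.S {T : El n ℤ} (h : IsSet T) : Bin T.S := fun x => h (x, true)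
lemma IsSet.E {T : El n ℤ} (h : IsSet T) : Bin T.E := h.R.ev
lemma IsSet.O {T : El n ℤ} (h : IsSet T) : Bin T.O := h.R.od
lemma IsSet.P {T : El n ℤ} (h : IsSet T) : Bin T.P := h.S.ev
lemma IsSet.Q {T : El n ℤ} (h : IsSet T) : Bin T.Q := h.S.od

/-- the equations for `T² = α + ν G` -/
structure Sizes (T : El n ℤ) (α ν : ℤ) : Prop where
  hE : (T * T).E = C α + C ν * ev all
  hO : (T * T).O = C ν * od all
  hP : (T * T).P = C ν * ev all
  hQ : (T * T).Q = C ν * od all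
  h1 : (aug T.E) ^ 2 + (aug T.O) ^ 2 + (aug T.P) ^ 2 + (aug T.Q) ^ 2 = α + 2 * n * ν
  h2 : aug T.E * aug T.O + aug T.P * aug T.Q = n * ν
  h3 : aug T.E * aug T.P + aug T.O * aug T.Q = n * ν
  h4 : aug T.E * aug T.Q + aug T.O * aug T.P = n * ν
  hk : aug T.E + aug T.O + aug T.P + aug T.Q = α + ν
  e0 : 0 ≤ aug T.E
  o0 : 0 ≤ aug T.O
  p0 : 0 ≤ aug T.P
  q0 : 0 ≤ aug T.Q
  e1 : aug T.E ≤ 2 * n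
  o1 : aug T.O ≤ 2 * n
  p1 : aug T.P ≤ 2 * n
  q1 : aug T.Q ≤ 2 * n

lemma sizes {T : El n ℤ} (hS : T.Sym) (hT : IsSet T) (ht : Triv (T * T)) : ∃ α ν, Sizes T α ν := by
  obtain ⟨ν, hν⟩ := ht
  have hR : (T * T).R = C ((T * T).R.c 0 - ν) + C ν * all := by
    ext x
    by_cases hx : x = 0
    · subst hx; simp [C_c, -eq_intCast]
    · have := hν (x, false) (by simp [hx])
      simp only [val_f] at this
      simp [C_c, hx, this, -eq_intCast]
  have hSS : (T * T).S = C ν * all := by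
    ext x
    have := hν (x, true) (by simp)
    simp only [val_t] at this
    simp [this, -eq_intCast]
  set α := (T * T).R.c 0 - ν
  have hE : (T * T).E = C α + C ν * ev all := by rw [El.E, hR]; simp [-eq_intCast]
  have hO : (T * T).O = C ν * od all := by rw [El.O, hR]; simp [-eq_intCast]
  have hP : (T * T).P = C ν * ev all := by rw [El.P, hSS]; simp [-eq_intCast]
  have hQ : (T * T).Q = C ν * od all := by rw [El.Q, hSS]; simp [-eq_intCast]
  refine ⟨α, ν, hE, hO, hP, hQ, ?_, ?_, ?_, ?_, ?_, hT.E.aug_nonneg, hT.O.aug_nonneg, hT.P.aug_nonneg,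
    hT.Q.aug_nonneg, hT.R.aug_ev_le, hT.R.aug_od_le, hT.S.aug_ev_le, hT.S.aug_od_le⟩
  · have := congrArg aug hE
    rw [hS.sq_E] at this
    simp only [map_add, map_mul, map_pow, aug_inv, aug_C, aug_ev_all] at this
    linear_combination this
  · have := congrArg aug hO
    rw [hS.sq_O] at this
    simp only [map_add, map_mul, map_pow, aug_inv, aug_C, aug_od_all, map_ofNat] at this
    have h2 : 2 * (aug T.E * aug T.O + aug T.P * aug T.Q) = 2 * (n * ν) := by linear_combination this
    omega
  · have := congrArg aug hP
    rw [hS.sq_P] at this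
    simp only [map_add, map_mul, map_pow, aug_inv, aug_C, aug_ev_all, map_ofNat] at this
    have h2 : 2 * (aug T.E * aug T.P + aug T.O * aug T.Q) = 2 * (n * ν) := by linear_combination this
    omega
  · have := congrArg aug hQ
    rw [hS.sq_Q] at this
    simp only [map_add, map_mul, map_pow, aug_inv, aug_C, aug_od_all, map_ofNat, map_one, aug_Z] at this
    have h2 : 2 * (aug T.E * aug T.Q + aug T.O * aug T.P) = 2 * (n * ν) := by linear_combination this
    omega
  · have := congrArg (fun f => f.c 0) hE
    rw [hS.sq_E, pow_two, pow_two] at this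
    nth_rewrite 2 [← hS.E] at this
    nth_rewrite 2 [← hS.O] at this
    simp only [add_c, hT.E.sq, hT.O.sq, hT.P.sq, hT.Q.sq, C_c, C_mul_c, Lam.ev, all_c] at this
    simpa using this
end El

namespace SR
variable {n : ℕ} [NeZero n] (A : SR n)

lemma no_single_t {T : El n ℤ} (h : Mem A.r T) (hR : T.R = 0) (hT : IsSet T) : aug T.S ≠ 1 := by
  intro h1
  obtain ⟨x, hx, hy⟩ := hT.S.single_of_aug h1
  have := A.prim3 T x h (by
    rintro ⟨y, i⟩ hg
    cases i
    · simp [hR]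
    · exact hy y (by simpa using hg))
  rw [val_t, hx] at this
  exact one_ne_zero this

/-- L6 for sets -/
lemma E_zero_set (hn : 3 ≤ n) {T : El n ℤ} (h : Mem A.r T) (hT : IsSet T) (hE : T.E = 0) : T = ⟨0, 0⟩ := by
  have hS := A.sym h
  obtain ⟨α, ν, H⟩ := sizes hS hT (A.sq_triv h (by rw [hE, mul_zero]))
  have h1 := H.h1; have h2 := H.h2; have h3 := H.h3; have h4 := H.h4; have hk := H.hk
  have o0 := H.o0; have p0 := H.p0; have q0 := H.q0
  have he : aug T.E = 0 := by rw [hE, map_zero]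
  rw [he] at h1 h2 h3 h4 hk
  have hzero : aug T.O = 0 → aug T.P = 0 → aug T.Q = 0 → T = ⟨0, 0⟩ := by
    intro ho hp hq
    ext1
    · rw [R_eq, hE, hT.O.eq_zero_of_aug ho, add_zero]
    · rw [S_eq, hT.P.eq_zero_of_aug hp, hT.Q.eq_zero_of_aug hq, add_zero]
  have hO1 : aug T.S = aug T.P + aug T.Q := by rw [S_eq, map_add]
  have caseR : aug T.O = 0 → aug T.S ≠ 1 := by
    intro ho
    refine A.no_single_t h ?_ hT
    rw [R_eq, hE, hT.O.eq_zero_of_aug ho, add_zero]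
  have caseS : aug T.P = 0 → aug T.Q = 0 → aug T.O = 0 := by
    intro hp hq
    obtain ⟨c, hc⟩ := A.prim2 T h (by rw [S_eq, hT.P.eq_zero_of_aug hp, hT.Q.eq_zero_of_aug hq, add_zero])
    rw [El.O, hc, od_C, map_zero]
  generalize aug T.O = o at *
  generalize aug T.P = p at *
  generalize aug T.Q = q at *
  simp only [zero_mul, zero_add, ne_eq, OfNat.ofNat_ne_zero, not_false_eq_true, zero_pow] at h1 h2 h3 h4 hk
  by_cases hν : ν = 0
  · subst hν
    simp only [mul_zero, mul_eq_zero, add_zero] at h1 h2 h3 h4 hk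
    have key : ∀ t : ℤ, t ^ 2 = t → t = 0 ∨ t = 1 := by
      intro t ht
      have : t * (t - 1) = 0 := by linear_combination ht
      rcases mul_eq_zero.1 this with h | h
      · exact Or.inl h
      · right; omega
    by_cases ho : o = 0
    · rcases h2 with hp | hq
      · subst hp; subst ho
        rcases key q (by linear_combination h1 - hk) with hq | hq
        · exact hzero rfl rfl hq
        · exact absurd (by rw [hO1, hq]; rfl) (caseR rfl)
      · subst hq; subst ho
        rcases key p (by linear_combination h1 - hk) with hq | hq
        · exact hzero rfl hq rfl
        · exact absurd (by rw [hO1, hq]; rfl) (caseR rfl)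
    · have hq := h3.resolve_left ho
      have hp := h4.resolve_left ho
      exact absurd (caseS hp hq) ho
  · exfalso
    have hn0 : (n : ℤ) ≠ 0 := by exact_mod_cast NeZero.ne n
    have hnn : (n : ℤ) * ν ≠ 0 := mul_ne_zero hn0 hν
    have hq : q ≠ 0 := by rintro rfl; apply hnn; linarith
    have hp : p ≠ 0 := by rintro rfl; apply hnn; linarith
    have e1 : p = o := mul_right_cancel₀ hq (by linarith)
    have e2 : q = p := by
      subst e1
      exact mul_left_cancel₀ hp (by linarith)
    subst e2; subst e1
    have h5 : n * (3 - q) = q := by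
      have : q * (n * (3 - q)) = q * q := by
        have ha : α = q ^ 2 := by linarith
        rw [ha] at hk
        linear_combination n * hk - h2
      exact mul_left_cancel₀ hp this
    have hn' : (3 : ℤ) ≤ n := by exact_mod_cast hn
    have hqlt : q < 3 := by
      by_contra hge; push Not at hge
      nlinarith
    have hq3 : q = 1 ∨ q = 2 := by omega
    rcases hq3 with rfl | rfl <;> omega

/-- L6 -/
lemma E_zero (hn : 3 ≤ n) {k : Type} [CommRing k] {y : El n k} (h : Mem A.r y) (hE : y.E = 0) (g) : y.val g = 0 := by
  by_contra hg
  have hT := A.E_zero_set hn (A.map_mem h (ind ℤ (y.val g))) (isSet_ind _ _) (by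
    ext x
    rw [El.E, zero_c]
    by_cases hx : par x = 0
    · rw [ev_c_even hx, map_R, ind_ne]
      rw [← ev_c_even hx]
      change y.E.c x ≠ _
      rw [hE, zero_c]; exact Ne.symm hg
    · exact isEv_ev _ x ((ne_zero_iff_par x).1 hx))
  have h1 : (y.map (ind ℤ (y.val g))).val g = 1 := by simp
  rw [hT] at h1
  obtain ⟨x, i⟩ := g
  cases i <;> simp at h1

/-- two elements with the same even part coincide -/
lemma eq_of_E (hn : 3 ≤ n) {k : Type} [CommRing k] {y y' : El n k} (h : Mem A.r y) (h' : Mem A.r y') (hE : y.E = y'.E) :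
    y = y' := by
  let w : El n k := El.of (fun g => y.val g - y'.val g)
  have hw : Mem A.r w := by
    intro a b hab; simp only [w, of_val, h a b hab, h' a b hab]
  have hwR : w.R = y.R - y'.R := by ext x; simp [w, El.of]
  have := A.E_zero hn hw (by
    have h1 : w.R + y'.R = y.R := by rw [hwR]; ring
    have h2 := congrArg ev h1
    rw [ev_add] at h2
    have h3 : w.E + y'.E = y.E := h2
    rw [hE] at h3
    simpa using h3)
  refine ext_val fun g => ?_
  have := this g
  simp only [w, of_val] at this
  exact sub_eq_zero.1 this

end SR

set_option linter.unusedSectionVars false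
set_option linter.unusedVariables false
set_option linter.unusedSimpArgs false
open Lam El

section parith
variable {n : ℕ} [NeZero n]

/-- generator of the subgroup of order `p` -/
def uu (p : ℕ) : Zm n := ((4 * n / p : ℕ) : Zm n)
/-- the `p`-part of the order -/
def qq (n p : ℕ) : ℕ := p ^ (4 * n).factorization p

lemma natCast_dvd_iff {d e : ℕ} (hd : d ∣ 4 * n) : ((d : Zm n) ∣ (e : Zm n)) ↔ d ∣ e := by
  constructor
  · rintro ⟨t, ht⟩
    have ht' : ((e : ℕ) : Zm n) = ((d * t.val : ℕ) : Zm n) := by push_cast; rw [ht]; simp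
    rw [ZMod.natCast_eq_natCast_iff] at ht'
    have h1 := ht'.of_dvd hd
    have h2 : d * t.val ≡ 0 [MOD d] := (Nat.modEq_zero_iff_dvd).2 (dvd_mul_right _ _)
    exact (Nat.modEq_zero_iff_dvd).1 (h1.trans h2)
  · rintro ⟨t, rfl⟩
    exact ⟨t, by push_cast; rfl⟩

lemma qq_dvd (p : ℕ) : qq n p ∣ 4 * n := Nat.ordProj_dvd _ _

lemma four_ne : 4 * n ≠ 0 := by have := NeZero.ne n; omega

variable {p : ℕ}

lemma p_mul_uu (hd : p ∣ 4 * n) : (p : Zm n) * uu p = 0 := by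
  rw [uu, ← Nat.cast_mul, Nat.mul_div_cancel' hd, natCast_eq_zero_iff']

lemma uu_ne (hp : p.Prime) (hd : p ∣ 4 * n) : (uu p : Zm n) ≠ 0 := by
  rw [uu, Ne, natCast_eq_zero_iff']
  intro h
  have h1 := four_ne (n := n)
  have h2 := Nat.le_of_dvd (Nat.div_pos (Nat.le_of_dvd (by omega) hd) hp.pos) h
  have h3 := Nat.div_lt_self (by omega : 0 < 4 * n) hp.one_lt
  omega

lemma addOrderOf_uu (hp : p.Prime) (hd : p ∣ 4 * n) : addOrderOf (uu p : Zm n) = p := by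
  have : Fact p.Prime := ⟨hp⟩
  exact addOrderOf_eq_prime (by rw [nsmul_eq_mul, p_mul_uu hd]) (uu_ne hp hd)

lemma p_mul_eq_zero (hp : p.Prime) (hd : p ∣ 4 * n) {x : Zm n} (h : (p : Zm n) * x = 0) :
    (uu p : Zm n) ∣ x := by
  have hx : x = ((x.val : ℕ) : Zm n) := by simp
  rw [hx, ← Nat.cast_mul, natCast_eq_zero_iff'] at h
  rw [hx, uu, natCast_dvd_iff (Nat.div_dvd_of_dvd hd)]
  obtain ⟨t, ht⟩ := h
  obtain ⟨s, hs⟩ := hd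
  refine ⟨t, ?_⟩
  have h4 : 4 * n / p = s := by rw [hs, Nat.mul_div_cancel_left _ hp.pos]
  rw [h4]
  generalize x.val = X at *
  rw [hs, mul_assoc] at ht
  exact Nat.eq_of_mul_eq_mul_left hp.pos ht

lemma exists_sp (hp : p.Prime) : ∃ s : Zm n, s * p * (qq n p : Zm n) = qq n p := by
  have hc : Nat.Coprime p (4 * n / qq n p) := Nat.coprime_ordCompl hp four_ne
  have hg : (4 * n / qq n p) * qq n p = 4 * n := Nat.div_mul_cancel (qq_dvd p)
  generalize 4 * n / qq n p = N at hc hg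
  have hb := Nat.gcd_eq_gcd_ab p N
  rw [hc.gcd_eq_one] at hb
  refine ⟨((Nat.gcdA p N : ℤ) : Zm n), ?_⟩
  have h1 := congrArg (fun t : ℤ => (t : Zm n)) hb
  have h2 : (N : Zm n) * (qq n p : Zm n) = 0 := by
    rw [← Nat.cast_mul, hg, ZMod.natCast_self (4 * n)]
  push_cast at h1
  linear_combination - (qq n p : Zm n) * h1 - ((Nat.gcdB p N : ℤ) : Zm n) * h2

lemma eq_zero_of_qq_dvd (hp : p.Prime) {x : Zm n} (h : (qq n p : Zm n) ∣ x) (h0 : (p : Zm n) * x = 0) : x = 0 := by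
  obtain ⟨s, hs⟩ := exists_sp (n := n) hp
  obtain ⟨t, rfl⟩ := h
  linear_combination s * h0 - t * hs

lemma exists_root (hp : p.Prime) {y : Zm n} (h : (qq n p : Zm n) ∣ y) :
    ∃ w, (qq n p : Zm n) ∣ w ∧ (p : Zm n) * w = y := by
  obtain ⟨s, hs⟩ := exists_sp (n := n) hp
  obtain ⟨t, rfl⟩ := h
  exact ⟨qq n p * (s * t), dvd_mul_right _ _, by linear_combination t * hs⟩

lemma nat_dvd_div (hp : p.Prime) (hd : p ∣ 4 * n) {d : ℕ} (h : d ∣ 4 * n) (hq : ¬ qq n p ∣ d) : d ∣ 4 * n / p := by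
  obtain ⟨c, hc⟩ := h
  have hpc : p ∣ c := by
    by_contra hpc
    apply hq
    have hcop : Nat.Coprime (qq n p) c := Nat.Coprime.pow_left _ ((Nat.Prime.coprime_iff_not_dvd hp).2 hpc)
    exact hcop.dvd_of_dvd_mul_right (hc ▸ qq_dvd p)
  obtain ⟨c', rfl⟩ := hpc
  refine ⟨c', ?_⟩
  rw [hc, show d * (p * c') = p * (d * c') by ring, Nat.mul_div_cancel_left _ hp.pos]

/-- unit-invariant functions -/
def RatL {k : Type} (f : Lam (Zm n) k) : Prop := ∀ (u : (Zm n)ˣ) (x : Zm n), f.c (u * x) = f.c x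

lemma RatL.eq_of_dvd {k : Type} {f : Lam (Zm n) k} (h : RatL f) {x y : Zm n} (h1 : x ∣ y) (h2 : y ∣ x) :
    f.c x = f.c y := by
  obtain ⟨d, hd, u, hu, rfl⟩ := ZMod.eq_unit_mul_divisor x
  obtain ⟨e, he, v, hv, rfl⟩ := ZMod.eq_unit_mul_divisor y
  have h1' : (d : Zm n) ∣ (e : Zm n) := by
    rw [hu.mul_left_dvd, hv.dvd_mul_left] at h1; exact h1
  have h2' : (e : Zm n) ∣ (d : Zm n) := by
    rw [hv.mul_left_dvd, hu.dvd_mul_left] at h2; exact h2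
  rw [natCast_dvd_iff hd] at h1'
  rw [natCast_dvd_iff he] at h2'
  have : d = e := Nat.dvd_antisymm h1' h2'
  subst this
  obtain ⟨u, rfl⟩ := hu
  obtain ⟨v, rfl⟩ := hv
  rw [h, h]

lemma dvd_of_not (hp : p.Prime) (hd : p ∣ 4 * n) {x y : Zm n} (hxy : (p : Zm n) * x = p * y)
    (hx : ¬ (qq n p : Zm n) ∣ x) : x ∣ y := by
  obtain ⟨d, hd', u, hu, rfl⟩ := ZMod.eq_unit_mul_divisor x
  rw [hu.mul_left_dvd]
  have h1 : (d : Zm n) ∣ uu p := by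
    refine (natCast_dvd_iff hd').2 (nat_dvd_div hp hd hd' ?_)
    rw [hu.dvd_mul_left, natCast_dvd_iff (qq_dvd p)] at hx
    exact hx
  have h2 : (uu p : Zm n) ∣ y - u * d := p_mul_eq_zero hp hd (by linear_combination - hxy)
  have := dvd_add (h1.trans h2) (dvd_mul_left (d : Zm n) u)
  simpa using this

/-- the coset lemma -/
lemma RatL.coset {k : Type} {f : Lam (Zm n) k} (h : RatL f) (hp : p.Prime) (hd : p ∣ 4 * n) {x y : Zm n}
    (hxy : (p : Zm n) * x = p * y) (hx : ¬ (qq n p : Zm n) ∣ x) (hy : ¬ (qq n p : Zm n) ∣ y) : f.c x = f.c y :=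
  h.eq_of_dvd (dvd_of_not hp hd hxy hx) (dvd_of_not hp hd hxy.symm hy)

lemma pow_c (hp : p.Prime) (f : Lam (Zm n) (ZMod p)) (y : Zm n) :
    (f ^ p).c y = ∑ x, if (p : Zm n) * x = y then f.c x else 0 := by
  have : Fact p.Prime := ⟨hp⟩
  rw [pow_char p f (nsmulAddMonoidHom p) (fun _ => rfl), push_c]
  simp [nsmul_eq_mul]

lemma p_mul_add_uu (hd : p ∣ 4 * n) (x : Zm n) : (p : Zm n) * (x + uu p) = (p : Zm n) * x := by
  rw [mul_add, p_mul_uu hd, add_zero]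

/-- powers of rational elements live on `p'`-elements -/
lemma RatL.pow_c_not (hp : p.Prime) (hd : p ∣ 4 * n) {f : Lam (Zm n) (ZMod p)} (h : RatL f) {y : Zm n}
    (hy : ¬ (qq n p : Zm n) ∣ y) : (f ^ p).c y = 0 := by
  rw [pow_c hp]
  obtain ⟨t, ht⟩ := sum_eq_of_periodic (uu p : Zm n) p (addOrderOf_uu hp hd)
    (fun x => if (p : Zm n) * x = y then f.c x else 0) (by
      intro x
      rw [p_mul_add_uu hd]
      split_ifs with hx
      · have h1 : ∀ x, (p : Zm n) * x = y → ¬ (qq n p : Zm n) ∣ x := by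
          rintro x rfl hx; exact hy (hx.mul_left _)
        exact h.coset hp hd (p_mul_add_uu hd x) (h1 _ (by rw [p_mul_add_uu hd, hx])) (h1 _ hx)
      · rfl)
  rw [ht]; simp

lemma not_dvd_add_uu (hp : p.Prime) (hd : p ∣ 4 * n) {w : Zm n} (hw : (qq n p : Zm n) ∣ w) :
    ¬ (qq n p : Zm n) ∣ w + uu p := by
  intro h
  have := (dvd_add_right hw).1 h
  exact uu_ne hp hd (eq_zero_of_qq_dvd hp this (p_mul_uu hd))

lemma RatL.pow_c_root (hp : p.Prime) (hd : p ∣ 4 * n) {f : Lam (Zm n) (ZMod p)} (h : RatL f) {w : Zm n}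
    (hw : (qq n p : Zm n) ∣ w) : (f ^ p).c (p * w) = f.c w - f.c (w + uu p) := by
  rw [pow_c hp]
  obtain ⟨t, ht⟩ := sum_eq_of_periodic (uu p : Zm n) p (addOrderOf_uu hp hd)
    (fun x => (if (p : Zm n) * x = p * w then f.c x else 0) +
      if x = w then f.c (w + uu p) - f.c w else 0) (by
      have key : ∀ x, (p : Zm n) * x = p * w →
        ((if (p : Zm n) * x = p * w then f.c x else 0) +
          if x = w then f.c (w + uu p) - f.c w else 0) = f.c (w + uu p) := by
        intro x hx
        rw [if_pos hx]
        split_ifs with hxw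
        · rw [hxw]; ring
        · rw [add_zero]
          refine h.coset hp hd (by rw [p_mul_add_uu hd, hx]) ?_ (not_dvd_add_uu hp hd hw)
          intro hx'
          apply hxw
          rw [← sub_eq_zero]
          exact eq_zero_of_qq_dvd hp (dvd_sub hx' hw) (by rw [mul_sub, hx, sub_self])
      intro x
      by_cases hx : (p : Zm n) * x = p * w
      · rw [key x hx, key (x + uu p) (by rw [p_mul_add_uu hd, hx])]
      · have h1 : x ≠ w := by rintro rfl; exact hx rfl
        have h2 : x + uu p ≠ w := by rintro rfl; apply hx; rw [p_mul_add_uu hd]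
        rw [p_mul_add_uu hd]
        simp [hx, h1, h2])
  rw [Finset.sum_add_distrib] at ht
  simp at ht
  linear_combination ht

/-- periodicity from vanishing of the `p`-th power -/
lemma RatL.per_of_pow (hp : p.Prime) (hd : p ∣ 4 * n) {f : Lam (Zm n) (ZMod p)} (h : RatL f)
    (h0 : ∀ y, y ≠ 0 → (f ^ p).c y = 0) (x : Zm n) (hx : x ≠ 0) (hxu : x + uu p ≠ 0) : f.c (x + uu p) = f.c x := by
  by_cases h1 : (qq n p : Zm n) ∣ x
  · have h2 := h.pow_c_root hp hd h1
    rw [h0 _ (fun h3 => hx (eq_zero_of_qq_dvd hp h1 h3))] at h2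
    linear_combination h2
  by_cases h2 : (qq n p : Zm n) ∣ x + uu p
  · have h3 := h.pow_c_root hp hd h2
    rw [h0 _ (fun h3 => hxu (eq_zero_of_qq_dvd hp h2 h3))] at h3
    have h4 : f.c (x + uu p + uu p) = f.c x :=
      h.coset hp hd (by rw [p_mul_add_uu hd, p_mul_add_uu hd]) (not_dvd_add_uu hp hd h2) h1
    rw [h4] at h3
    linear_combination - h3
  · exact h.coset hp hd (p_mul_add_uu hd x) h2 h1

/-- 0/1 functions with vanishing fibre sum -/
lemma bin_fibre (hp : p.Prime) (hd : p ∣ 4 * n) {f : Lam (Zm n) ℤ} (hf : Bin f) (x : Zm n)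
    (h0 : ((pmap (Int.castRingHom (ZMod p)) f) ^ p).c (p * x) = 0) : f.c (x + uu p) = f.c x := by
  rw [pow_c hp, ← Finset.sum_filter] at h0
  set s := Finset.univ.filter (fun w : Zm n => (p : Zm n) * w = p * x) with hs
  have h1 : ((∑ w ∈ s, f.c w : ℤ) : ZMod p) = 0 := by
    push_cast; exact h0
  rw [ZMod.intCast_zmod_eq_zero_iff_dvd] at h1
  have hcard : s.card ≤ p := by
    have h2 := IsAddCyclic.card_nsmul_eq_zero_le (α := Zm n) hp.pos
    refine le_trans (Finset.card_le_card_of_injOn (fun w => w - x) ?_ ?_) h2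
    · intro w hw
      simp only [hs, Finset.coe_filter, Finset.mem_univ, true_and, Set.mem_ofPred] at hw
      simp only [Finset.coe_filter, Finset.mem_univ, true_and, Set.mem_ofPred, nsmul_eq_mul, mul_sub]
      rw [hw, sub_self]
    · intro a _ b _ hab; simpa using hab
  have hx : x ∈ s := by simp [hs]
  have hxu : x + uu p ∈ s := by rw [hs, Finset.mem_filter]; exact ⟨Finset.mem_univ _, p_mul_add_uu hd x⟩
  have hle : ∑ w ∈ s, f.c w ≤ p := by
    calc ∑ w ∈ s, f.c w ≤ ∑ w ∈ s, (1 : ℤ) := Finset.sum_le_sum fun w _ => hf.le_one w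
      _ = s.card := by simp
      _ ≤ p := by exact_mod_cast hcard
  have hge : 0 ≤ ∑ w ∈ s, f.c w := Finset.sum_nonneg fun w _ => hf.nonneg w
  obtain ⟨t, ht⟩ := h1
  have hp0 : (0 : ℤ) < p := by exact_mod_cast hp.pos
  have ht01 : t = 0 ∨ t = 1 := by
    have : 0 ≤ t := by
      by_contra hneg; push Not at hneg
      nlinarith
    have : t ≤ 1 := by
      by_contra hneg; push Not at hneg
      nlinarith
    omega
  rcases ht01 with rfl | rfl
  · rw [mul_zero, Finset.sum_eq_zero_iff_of_nonneg (fun w _ => hf.nonneg w)] at ht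
    rw [ht _ hx, ht _ hxu]
  · have h3 : ∑ w ∈ s, (1 - f.c w) = 0 := by
      rw [Finset.sum_sub_distrib, ht]
      have : (s.card : ℤ) ≤ p := by exact_mod_cast hcard
      have h5 : ∑ w ∈ s, f.c w ≤ s.card := by
        calc ∑ w ∈ s, f.c w ≤ ∑ w ∈ s, (1 : ℤ) := Finset.sum_le_sum fun w _ => hf.le_one w
          _ = s.card := by simp
      simp; linarith
    rw [Finset.sum_eq_zero_iff_of_nonneg (fun w _ => by have := hf.le_one w; omega)] at h3
    have := h3 _ hx; have := h3 _ hxu; omega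

end parith

set_option linter.unusedSectionVars false
set_option linter.unusedVariables false
set_option linter.unusedSimpArgs false
open Lam El

section frob
variable {n : ℕ} [NeZero n] {k : Type} [CommRing k]

lemma Lam.Z_pow_odd (j : ℕ) (hj : Odd j) : (Z : Lam (Zm n) k) ^ j = Z := by
  obtain ⟨m, rfl⟩ := hj
  rw [pow_succ, pow_mul, pow_two, Z_mul_Z, one_pow, one_mul]

lemma Lam.IsEv.pow {f : Lam (Zm n) k} (h : IsEv f) (j : ℕ) : IsEv (f ^ j) := by
  induction j with
  | zero => rw [pow_zero, ← map_one C]; exact isEv_C 1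
  | succ j ih => rw [pow_succ]; exact ih.mul h

lemma Lam.IsOd.pow_odd {f : Lam (Zm n) k} (h : IsOd f) (j : ℕ) (hj : Odd j) : IsOd (f ^ j) := by
  obtain ⟨m, rfl⟩ := hj
  rw [pow_succ, pow_mul]
  exact IsEv.mul_od (IsEv.pow (by rw [pow_two]; exact h.mul h) m) h

lemma Lam.isEv_one_add_Z : IsEv (1 + Z : Lam (Zm n) k) := by
  refine IsEv.add ?_ isEv_Z
  rw [← map_one C]; exact isEv_C 1

lemma Lam.one_add_Z_pow (ℓ : ℕ) [Fact ℓ.Prime] (h2 : ℓ ≠ 2) : (1 + Z : Lam (Zm n) (ZMod ℓ)) ^ ℓ = 1 + Z := by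
  have : ExpChar (Lam (Zm n) (ZMod ℓ)) ℓ := ExpChar.prime Fact.out
  rw [add_pow_char, one_pow, Z_pow_odd _ ((Fact.out : ℓ.Prime).odd_of_ne_two h2)]

lemma El.trace_eq {y : El n k} (h : y.Sym) : y.mat.trace = 2 * y.E + (1 + Z) * y.O := by
  rw [mat_trace, h.twR, R_eq]; ring

lemma Lam.two_cancel (ℓ : ℕ) [Fact ℓ.Prime] (h2 : ℓ ≠ 2) {f g : Lam (Zm n) (ZMod ℓ)} (h : 2 * f = 2 * g) : f = g := by
  ext x
  have := congrArg (fun t => t.c x) h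
  simp only [ofNat_mul_c] at this
  refine mul_left_cancel₀ ?_ this
  intro h0
  have h1 : ((2 : ℕ) : ZMod ℓ) = 0 := by exact_mod_cast h0
  rw [ZMod.natCast_eq_zero_iff] at h1
  exact h2 ((Nat.prime_dvd_prime_iff_eq Fact.out Nat.prime_two).1 h1)

/-- L7 -/
lemma SR.frob (A : SR n) (ℓ : ℕ) [Fact ℓ.Prime] (h2 : ℓ ≠ 2) {y : El n (ZMod ℓ)} (h : Mem A.r y) :
    (y ^ ℓ).E = y.E ^ ℓ ∧ (1 + Z) * (y ^ ℓ).O = (1 + Z) * y.O ^ ℓ := by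
  have : ExpChar (Lam (Zm n) (ZMod ℓ)) ℓ := ExpChar.prime Fact.out
  have hodd : Odd ℓ := (Fact.out : ℓ.Prime).odd_of_ne_two h2
  have h1 : (y ^ ℓ).mat.trace = y.mat.trace ^ ℓ := by rw [mat_pow, trace_pow_char]
  rw [El.trace_eq (A.sym h), El.trace_eq (A.sym (A.pow_mem h ℓ)), add_pow_char, mul_pow, mul_pow,
    one_add_Z_pow ℓ h2] at h1
  have h22 : (2 : Lam (Zm n) (ZMod ℓ)) ^ ℓ = 2 := by
    have e : (2 : Lam (Zm n) (ZMod ℓ)) = C 2 := (map_ofNat C 2).symm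
    rw [e, ← map_pow, ZMod.pow_card]
  rw [h22] at h1
  have e2 : ∀ f : Lam (Zm n) (ZMod ℓ), IsEv f → IsEv (2 * f) := fun f hf => by
    rw [two_mul]; exact hf.add hf
  have a1 := ev_eq (f := (2 : Lam (Zm n) (ZMod ℓ)) * (y ^ ℓ).E + (1 + Z) * (y ^ ℓ).O) rfl (e2 _ (isEv_ev _))
    (isEv_one_add_Z.mul_od (isOd_od _))
  have a2 := ev_eq h1 (e2 _ ((isEv_ev _ : IsEv y.E).pow ℓ)) (isEv_one_add_Z.mul_od ((isOd_od _ : IsOd y.O).pow_odd ℓ hodd))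
  have b1 := od_eq (f := (2 : Lam (Zm n) (ZMod ℓ)) * (y ^ ℓ).E + (1 + Z) * (y ^ ℓ).O) rfl (e2 _ (isEv_ev _))
    (isEv_one_add_Z.mul_od (isOd_od _))
  have b2 := od_eq h1 (e2 _ ((isEv_ev _ : IsEv y.E).pow ℓ)) (isEv_one_add_Z.mul_od ((isOd_od _ : IsOd y.O).pow_odd ℓ hodd))
  exact ⟨two_cancel ℓ h2 (a1.symm.trans a2), b1.symm.trans b2⟩

/-- rational elements -/
def ERat (y : El n k) : Prop := RatL y.E

lemma par_unit (u : (Zm n)ˣ) : par (u : Zm n) = 1 := by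
  rcases par_cases (u : Zm n) with h | h
  · have := congrArg par (u.mul_inv)
    rw [map_mul, h, zero_mul, map_one] at this
    exact absurd this (by decide)
  · exact h

lemma par_unit_mul (u : (Zm n)ˣ) (x : Zm n) : par ((u : Zm n) * x) = par x := by
  rw [map_mul, par_unit, one_mul]

lemma unit_zz (u : (Zm n)ˣ) : (u : Zm n) * zz = zz := by
  obtain ⟨y, hy⟩ := (par_one_iff _).1 (par_unit u)
  rw [hy]; linear_combination y * two_zz (n := n)

lemma erat_iff {y : El n k} : ERat y ↔ ∀ (u : (Zm n)ˣ) (x : Zm n), par x = 0 → y.R.c (u * x) = y.R.c x := by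
  constructor
  · intro h u x hx
    have := h u x
    rw [El.E, ev_c_even hx, ev_c_even (by rw [par_unit_mul, hx])] at this
    exact this
  · intro h u x
    simp only [El.E, ev, par_unit_mul]
    split_ifs with hx
    · exact h u x hx
    · rfl

lemma ERat.map {k' : Type} [CommRing k'] {y : El n k} (h : ERat y) (φ : k → k') : ERat (y.map φ) :=
  erat_iff.2 fun u x hx => by rw [map_R, map_R, erat_iff.1 h u x hx]

lemma ERat.add1 {y : El n k} (h : ERat y) (c : k) : ERat (y.add1 c) :=
  erat_iff.2 fun u x hx => by
    change (y.R + C c).c _ = (y.R + C c).c _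
    rw [add_c, add_c, erat_iff.1 h u x hx, C_c, C_c]; simp

lemma ratL_iff {f : Lam (Zm n) k} : RatL f ↔ ∀ u, tw u f = f := by
  constructor
  · intro h u; ext x; exact h u x
  · intro h u x; conv_rhs => rw [← h u]
    rfl

lemma RatL.pow {f : Lam (Zm n) k} (h : RatL f) (j : ℕ) : RatL (f ^ j) :=
  ratL_iff.2 fun u => by rw [map_pow, ratL_iff.1 h u]

lemma SR.erat_pow (A : SR n) (ℓ : ℕ) [Fact ℓ.Prime] (h2 : ℓ ≠ 2) {y : El n (ZMod ℓ)} (h : Mem A.r y) (hr : ERat y) :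
    ERat (y ^ ℓ) := by
  rw [ERat, (A.frob ℓ h2 h).1]; exact RatL.pow hr ℓ

lemma exists_prime_unit (u : (Zm n)ˣ) (B : ℕ) : ∃ ℓ : ℕ, ℓ.Prime ∧ B < ℓ ∧ (ℓ : Zm n) = u := by
  obtain ⟨ℓ, h1, h2, h3⟩ := Nat.forall_exists_prime_gt_and_eq_mod (q := 4 * n) u.isUnit B
  exact ⟨ℓ, h2, h1, h3⟩

lemma pow_c_unit {ℓ : ℕ} (hp : ℓ.Prime) (u : (Zm n)ˣ) (hu : (ℓ : Zm n) = u) (f : Lam (Zm n) (ZMod ℓ)) (x : Zm n) :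
    (f ^ ℓ).c (u * x) = f.c x := by
  rw [pow_c hp, hu]; simp

/-- the class of the central involution is rational -/
lemma SR.zclass (A : SR n) {T : El n ℤ} (hT : IsSet T) (hm : Mem A.r T)
    (h1 : ∀ g, T.val g = 1 → A.r (zz, false) g) (hz : T.val (zz, false) = 1) : ERat T := by
  have key : ∀ (u : (Zm n)ˣ) (x : Zm n), par x = 0 → T.R.c (u * x) = 1 → T.R.c x = 1 := by
    intro u x hx hux
    obtain ⟨ℓ, hℓ, h2, hu⟩ := exists_prime_unit u 2
    have : Fact ℓ.Prime := ⟨hℓ⟩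
    let y : El n (ZMod ℓ) := T.map (Int.castRingHom (ZMod ℓ))
    have hy : Mem A.r y := A.map_mem hm _
    have hyp := A.pow_mem hy ℓ
    have hE := (A.frob ℓ (by omega) hy).1
    have v1 : ∀ x : Zm n, par x = 0 → (y ^ ℓ).R.c (u * x) = (T.R.c x : ZMod ℓ) := by
      intro x hx
      have : (y ^ ℓ).E.c (u * x) = y.E.c x := by rw [hE, pow_c_unit hℓ u hu]
      rw [El.E, El.E, ev_c_even hx, ev_c_even (by rw [par_unit_mul, hx])] at this
      rw [this]; rfl
    have hvz := v1 zz par_zz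
    rw [unit_zz, show T.R.c zz = 1 from hz] at hvz
    have := hyp _ _ (h1 (u * x, false) hux)
    rw [val_f, val_f, hvz, v1 x hx] at this
    rcases hT (x, false) with h | h
    · rw [val_f] at h
      rw [h] at this
      simp at this
    · exact h
  refine erat_iff.2 fun u x hx => ?_
  rcases hT (x, false) with h | h <;> rcases hT (u * x, false) with h' | h' <;> rw [val_f] at h h' <;> rw [h, h']
  · exact absurd (key u x hx h') (by rw [h]; decide)
  · have := key u⁻¹ (u * x) (by rw [par_unit_mul, hx]) (by simpa using h)
    rw [h'] at this; exact this

lemma SR.frob_rat (A : SR n) (hn : 3 ≤ n) {ℓ : ℕ} [Fact ℓ.Prime] (h2 : ℓ ≠ 2) (u : (Zm n)ˣ) (hu : (ℓ : Zm n) = u)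
    {y : El n (ZMod ℓ)} (h : Mem A.r y) (hr : ERat y) : y ^ ℓ = y := by
  refine A.eq_of_E hn (A.pow_mem h ℓ) h ?_
  rw [(A.frob ℓ h2 h).1]
  ext x
  have := pow_c_unit Fact.out u hu y.E ((u⁻¹ : (Zm n)ˣ) * x)
  rw [hr, ← mul_assoc, u.mul_inv, one_mul] at this
  exact this

lemma int_eq_of_mod {a b : ℤ} (h : ∀ B : ℕ, ∃ ℓ : ℕ, B < ℓ ∧ (a : ZMod ℓ) = b) : a = b := by
  obtain ⟨ℓ, h1, h2⟩ := h (a - b).natAbs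
  rw [← sub_eq_zero, ← Int.cast_sub, ZMod.intCast_zmod_eq_zero_iff_dvd] at h2
  rw [← sub_eq_zero]
  exact Int.eq_zero_of_dvd_of_natAbs_lt_natAbs h2 (by simpa using h1)

lemma map_E {k' : Type} [CommRing k'] (φ : k →+* k') (y : El n k) : (y.map φ).E = pmap φ y.E := by
  ext x; simp only [El.E, ev, map_R, pmap_c]; split_ifs <;> simp
lemma map_O {k' : Type} [CommRing k'] (φ : k →+* k') (y : El n k) : (y.map φ).O = pmap φ y.O := by
  ext x; simp only [El.O, od, map_R, pmap_c]; split_ifs <;> simp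
lemma pmap_Z {k' : Type} [CommRing k'] (φ : k →+* k') : pmap φ (Z : Lam (Zm n) k) = Z := by
  ext x; simp only [Z, d_c, pmap_c]; split_ifs <;> simp

lemma SR.ratO (A : SR n) (hn : 3 ≤ n) {y : El n ℤ} (h : Mem A.r y) (hr : ERat y) : RatL ((1 + Z) * y.O) := by
  intro u x
  refine int_eq_of_mod fun B => ?_
  obtain ⟨ℓ, hℓ, h2, hu⟩ := exists_prime_unit u (max B 2)
  have : Fact ℓ.Prime := ⟨hℓ⟩
  have hl2 : ℓ ≠ 2 := by have := le_max_right B 2; omega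
  refine ⟨ℓ, lt_of_le_of_lt (le_max_left _ _) h2, ?_⟩
  let w : El n (ZMod ℓ) := y.map (Int.castRingHom (ZMod ℓ))
  have hw : Mem A.r w := A.map_mem h _
  have h3 := (A.frob ℓ hl2 hw).2
  rw [A.frob_rat hn hl2 u hu hw (hr.map _), ← one_add_Z_pow ℓ hl2, ← mul_pow, one_add_Z_pow ℓ hl2] at h3
  have h4 := pow_c_unit hℓ u hu ((1 + Z) * w.O) x
  rw [← h3] at h4
  have h5 : (1 + Z) * w.O = pmap (Int.castRingHom (ZMod ℓ)) ((1 + Z) * y.O) := by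
    rw [map_O, map_mul, map_add, map_one, pmap_Z]
  rw [h5] at h4
  exact h4

lemma SR.rat_sq (A : SR n) (hn : 3 ≤ n) {y : El n ℤ} (h : Mem A.r y) (hr : ERat y) : ERat (y * y) := by
  intro u x
  refine int_eq_of_mod fun B => ?_
  obtain ⟨ℓ, hℓ, h2, hu⟩ := exists_prime_unit u (max B 2)
  have : Fact ℓ.Prime := ⟨hℓ⟩
  have hl2 : ℓ ≠ 2 := by have := le_max_right B 2; omega
  refine ⟨ℓ, lt_of_le_of_lt (le_max_left _ _) h2, ?_⟩
  let w : El n (ZMod ℓ) := y.map (Int.castRingHom (ZMod ℓ))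
  have hw : Mem A.r w := A.map_mem h _
  have h3 := (A.frob ℓ hl2 (A.mul_mem _ _ hw hw)).1
  rw [← pow_two, ← pow_mul, Nat.mul_comm, pow_mul, A.frob_rat hn hl2 u hu hw (hr.map _)] at h3
  have h4 := pow_c_unit hℓ u hu (w ^ 2).E x
  rw [← h3] at h4
  have h5 : (w ^ 2).E = pmap (Int.castRingHom (ZMod ℓ)) (y * y).E := by
    rw [← map_E, El.map_mul, pow_two]
  rw [h5] at h4
  exact h4

end frob

set_option linter.unusedSectionVars false
set_option linter.unusedVariables false
set_option linter.unusedSimpArgs false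
open Lam El

section lemP
variable {n : ℕ} [NeZero n]

lemma El.triv_of_ind' {k : Type} [CommRing k] (k' : Type) [CommRing k'] [Nontrivial k'] (y : El n k)
    (h : ∀ v, v ≠ 0 → Triv (y.map (ind k' v))) : Triv y := by
  by_cases h0 : ∀ g, g ≠ (0, false) → y.val g = 0
  · exact ⟨0, h0⟩
  · push Not at h0
    obtain ⟨g0, hg0, hv⟩ := h0
    refine ⟨y.val g0, fun g hg => ?_⟩
    obtain ⟨c, hc⟩ := h _ hv
    have h1 := hc g hg
    have h2 := hc g0 hg0
    simp only [map_val] at h1 h2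
    rw [← h1] at h2
    exact ind_eq (k' := k') (by rw [← h2, ind_self])

lemma El.Sym.invR {k : Type} [CommRing k] {y : El n k} (h : y.Sym) : inv y.R = y.R := by
  rw [R_eq, map_add, h.E, h.O]
lemma El.Sym.twS' {k : Type} [CommRing k] {y : El n k} (h : y.Sym) : tw sgU y.S = inv y.S := by
  rw [h.twS, ← map_add, ← S_eq]

lemma SR.bal_u (A : SR n) {k : Type} [CommRing k] {y : El n k} (h : Mem A.r y) (u : Zm n) (hu : u ≠ 0)
    (hS : d u * y.S = y.S) (hR : ∀ x, x ≠ 0 → x + u ≠ 0 → y.R.c (x + u) = y.R.c x) : Triv y := by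
  obtain ⟨c, hc⟩ := A.prim1 (y.add1 (y.R.c u - y.R.c 0)) u hu (A.add1_mem h _) (by
    change d u * (y.R + C _) = y.R + C _
    ext x
    rw [d_mul_c, add_c, add_c, C_c, C_c]
    by_cases h0 : x = 0
    · subst h0
      have h1 : y.R.c (-u) = y.R.c u := congrArg (fun f => f.c u) (A.sym h).invR
      simp [hu, h1]
    by_cases hz : x - u = 0
    · rw [sub_eq_zero] at hz
      subst hz; simp [hu]
    · have := hR (x - u) hz (by simpa using h0)
      rw [sub_add_cancel] at this
      rw [this, if_neg h0, if_neg hz]) hS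
  refine ⟨c, fun g hg => ?_⟩
  have := hc g
  rwa [add1_val, if_neg hg, add_zero] at this

variable {p : ℕ}

lemma par_uu (hp : p.Prime) (h2 : p ≠ 2) (hd : p ∣ n) : par (uu p : Zm n) = 0 := by
  have h : 4 * n / p = 4 * (n / p) := Nat.mul_div_assoc 4 hd
  rw [uu, h, par_natCast]
  push_cast
  rw [show (4 : ZMod 2) = 0 from rfl, zero_mul]

lemma inv_periodic {k : Type} [CommRing k] {u : Zm n} {f : Lam (Zm n) k} (h : d u * f = f) : d u * inv f = inv f := by
  have h1 : d (-u) * inv f = inv f := by conv_rhs => rw [← h, map_mul, inv_d]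
  conv_lhs => rw [← h1, ← mul_assoc, d_mul_d, add_neg_cancel, d_zero, one_mul]

/-- powers when the outer part is periodic -/
lemma SR.pow_periodic (A : SR n) (hp : p.Prime) (hd : p ∣ 4 * n) {y : El n (ZMod p)} (h : Mem A.r y)
    (hS : d (uu p) * y.S = y.S) (j : ℕ) :
    (y ^ j).R = y.R ^ j ∧ d (uu p) * (y ^ j).S = (y ^ j).S ∧
      (1 + Z) * (y ^ j).S * y.R = (1 + Z) * ((j : Lam (Zm n) (ZMod p)) * y.R ^ j * y.S) := by
  have : Fact p.Prime := ⟨hp⟩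
  have hsy := A.sym h
  have htw : (1 + Z) * tw sgU y.R = (1 + Z) * y.R := by
    rw [hsy.twR, R_eq]; linear_combination y.O * (Z_mul_Z (n := n) (k := ZMod p))
  have htwp : ∀ j, (1 + Z) * tw sgU y.R ^ j = (1 + Z) * y.R ^ j := by
    intro j
    induction j with
    | zero => simp
    | succ j ih => rw [pow_succ, pow_succ]; linear_combination tw sgU y.R * ih + y.R ^ j * htw
  induction j with
  | zero => refine ⟨?_, ?_, ?_⟩ <;> simp [one_R, one_S]
  | succ j ih =>
    obtain ⟨i1, i2, i3⟩ := ih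
    have hj := A.sym (A.pow_mem h j)
    have h0 : y.S * tw sgU (y ^ j).S = 0 := by
      rw [hj.twS']
      exact mul_eq_zero_of_periodic (uu p) p (addOrderOf_uu hp hd) _ _ hS (inv_periodic i2)
    rw [pow_succ', mul_R, mul_S, h0, i1]
    refine ⟨by ring, by linear_combination y.R * i2 + tw sgU (y.R ^ j) * hS, ?_⟩
    rw [map_pow]
    push_cast
    linear_combination y.R * i3 + y.S * y.R * htwp j

lemma SR.pow_periodic_p (A : SR n) (hp : p.Prime) (hd : p ∣ 4 * n) {y : El n (ZMod p)} (h : Mem A.r y)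
    (hS : d (uu p) * y.S = y.S) : (y ^ p).R = y.R ^ p ∧ d (uu p) * (y ^ p).S = (y ^ p).S ∧ (1 + Z) * (y ^ p).S = 0 := by
  have : Fact p.Prime := ⟨hp⟩
  have h1 := A.pow_periodic hp hd h hS p
  refine ⟨h1.1, h1.2.1, ?_⟩
  obtain ⟨j, rfl⟩ : ∃ j, p = j + 1 := ⟨p - 1, by have := hp.pos; omega⟩
  have hsy := A.sym h
  have htw : (1 + Z) * tw sgU y.R = (1 + Z) * y.R := by
    rw [hsy.twR, R_eq]; linear_combination y.O * (Z_mul_Z (n := n) (k := ZMod (j+1)))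
  have htwp : ∀ j', (1 + Z) * tw sgU y.R ^ j' = (1 + Z) * y.R ^ j' := by
    intro j'
    induction j' with
    | zero => simp
    | succ j' ih => rw [pow_succ, pow_succ]; linear_combination tw sgU y.R * ih + y.R ^ j' * htw
  have h2 := A.pow_periodic hp hd h hS j
  rw [pow_succ', mul_S, h2.1, map_pow]
  have h3 : ((j + 1 : ℕ) : Lam (Zm n) (ZMod (j + 1))) = 0 := CharP.cast_eq_zero _ _
  push_cast at h3
  linear_combination h2.2.2 + y.S * htwp j + (1 + Z) * y.S * y.R ^ j * h3

/-- supported on `p'`-elements: fixed by Frobenius -/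
lemma SR.frob_supp (A : SR n) (hn : 3 ≤ n) (hp : p.Prime) (h2 : p ≠ 2) (hd : p ∣ 4 * n) {y : El n (ZMod p)}
    (h : Mem A.r y) (hr : ERat y) (hs : ∀ x, y.E.c x ≠ 0 → (qq n p : Zm n) ∣ x) : y ^ p = y := by
  have : Fact p.Prime := ⟨hp⟩
  refine A.eq_of_E hn (A.pow_mem h p) h ?_
  rw [(A.frob p h2 h).1]
  ext x
  by_cases hx : (qq n p : Zm n) ∣ x
  · obtain ⟨w, hw, rfl⟩ := exists_root hp hx
    rw [RatL.pow_c_root hp hd hr hw]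
    have h1 : y.E.c (w + uu p) = 0 := by
      by_contra hne
      exact not_dvd_add_uu hp hd hw (hs _ hne)
    rw [h1, sub_zero]
    refine hr.eq_of_dvd (dvd_mul_left _ _) ?_
    obtain ⟨s, hs⟩ := exists_sp (n := n) hp
    obtain ⟨t, rfl⟩ := hw
    exact ⟨s, by linear_combination - t * hs⟩
  · rw [RatL.pow_c_not hp hd hr hx]
    by_contra hne
    exact hx (hs _ (Ne.symm hne))

lemma map_ind_E_ne {k : Type} [CommRing k] {w : El n k} {v : k} (hv : v ≠ 0) {x : Zm n}
    (h : (w.map (ind ℤ v)).E.c x ≠ 0) : w.E.c x = v := by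
  have hx : par x = 0 := by
    by_contra hx
    exact h (isEv_ev _ x ((ne_zero_iff_par x).1 hx))
  rw [El.E, ev_c_even hx, map_R] at h
  rw [El.E, ev_c_even hx]
  by_contra hne
  exact h (ind_ne hne)

lemma cast_small {a : ℤ} (h3 : 3 ≤ p) (h0 : -3 < a) (h1 : a < 3) (h : (a : ZMod p) = 0) : a = 0 := by
  rw [ZMod.intCast_zmod_eq_zero_iff_dvd] at h
  exact Int.eq_zero_of_abs_lt_dvd h (by rw [abs_lt]; constructor <;> omega)

lemma El.map_dS {k k' : Type} [CommRing k] [CommRing k'] {y : El n k} {u : Zm n} (h : d u * y.S = y.S) (φ : k → k') :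
    d u * (y.map φ).S = (y.map φ).S := by
  ext x
  rw [d_mul_c, map_S, map_S, ← d_mul_c, h]

/-- Lemma P -/
lemma SR.lemP (A : SR n) (hn : 3 ≤ n) (hp : p.Prime) (h2 : p ≠ 2) (hd : p ∣ n) {F : El n ℤ} (h : Mem A.r F)
    (hT : IsSet F) (hr : ERat F) (hS : d (uu p) * F.S = F.S) : Triv F := by
  have : Fact p.Prime := ⟨hp⟩
  have h3 : 3 ≤ p := by have := hp.two_le; omega
  have hd4 : p ∣ 4 * n := hd.mul_left 4
  let φ := Int.castRingHom (ZMod p)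
  let y := F.map φ
  have hy : Mem A.r y := A.map_mem h _
  have hyr : ERat y := hr.map _
  have hyS : d (uu p) * y.S = y.S := map_dS hS _
  obtain ⟨a1, a2, a3⟩ := A.pow_periodic_p hp hd4 hy hyS
  have hwm := A.pow_mem hy p
  have hwr := A.erat_pow p h2 hy hyr
  have hwt : Triv (y ^ p) := by
    refine triv_of_ind' ℤ _ fun v hv => ?_
    set F' := (y ^ p).map (ind ℤ v) with hF'
    have hm' : Mem A.r F' := A.map_mem hwm _
    have hT' : IsSet F' := isSet_ind _ _
    have hr' : ERat F' := hwr.map _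
    have hS' : d (uu p) * F'.S = F'.S := map_dS a2 _
    let y' := F'.map φ
    have hy' : Mem A.r y' := A.map_mem hm' _
    obtain ⟨b1, b2, b3⟩ := A.pow_periodic_p hp hd4 hy' (map_dS hS' _)
    rw [A.frob_supp hn hp h2 hd4 hy' (hr'.map _) (by
      intro x hx
      by_contra hq
      have h1 : F'.E.c x ≠ 0 := by
        intro h0
        apply hx
        change (F'.map φ).E.c x = 0
        rw [map_E, pmap_c, h0, map_zero]
      have h4 := map_ind_E_ne hv h1
      rw [(A.frob p h2 hy).1, RatL.pow_c_not hp hd4 hyr hq] at h4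
      exact hv h4.symm)] at b3
    have hz : F'.S = 0 := by
      ext x
      have h5 := congrArg (fun f => f.c x) b3
      simp only [add_mul, one_mul, add_c, Z_mul_c, zero_c] at h5
      have h6 : ((F'.S.c x + F'.S.c (x + zz) : ℤ) : ZMod p) = 0 := by
        push_cast; exact h5
      have h7 := hT'.S.nonneg x
      have h8 := hT'.S.nonneg (x + zz)
      have h9 := hT'.S.le_one x
      have h10 := hT'.S.le_one (x + zz)
      have := cast_small h3 (by omega) (by omega) h6
      rw [zero_c]; omega
    obtain ⟨c, hc⟩ := A.prim2 F' hm' hz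
    refine ⟨0, ?_⟩
    rintro ⟨x, i⟩ hg
    cases i
    · rw [val_f, hc, C_c, if_neg (by rintro rfl; exact hg rfl)]
    · rw [val_t, hz, zero_c]
  obtain ⟨c, hc⟩ := hwt
  have hc0 : c = 0 := by
    have h5 := congrArg (fun f => f.c 0) a3
    simp only [add_mul, one_mul, add_c, Z_mul_c, zero_c] at h5
    have c1 := hc (0, true) (by simp)
    have c2 := hc (0 + zz, true) (by simp)
    rw [val_t] at c1 c2
    rw [c1, c2, ← two_mul] at h5
    rcases mul_eq_zero.1 h5 with h6 | h6
    · exfalso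
      have : ((2 : ℤ) : ZMod p) = 0 := by exact_mod_cast h6
      have := cast_small h3 (by norm_num) (by norm_num) this
      omega
    · exact h6
  subst hc0
  refine A.bal_u h (uu p) (uu_ne hp hd4) hS fun x hx hxu => ?_
  by_cases hpx : (p : Zm n) * x = 0
  · have hev : par x = 0 := by
      obtain ⟨t, ht⟩ := p_mul_eq_zero hp hd4 hpx
      rw [ht, map_mul, par_uu hp h2 hd, zero_mul]
    have h1 : F.E.c (x + uu p) = F.E.c x :=
      RatL.coset hr hp hd4 (p_mul_add_uu hd4 x)
        (fun hq => hxu (eq_zero_of_qq_dvd hp hq (by rw [p_mul_add_uu hd4, hpx])))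
        (fun hq => hx (eq_zero_of_qq_dvd hp hq hpx))
    rwa [El.E, ev_c_even hev, ev_c_even (by rw [map_add, hev, par_uu hp h2 hd, zero_add])] at h1
  · refine bin_fibre hp hd4 hT.R x ?_
    have := hc (p * x, false) (by simpa using hpx)
    rw [val_f, a1] at this
    exact this

end lemP

set_option linter.unusedSectionVars false
set_option linter.unusedVariables false
set_option linter.unusedSimpArgs false
open Lam El

section choose
variable {n : ℕ} [NeZero n]

/-- nontrivial rational sets -/
structure Good (A : SR n) (F : El n ℤ) : Prop where
  mem : Mem A.r F
  set : IsSet F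
  rat : ERat F
  nt : ¬ Triv F
  zero : F.R.c 0 = 0

/-- nontrivial rational sets with trivial square -/
structure TT (A : SR n) (T : El n ℤ) : Prop where
  mem : Mem A.r T
  set : IsSet T
  rat : ERat T
  nt : ¬ Triv T
  sq : Triv (T * T)

/-- even part supported on `p'`-elements -/
def Supp (p : ℕ) (F : El n ℤ) : Prop := ∀ x, F.E.c x ≠ 0 → (qq n p : Zm n) ∣ x

open Classical in
/-- bad primes -/
noncomputable def PI (F : El n ℤ) : Finset ℕ := n.primeFactors.filter (fun p => p ≠ 2 ∧ ¬ Supp p F)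

lemma mem_PI {F : El n ℤ} {p : ℕ} : p ∈ PI F ↔ p.Prime ∧ p ∣ n ∧ p ≠ 2 ∧ ¬ Supp p F := by
  have := NeZero.ne n
  simp only [PI, Finset.mem_filter, Nat.mem_primeFactors]
  tauto

lemma El.add1_E (F : El n ℤ) (c : ℤ) : (F.add1 c).E = F.E + C c := by
  change ev (F.R + C c) = _
  rw [ev_add, ev_C]; rfl
lemma El.add1_O (F : El n ℤ) (c : ℤ) : (F.add1 c).O = F.O := by
  change od (F.R + C c) = _
  rw [od_add, od_C, add_zero]; rfl
lemma El.add1_triv {F : El n ℤ} {c : ℤ} (h : Triv (F.add1 c)) : Triv F := by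
  obtain ⟨t, ht⟩ := h
  refine ⟨t, fun g hg => ?_⟩
  have := ht g hg
  rwa [add1_val, if_neg hg, add_zero] at this

lemma El.add1_set {F : El n ℤ} (hF : IsSet F) {c : ℤ} (h : F.R.c 0 + c = 0 ∨ F.R.c 0 + c = 1) : IsSet (F.add1 c) := by
  intro g
  rw [add1_val]
  split_ifs with hg
  · subst hg; exact h
  · rw [add_zero]; exact hF g

/-- minimality -/
lemma SR.min_triv (A : SR n) {F : El n ℤ} (hF : Good A F) (hmin : ∀ F', Good A F' → (PI F).card ≤ (PI F').card)
    {p : ℕ} (hpi : p ∈ PI F) : Triv ((F.map (Int.castRingHom (ZMod p))) ^ p) := by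
  obtain ⟨hp, hd, h2, hs⟩ := mem_PI.1 hpi
  have : Fact p.Prime := ⟨hp⟩
  have hd4 : p ∣ 4 * n := hd.mul_left 4
  set y := F.map (Int.castRingHom (ZMod p)) with hy
  have hym : Mem A.r y := A.map_mem hF.mem _
  have hyr : ERat y := hF.rat.map _
  refine triv_of_ind' ℤ _ fun v hv => ?_
  by_contra hnt
  set F1 := (y ^ p).map (ind ℤ v) with hF1
  let F2 := F1.add1 (- F1.R.c 0)
  have hg : Good A F2 := by
    refine ⟨A.add1_mem (A.map_mem (A.pow_mem hym p) _) _, add1_set (isSet_ind _ _) (Or.inl (add_neg_cancel (F1.R.c 0))),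
      ((A.erat_pow p h2 hym hyr).map _).add1 _, fun h => hnt (add1_triv h), ?_⟩
    change (F1.R + C (- F1.R.c 0)).c 0 = 0
    rw [add_c, C_c, if_pos rfl, add_neg_cancel]
  have hsup : ∀ x, F2.E.c x ≠ 0 → (y.E ^ p).c x ≠ 0 := by
    intro x hx
    by_cases hx0 : x = 0
    · exfalso
      subst hx0
      apply hx
      rw [El.E, ev_c_even (map_zero _)]
      exact hg.zero
    have h1 : F1.E.c x ≠ 0 := by
      intro h0
      apply hx
      change (F1.add1 _).E.c x = 0
      rw [add1_E, add_c, h0, C_c, if_neg hx0, add_zero]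
    rw [← (A.frob p h2 hym).1, map_ind_E_ne hv h1]
    exact hv
  have hlt : PI F2 ⊂ PI F := by
    rw [Finset.ssubset_iff_of_subset]
    · refine ⟨p, hpi, fun h => ?_⟩
      apply (mem_PI.1 h).2.2.2
      intro x hx
      by_contra hq
      exact hsup x hx (RatL.pow_c_not hp hd4 hyr hq)
    · intro p' hp'
      obtain ⟨a1, a2, a3, a4⟩ := mem_PI.1 hp'
      refine mem_PI.2 ⟨a1, a2, a3, fun hsp => a4 fun x hx => ?_⟩
      have h1 := hsup x hx
      rw [pow_c hp] at h1
      obtain ⟨w, -, hw⟩ := Finset.exists_ne_zero_of_sum_ne_zero h1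
      rw [ite_ne_right_iff] at hw
      obtain ⟨rfl, hw⟩ := hw
      have h3 : F.E.c w ≠ 0 := by
        intro h0
        apply hw
        rw [hy, map_E, pmap_c, h0, map_zero]
      exact (hsp w h3).mul_left _
  exact absurd (hmin F2 hg) (not_le.2 (Finset.card_lt_card hlt))

lemma one_add_Z_mul_c {k : Type} [CommRing k] (f : Lam (Zm n) k) (x : Zm n) : ((1 + Z) * f).c x = f.c x + f.c (x + zz) := by
  rw [add_mul, one_mul, add_c, Z_mul_c]

lemma SR.tt_p (A : SR n) (hn : 3 ≤ n) {F : El n ℤ} (hF : Good A F) {p : ℕ} (hp : p.Prime) (hd : p ∣ n) (h2 : p ≠ 2)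
    (ht : Triv ((F.map (Int.castRingHom (ZMod p))) ^ p)) : ∃ ε, TT A (F.add1 ε) ∧ d (uu p) * (F.add1 ε).E = (F.add1 ε).E ∧
      d (uu p) * ((1 + Z) * (F.add1 ε).O) = (1 + Z) * (F.add1 ε).O := by
  have : Fact p.Prime := ⟨hp⟩
  have h3 : 3 ≤ p := by have := hp.two_le; omega
  have hd4 : p ∣ 4 * n := hd.mul_left 4
  set y := F.map (Int.castRingHom (ZMod p)) with hy
  have hym : Mem A.r y := A.map_mem hF.mem _
  have hyr : ERat y := hF.rat.map _
  have hpu := par_uu hp h2 hd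
  have hune := uu_ne hp hd4
  obtain ⟨c, hc⟩ := ht
  have hfr := A.frob p h2 hym
  have hcE : ∀ x, x ≠ 0 → par x = 0 → (y.E ^ p).c x = c := by
    intro x hx hx0
    rw [← hfr.1, El.E, ev_c_even hx0]
    exact hc (x, false) (by simpa using hx)
  have hc0 : c = 0 := by
    rw [← hcE _ hune hpu]
    refine RatL.pow_c_not hp hd4 hyr ?_
    have := not_dvd_add_uu hp hd4 (dvd_zero (qq n p : Zm n))
    rwa [zero_add] at this
  subst hc0
  have hcE' : ∀ x, x ≠ 0 → (y.E ^ p).c x = 0 := by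
    intro x hx
    rcases par_cases x with h | h
    · exact hcE x hx h
    · exact (isEv_ev y.R : IsEv y.E).pow p x h
  have hperE : ∀ x, x ≠ 0 → x + uu p ≠ 0 → F.E.c (x + uu p) = F.E.c x := by
    intro x hx hxu
    have h1 := RatL.per_of_pow hp hd4 hyr hcE' x hx hxu
    rw [hy, map_E, pmap_c, pmap_c] at h1
    have h4 : ((F.E.c (x + uu p) - F.E.c x : ℤ) : ZMod p) = 0 := by push_cast; exact sub_eq_zero.2 h1
    have b1 := hF.set.E.nonneg x; have b2 := hF.set.E.le_one x
    have b3 := hF.set.E.nonneg (x + uu p); have b4 := hF.set.E.le_one (x + uu p)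
    have := cast_small h3 (by omega) (by omega) h4
    omega
  have hperO : ∀ x, ((1 + Z) * F.O).c (x + uu p) = ((1 + Z) * F.O).c x := by
    intro x
    have hO : IsOd ((1 + Z) * F.O) := isEv_one_add_Z.mul_od (isOd_od _)
    rcases par_cases x with h | h
    · rw [hO _ h, hO _ (by rw [map_add, h, hpu, add_zero])]
    have hx : x ≠ 0 := by rintro rfl; rw [map_zero] at h; exact absurd h (by decide)
    have hxu : x + uu p ≠ 0 := by
      intro h'
      have := congrArg par h'
      rw [map_add, h, hpu, map_zero, add_zero] at this
      exact absurd this (by decide)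
    set g := pmap (Int.castRingHom (ZMod p)) ((1 + Z) * F.O) with hg
    have hgr : RatL g := fun u x => by rw [hg, pmap_c, pmap_c, A.ratO hn hF.mem hF.rat u x]
    have hgO : g = (1 + Z) * y.O := by rw [hg, map_mul, map_add, map_one, pmap_Z, hy, map_O]
    have hgp : g ^ p = (1 + Z) * (y ^ p).O := by rw [hfr.2, hgO, mul_pow, one_add_Z_pow p h2]
    have h1 := RatL.per_of_pow hp hd4 hgr (by
      intro x hx
      rw [hgp, one_add_Z_mul_c]
      have : ∀ x, (y ^ p).O.c x = 0 := by
        intro x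
        rcases par_cases x with h | h
        · exact isOd_od _ _ h
        · rw [El.O, od_c_odd h]
          exact hc (x, false) (by rintro ⟨⟩; rw [map_zero] at h; exact absurd h (by decide))
      rw [this, this, add_zero]) x hx hxu
    rw [hg, pmap_c, pmap_c] at h1
    have h4 : ((((1 + Z) * F.O).c (x + uu p) - ((1 + Z) * F.O).c x : ℤ) : ZMod p) = 0 := by
      push_cast; exact sub_eq_zero.2 h1
    rw [one_add_Z_mul_c, one_add_Z_mul_c] at *
    have b1 := hF.set.O.nonneg x; have b2 := hF.set.O.le_one x
    have b3 := hF.set.O.nonneg (x + uu p); have b4 := hF.set.O.le_one (x + uu p)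
    have b5 := hF.set.O.nonneg (x + zz); have b6 := hF.set.O.le_one (x + zz)
    have b7 := hF.set.O.nonneg (x + uu p + zz); have b8 := hF.set.O.le_one (x + uu p + zz)
    have := cast_small h3 (by omega) (by omega) h4
    omega
  have per_d : ∀ f : Lam (Zm n) ℤ, (∀ x, f.c (x + uu p) = f.c x) → d (uu p) * f = f := by
    intro f hf
    ext x
    rw [d_mul_c]
    conv_rhs => rw [← sub_add_cancel x (uu p), hf]
  let ε := F.E.c (uu p)
  have hF0 : F.E.c 0 = 0 := by rw [El.E, ev_c_even (map_zero _)]; exact hF.zero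
  have hE : d (uu p) * (F.add1 ε).E = (F.add1 ε).E := by
    apply per_d
    intro x
    rw [add1_E, add_c, add_c, C_c, C_c]
    by_cases hx : x = 0
    · subst hx; simp [hune, hF0, ε]
    by_cases hxu : x + uu p = 0
    · have hx' : x = - uu p := by rw [← add_eq_zero_iff_eq_neg]; exact hxu
      have h5 : F.E.c (- uu p) = F.E.c (uu p) := by
        have := congrArg (fun f => f.c (uu p)) (A.sym hF.mem).E
        simpa using this
      rw [hxu, hx']; simp [hune, hF0, ε, h5]
    · rw [hperE x hx hxu, if_neg hx, if_neg hxu]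
  have hO : d (uu p) * ((1 + Z) * (F.add1 ε).O) = (1 + Z) * (F.add1 ε).O := by
    rw [add1_O]; exact per_d _ hperO
  have hm : Mem A.r (F.add1 ε) := A.add1_mem hF.mem _
  refine ⟨ε, ⟨hm, add1_set hF.set ?_, hF.rat.add1 _, fun h => hF.nt (add1_triv h), ?_⟩, hE, hO⟩
  · rw [hF.zero, zero_add]; exact hF.set.E _
  · have hS := A.sym hm
    have hSS : d (uu p) * (F.add1 ε * F.add1 ε).S = (F.add1 ε * F.add1 ε).S := by
      rw [S_eq, hS.sq_P, hS.sq_Q]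
      generalize (F.add1 ε) = T at *
      have hq := hS.Q
      linear_combination (2 * T.P + 2 * T.Q) * hE + (T.Q + T.P) * hO + (1 - d (uu p)) * T.O * hq
    refine triv_of_ind ℤ _ fun v => ?_
    exact A.lemP hn hp h2 hd (A.map_mem (A.mul_mem _ _ hm hm) _) (isSet_ind _ _) ((A.rat_sq hn hm (hF.rat.add1 _)).map _)
      (map_dS hSS _)

lemma eq_zero_of_all_qq {x : Zm n} (h : ∀ p : ℕ, p.Prime → p ∣ 4 * n → (qq n p : Zm n) ∣ x) : x = 0 := by
  have hx : x = ((x.val : ℕ) : Zm n) := by simp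
  rw [hx, natCast_eq_zero_iff', Nat.dvd_iff_prime_pow_dvd_dvd]
  intro p k hp hk
  by_cases hk0 : k = 0
  · subst hk0; simp
  have h1 := h p hp ((dvd_pow_self p hk0).trans hk)
  rw [hx, natCast_dvd_iff (qq_dvd p)] at h1
  refine (pow_dvd_pow p ?_).trans h1
  exact (hp.pow_dvd_iff_le_factorization four_ne).1 hk

lemma uu_two : (uu 2 : Zm n) = zz := by
  rw [uu, zz]; congr 1; omega

lemma qq_dvd_zz {p : ℕ} (hp : p.Prime) (h2 : p ≠ 2) : (qq n p : Zm n) ∣ zz := by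
  rw [zz, natCast_dvd_iff (qq_dvd p)]
  have h1 : Nat.Coprime (qq n p) 2 := Nat.Coprime.pow_left _ ((Nat.coprime_primes hp Nat.prime_two).2 h2)
  refine h1.dvd_of_dvd_mul_left (m := 2) ?_
  have := qq_dvd (n := n) p
  rwa [show 2 * (2 * n) = 4 * n by ring]

lemma SR.tt_z (A : SR n) (hn : 3 ≤ n) {F : El n ℤ} (hF : Good A F) (h0 : ∀ p, p.Prime → p ∣ n → p ≠ 2 → Supp p F) :
    ∃ ε, TT A (F.add1 ε) ∧ Z * (F.add1 ε).E = (F.add1 ε).E := by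
  have hd2 : 2 ∣ 4 * n := by omega
  have hsup : ∀ x, F.E.c x ≠ 0 → ∀ p, p.Prime → p ≠ 2 → p ∣ 4 * n → (qq n p : Zm n) ∣ x := by
    intro x hx p hp h2 hd
    refine h0 p hp ?_ h2 x hx
    rcases (Nat.Prime.dvd_mul hp).1 hd with h | h
    · exfalso
      have : p ∣ 2 ^ 2 := h
      exact h2 ((Nat.prime_dvd_prime_iff_eq hp Nat.prime_two).1 (hp.dvd_of_dvd_pow this))
    · exact h
  have hF0 : F.E.c 0 = 0 := by rw [El.E, ev_c_even (map_zero _)]; exact hF.zero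
  have k1 : ∀ x, (qq n 2 : Zm n) ∣ x → F.E.c x = 0 := by
    intro x hx
    by_contra hne
    apply hne
    rw [eq_zero_of_all_qq (x := x), hF0]
    intro p hp hd
    by_cases h2 : p = 2
    · subst h2; exact hx
    · exact hsup x hne p hp h2 hd
  have k2 : ∀ x, x ≠ 0 → (qq n 2 : Zm n) ∣ x → F.E.c (x + zz) = 0 := by
    intro x hx0 hx
    by_contra hne
    apply hx0
    refine eq_zero_of_all_qq ?_
    intro p hp hd
    by_cases h2 : p = 2
    · subst h2; exact hx
    · have := hsup _ hne p hp h2 hd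
      exact (dvd_add_left (qq_dvd_zz hp h2)).1 this
  have hper : ∀ x, x ≠ 0 → x ≠ zz → F.E.c (x + zz) = F.E.c x := by
    intro x hx hxz
    by_cases h1 : (qq n 2 : Zm n) ∣ x
    · rw [k1 x h1, k2 x hx h1]
    by_cases h2 : (qq n 2 : Zm n) ∣ x + zz
    · have := k2 (x + zz) (by rw [Ne, ← eq_neg_iff_add_eq_zero, neg_zz]; exact hxz) h2
      rw [add_assoc, zz_add, add_zero] at this
      rw [k1 _ h2, this]
    · have := RatL.coset (n := n) (p := 2) hF.rat Nat.prime_two hd2 (p_mul_add_uu hd2 x) (by rwa [uu_two]) h1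
      rwa [uu_two] at this
  let ε := F.E.c zz
  have hE : Z * (F.add1 ε).E = (F.add1 ε).E := by
    ext x
    rw [Z_mul_c, add1_E, add_c, add_c, C_c, C_c]
    by_cases hx : x = 0
    · subst hx; simp [zz_ne, hF0, ε]
    by_cases hxz : x = zz
    · subst hxz; simp [zz_add, zz_ne, hF0, ε]
    · rw [hper x hx hxz, if_neg hx, if_neg]
      rw [← eq_neg_iff_add_eq_zero, neg_zz]; exact hxz
  have hm : Mem A.r (F.add1 ε) := A.add1_mem hF.mem _
  refine ⟨ε, ⟨hm, add1_set hF.set ?_, hF.rat.add1 _, fun h => hF.nt (add1_triv h), A.sq_triv hm hE⟩, hE⟩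
  rw [hF.zero, zero_add]; exact hF.set.E _

/-- support for primes outside `PI` -/
lemma SR.supp_R (A : SR n) (hn : 3 ≤ n) {F : El n ℤ} (hF : Good A F) {p : ℕ} (hp : p.Prime) (hd : p ∣ n) (h2 : p ≠ 2)
    (hs : Supp p F) (x : Zm n) (hx : F.R.c x ≠ 0) : (p : Zm n) ∣ x := by
  have : Fact p.Prime := ⟨hp⟩
  have h3 : 3 ≤ p := by have := hp.two_le; omega
  have hd4 : p ∣ 4 * n := hd.mul_left 4
  have hpq : (p : Zm n) ∣ (qq n p : Zm n) := by
    rw [natCast_dvd_iff hd4]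
    refine dvd_pow_self p ?_
    have := (hp.dvd_iff_one_le_factorization four_ne).1 hd4
    omega
  rcases par_cases x with h | h
  · refine hpq.trans (hs x ?_)
    rwa [El.E, ev_c_even h]
  · set y := F.map (Int.castRingHom (ZMod p)) with hy
    have hym : Mem A.r y := A.map_mem hF.mem _
    have hyr : ERat y := hF.rat.map _
    have hfix := A.frob_supp hn hp h2 hd4 hym hyr (by
      intro x hx
      apply hs
      intro h0
      apply hx
      rw [hy, map_E, pmap_c, h0, map_zero])
    have hfr := (A.frob p h2 hym).2
    rw [hfix, ← one_add_Z_pow p h2, ← mul_pow, one_add_Z_pow p h2] at hfr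
    by_contra hnd
    have h1 := congrArg (fun f => f.c x) hfr
    simp only [pow_c hp] at h1
    rw [Finset.sum_eq_zero (by
      intro w _
      rw [if_neg]
      rintro rfl
      exact hnd (dvd_mul_right _ _)), one_add_Z_mul_c, hy, map_O, pmap_c, pmap_c] at h1
    have h4 : ((F.O.c x + F.O.c (x + zz) : ℤ) : ZMod p) = 0 := by push_cast; exact h1
    have b1 := hF.set.O.nonneg x; have b2 := hF.set.O.le_one x
    have b5 := hF.set.O.nonneg (x + zz); have b6 := hF.set.O.le_one (x + zz)
    have := cast_small h3 (by omega) (by omega) h4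
    have h6 : F.O.c x = 0 := by omega
    rw [El.O, od_c_odd h] at h6
    exact hx h6

open Classical in
/-- trichotomy -/
lemma SR.tri (A : SR n) (hn : 3 ≤ n) (hnt : ∃ g h, g ≠ (0, false) ∧ h ≠ (0, false) ∧ ¬ A.r g h) :
    (∃ T p, TT A T ∧ p.Prime ∧ p ∣ n ∧ p ≠ 2 ∧ ∀ x, T.R.c x ≠ 0 → (p : Zm n) ∣ x) ∨
    (∀ p, p.Prime → p ∣ n → p ≠ 2 → ∃ T, TT A T ∧ d (uu p) * T.E = T.E ∧
      d (uu p) * ((1 + Z) * T.O) = (1 + Z) * T.O) ∧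
    ((∀ p, p.Prime → p ∣ n → p = 2) → ∃ T, TT A T ∧ Z * T.E = T.E) := by
  have hex : ∃ F, Good A F := by
    let T : El n ℤ := El.of (fun g => if A.r (zz, false) g then 1 else 0)
    have hz0 : ¬ A.r (zz, false) (0, false) := by
      intro h
      have := A.one_cls _ (A.eqv.symm h)
      simp [zz_ne] at this
    have hm : Mem A.r T := by
      intro a b hab
      simp only [T, of_val]
      have : A.r (zz, false) a ↔ A.r (zz, false) b :=
        ⟨fun h => A.eqv.trans h hab, fun h => A.eqv.trans h (A.eqv.symm hab)⟩
      simp [this]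
    have hT : IsSet T := by
      intro g; simp only [T, of_val]; split_ifs <;> simp
    have hz : T.val (zz, false) = 1 := by
      simp only [T, of_val]; rw [if_pos (A.eqv.refl _)]
    have h1 : ∀ g, T.val g = 1 → A.r (zz, false) g := by
      intro g hg
      by_contra h
      simp [T, h] at hg
    refine ⟨T, hm, hT, A.zclass hT hm h1 hz, ?_, ?_⟩
    · rintro ⟨c, hc⟩
      obtain ⟨g, h, hg, hh, hgh⟩ := hnt
      have c1 := hc _ (show ((zz : Zm n), false) ≠ (0, false) by simp [zz_ne])
      rw [hz] at c1
      have c2 := hc g hg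
      have c3 := hc h hh
      rw [← c1] at c2 c3
      exact hgh (A.eqv.trans (A.eqv.symm (h1 g c2)) (h1 h c3))
    · change T.val (0, false) = 0
      simp only [T, of_val]; rw [if_neg hz0]
  obtain ⟨F, hF, hmin⟩ : ∃ F, Good A F ∧ ∀ F', Good A F' → (PI F).card ≤ (PI F').card := by
    have hex' : ∃ m, ∃ F, Good A F ∧ (PI F).card = m := by
      obtain ⟨F, hF⟩ := hex; exact ⟨_, F, hF, rfl⟩
    obtain ⟨F, hF, hm⟩ := Nat.find_spec hex'
    exact ⟨F, hF, fun F' hF' => by rw [hm]; exact Nat.find_min' hex' ⟨F', hF', rfl⟩⟩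
  by_cases hc : ∃ p, p.Prime ∧ p ∣ n ∧ p ≠ 2 ∧ Supp p F
  · left
    obtain ⟨p, hp, hd, h2, hs⟩ := hc
    obtain ⟨ε, hTT⟩ : ∃ ε, TT A (F.add1 ε) := by
      by_cases hpi : ∃ q, q ∈ PI F
      · obtain ⟨q, hq⟩ := hpi
        obtain ⟨a1, a2, a3, a4⟩ := mem_PI.1 hq
        obtain ⟨ε, h, -⟩ := A.tt_p hn hF a1 a2 a3 (A.min_triv hF hmin hq)
        exact ⟨ε, h⟩
      · obtain ⟨ε, h, -⟩ := A.tt_z hn hF (by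
          intro q a1 a2 a3
          by_contra hs
          exact hpi ⟨q, mem_PI.2 ⟨a1, a2, a3, hs⟩⟩)
        exact ⟨ε, h⟩
    refine ⟨_, p, hTT, hp, hd, h2, fun x hx => ?_⟩
    by_cases hx0 : x = 0
    · subst hx0; exact dvd_zero _
    refine A.supp_R hn hF hp hd h2 hs x ?_
    change (F.R + C ε).c x ≠ 0 at hx
    rwa [add_c, C_c, if_neg hx0, add_zero] at hx
  · right
    push Not at hc
    refine ⟨fun p hp hd h2 => ?_, fun h => ?_⟩
    · obtain ⟨ε, h⟩ := A.tt_p hn hF hp hd h2 (A.min_triv hF hmin (mem_PI.2 ⟨hp, hd, h2, hc p hp hd h2⟩))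
      exact ⟨_, h⟩
    · obtain ⟨ε, h⟩ := A.tt_z hn hF (fun p hp hd h2 => absurd (h p hp hd) h2)
      exact ⟨_, h⟩

end choose

set_option linter.unusedSectionVars false
set_option linter.unusedVariables false
set_option linter.unusedSimpArgs false
open Lam El

/-- position of the exceptional size -/
def Pos (e o p q s δ : ℤ) : Prop :=
  (e = s + δ ∧ o = s ∧ p = s ∧ q = s) ∨ (e = s ∧ o = s + δ ∧ p = s ∧ q = s) ∨
  (e = s ∧ o = s ∧ p = s + δ ∧ q = s) ∨ (e = s ∧ o = s ∧ p = s ∧ q = s + δ)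

lemma shape {n e o p q α ν : ℤ} (h1 : e ^ 2 + o ^ 2 + p ^ 2 + q ^ 2 = α + 2 * n * ν)
    (h2 : e * o + p * q = n * ν) (h3 : e * p + o * q = n * ν) (h4 : e * q + o * p = n * ν) :
    ∃ μ s δ : ℤ, 0 ≤ μ ∧ α = μ ^ 2 ∧ (δ = μ ∨ δ = -μ) ∧ n * ν = s * (2 * s + δ) ∧ Pos e o p q s δ := by
  have hD : (e + o - p - q) ^ 2 = α := by linear_combination h1 + 2 * h2 - 2 * h3 - 2 * h4
  have a1 : (e - o + p - q) ^ 2 = (e + o - p - q) ^ 2 := by linear_combination -4 * h2 + 4 * h3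
  have a2 : (e - o - p + q) ^ 2 = (e + o - p - q) ^ 2 := by linear_combination -4 * h2 + 4 * h4
  refine ⟨|e + o - p - q|, ?_⟩
  have hab : ∀ δ : ℤ, (δ = e + o - p - q ∨ δ = -(e + o - p - q)) → (δ = |e + o - p - q| ∨ δ = -|e + o - p - q|) := by
    intro δ h
    rcases abs_cases (e + o - p - q) with ⟨h', _⟩ | ⟨h', _⟩ <;> rw [h'] <;> omega
  rcases sq_eq_sq_iff_eq_or_eq_neg.1 a1 with b1 | b1 <;> rcases sq_eq_sq_iff_eq_or_eq_neg.1 a2 with b2 | b2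
  · refine ⟨o, e - o, abs_nonneg _, by rw [sq_abs, hD], hab _ (by omega), ?_, Or.inl ⟨by omega, by omega, by omega, by omega⟩⟩
    have : p = o := by omega
    have : q = o := by omega
    subst p q; linear_combination - h2
  · refine ⟨e, q - e, abs_nonneg _, by rw [sq_abs, hD], hab _ (by omega), ?_, Or.inr <| Or.inr <| Or.inr ⟨by omega, by omega, by omega, by omega⟩⟩
    have : o = e := by omega
    have : p = e := by omega
    subst o p; linear_combination - h2
  · refine ⟨e, p - e, abs_nonneg _, by rw [sq_abs, hD], hab _ (by omega), ?_, Or.inr <| Or.inr <| Or.inl ⟨by omega, by omega, by omega, by omega⟩⟩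
    have : o = e := by omega
    have : q = e := by omega
    subst o q; linear_combination - h2
  · refine ⟨e, o - e, abs_nonneg _, by rw [sq_abs, hD], hab _ (by omega), ?_, Or.inr <| Or.inl ⟨by omega, by omega, by omega, by omega⟩⟩
    have : p = e := by omega
    have : q = e := by omega
    subst p q; linear_combination - h2

section kill
variable {n : ℕ} [NeZero n] {A : SR n}

/-- complement -/
def El.compl (T : El n ℤ) : El n ℤ := ⟨all - T.R, all - T.S⟩

lemma El.compl_val (T : El n ℤ) (g) : T.compl.val g = 1 - T.val g := by
  obtain ⟨x, i⟩ := g; cases i <;> simp [El.compl, val]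

lemma SR.compl_mem (A : SR n) {T : El n ℤ} (h : Mem A.r T) : Mem A.r T.compl := by
  intro a b hab; rw [compl_val, compl_val, h a b hab]

lemma El.compl_set {T : El n ℤ} (h : IsSet T) : IsSet T.compl := by
  intro g; rw [compl_val]; rcases h g with h | h <;> simp [h]

lemma El.compl_triv {T : El n ℤ} (h : Triv T.compl) : Triv T := by
  obtain ⟨c, hc⟩ := h
  refine ⟨1 - c, fun g hg => ?_⟩
  have := hc g hg
  rw [compl_val] at this; omega

lemma ev_sub' (f g : Lam (Zm n) ℤ) : ev (f - g) = ev f - ev g := by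
  ext x; simp only [ev, sub_c]; split_ifs <;> simp
lemma od_sub' (f g : Lam (Zm n) ℤ) : od (f - g) = od f - od g := by
  ext x; simp only [od, sub_c]; split_ifs <;> simp

lemma El.compl_E (T : El n ℤ) : T.compl.E = ev all - T.E := ev_sub' _ _
lemma El.compl_O (T : El n ℤ) : T.compl.O = od all - T.O := od_sub' _ _
lemma El.compl_P (T : El n ℤ) : T.compl.P = ev all - T.P := ev_sub' _ _
lemma El.compl_Q (T : El n ℤ) : T.compl.Q = od all - T.Q := od_sub' _ _

lemma SR.e_ne (hn : 3 ≤ n) {T : El n ℤ} (h : Mem A.r T) (hs : IsSet T) (hnt : ¬ Triv T) : aug T.E ≠ 0 := by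
  intro h0
  refine hnt ⟨0, fun g _ => A.E_zero hn h (hs.E.eq_zero_of_aug h0) g⟩

lemma SR.s_ne {T : El n ℤ} (h : Mem A.r T) (hs : IsSet T) (hnt : ¬ Triv T) : aug T.P + aug T.Q ≠ 0 := by
  intro h0
  have p0 := hs.P.aug_nonneg
  have q0 := hs.Q.aug_nonneg
  have hS : T.S = 0 := by
    rw [S_eq, hs.P.eq_zero_of_aug (by omega), hs.Q.eq_zero_of_aug (by omega), add_zero]
  obtain ⟨c, hc⟩ := A.prim2 T h hS
  refine hnt ⟨0, ?_⟩
  rintro ⟨x, i⟩ hg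
  cases i
  · simp at hg; simp [hc, C_c, hg, -eq_intCast]
  · simp [hS]

lemma TT.e_pos (hn : 3 ≤ n) {T : El n ℤ} (h : TT A T) : 1 ≤ aug T.E := by
  have := SR.e_ne hn h.mem h.set h.nt
  have := h.set.E.aug_nonneg
  omega
lemma TT.s_pos {T : El n ℤ} (h : TT A T) : 1 ≤ aug T.P + aug T.Q := by
  have := SR.s_ne h.mem h.set h.nt
  have p0 := h.set.P.aug_nonneg
  have q0 := h.set.Q.aug_nonneg
  omega
lemma TT.e_lt (hn : 3 ≤ n) {T : El n ℤ} (h : TT A T) : aug T.E ≤ 2 * n - 1 := by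
  have := SR.e_ne hn (A.compl_mem h.mem) (compl_set h.set) (fun h' => h.nt (compl_triv h'))
  have h2 := (compl_set h.set).E.aug_nonneg
  rw [compl_E, map_sub, aug_ev_all] at this h2
  omega
lemma TT.s_lt {T : El n ℤ} (h : TT A T) : aug T.P + aug T.Q ≤ 4 * n - 1 := by
  have := SR.s_ne (A.compl_mem h.mem) (compl_set h.set) (fun h' => h.nt (compl_triv h'))
  have h2 := (compl_set h.set).P.aug_nonneg
  have h3 := (compl_set h.set).Q.aug_nonneg
  rw [compl_P, map_sub, aug_ev_all] at this h2
  rw [compl_Q, map_sub, aug_od_all] at this h3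
  omega

/-- the numerical data of `T` -/
structure NumD (T : El n ℤ) (μ s δ ν : ℤ) : Prop where
  sz : Sizes T (μ ^ 2) ν
  two : 2 ≤ μ
  hδ : δ = μ ∨ δ = -μ
  hν : n * ν = s * (2 * s + δ)
  hk : 4 * s + δ = μ ^ 2 + ν
  pos : Pos (aug T.E) (aug T.O) (aug T.P) (aug T.Q) s δ

lemma TT.num (hn : 3 ≤ n) {T : El n ℤ} (h : TT A T) : ∃ μ s δ ν, NumD T μ s δ ν := by
  obtain ⟨α, ν, H⟩ := sizes (A.sym h.mem) h.set h.sq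
  obtain ⟨μ, s, δ, h0, rfl, hδ, hν, hp⟩ := shape H.h1 H.h2 H.h3 H.h4
  have hk : 4 * s + δ = μ ^ 2 + ν := by
    have := H.hk
    rcases hp with hp | hp | hp | hp <;> omega
  refine ⟨μ, s, δ, ν, H, ?_, hδ, hν, hk, hp⟩
  by_contra hlt
  have e1 := h.e_pos hn
  have e2 := h.e_lt hn
  have s1 := h.s_pos
  have s2 := h.s_lt
  have hn' : (3 : ℤ) ≤ n := by exact_mod_cast hn
  have key : (n : ℤ) * (4 * s + δ - μ ^ 2) = s * (2 * s + δ) := by rw [← hν, hk]; ring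
  have hm : μ = 0 ∨ μ = 1 := by omega
  rcases hm with rfl | rfl
  · have : δ = 0 := by omega
    subst this
    have h2 : s * (2 * n - s) = 0 := by
      have : 2 * (s * (2 * n - s)) = 0 := by linear_combination key
      omega
    rcases mul_eq_zero.1 h2 with h2 | h2 <;> rcases hp with hp | hp | hp | hp <;> omega
  · have h2 : (n - s - δ * n) * (2 * (n - s) + δ * (2 * n - 1)) = 0 := by
      have hdd : δ ^ 2 = 1 := by rcases hδ with rfl | rfl <;> norm_num
      linear_combination -key - (n * (2 * n - 1)) * hdd
    rcases mul_eq_zero.1 h2 with h2 | h2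
    · rcases hδ with rfl | rfl <;> rcases hp with hp | hp | hp | hp <;> omega
    · rcases hδ with rfl | rfl <;> omega

lemma aug_push {N : Type} [AddCommGroup N] [Fintype N] [DecidableEq N] (φ : Zm n →+ N) (f : Lam (Zm n) ℤ) :
    aug (push φ f) = aug f := by
  rw [aug_apply, aug_apply]
  simp only [push_c]
  rw [Finset.sum_comm]
  simp

lemma push_inv {N : Type} [AddCommGroup N] [Fintype N] [DecidableEq N] (φ : Zm n →+ N) (f : Lam (Zm n) ℤ) :
    push φ (inv f) = inv (push φ f) := by
  ext y
  rw [push_c, inv_c, push_c]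
  exact Fintype.sum_equiv (Equiv.neg _) _ _ (fun w => by simp [neg_eq_iff_eq_neg])

lemma mul_inv_c {M : Type} [AddCommGroup M] [Fintype M] [DecidableEq M] (f : Lam M ℤ) :
    (f * inv f).c 0 = ∑ x, f.c x ^ 2 := by
  rw [mul_c]
  exact Finset.sum_congr rfl fun x _ => by simp [pow_two]

lemma push_all {N : Type} [AddCommGroup N] [Fintype N] [DecidableEq N] (φ : Zm n →+ N)
    (hs : Function.Surjective φ) (y : N) : (push φ (all : Lam (Zm n) ℤ)).c y = (push φ (all : Lam (Zm n) ℤ)).c 0 := by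
  obtain ⟨x, rfl⟩ := hs y
  rw [push_c, push_c]
  exact Fintype.sum_equiv (Equiv.subRight x) _ _ (fun w => by simp [sub_eq_zero])

lemma fin1 {n μ : ℤ} (hn : 3 ≤ n) (h2 : 2 ≤ μ) (h : n * (4 * μ + -μ - μ ^ 2) = μ * (2 * μ + -μ)) : False := by
  have h0 : μ ≠ 0 := by omega
  have h1 : n * (3 - μ) = μ := mul_left_cancel₀ h0 (by linear_combination h)
  have : μ < 3 := by
    by_contra hc; push Not at hc
    have : n * (3 - μ) ≤ 0 := mul_nonpos_of_nonneg_of_nonpos (by omega) (by omega)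
    omega
  have : μ = 2 := by omega
  subst this
  omega

lemma fin2 {n s δ : ℤ} (hn : 3 ≤ n) (h1 : 1 ≤ s) (h2 : 2 * s ≤ δ) (h : n * (4 * s + δ - δ ^ 2) = s * (2 * s + δ)) : False := by
  have h3 : 0 < n * (4 * s + δ - δ ^ 2) := by rw [h]; exact mul_pos (by omega) (by omega)
  have h4 : 0 < 4 * s + δ - δ ^ 2 := by
    by_contra hc; push Not at hc
    have := mul_nonpos_of_nonneg_of_nonpos (show (0 : ℤ) ≤ n by omega) hc
    omega
  have : δ < 3 := by
    by_contra hc; push Not at hc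
    nlinarith
  have : δ = 2 := by omega
  subst this
  have : s = 1 := by omega
  subst this
  omega

set_option maxHeartbeats 1000000 in
/-- kill I -/
lemma TT.kill1 (hn : 3 ≤ n) {T : El n ℤ} (h : TT A T) {p : ℕ} (hp : p.Prime) (hd : p ∣ n)
    (hR : ∀ x, T.R.c x ≠ 0 → (p : Zm n) ∣ x) : False := by
  obtain ⟨μ, s, δ, ν, N⟩ := h.num hn
  have : Fact p.Prime := ⟨hp⟩
  have hd4 : p ∣ 4 * n := hd.mul_left 4
  let φ : Zm n →+ ZMod p := (ZMod.castHom hd4 (ZMod p)).toAddMonoidHom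
  have hφ : ∀ x : Zm n, φ x = ZMod.castHom hd4 (ZMod p) x := fun x => rfl
  have hφp : ∀ x : Zm n, (p : Zm n) ∣ x → φ x = 0 := by
    rintro x ⟨y, rfl⟩; rw [hφ, map_mul, map_natCast]; simp
  have hsurj : Function.Surjective φ := ZMod.castHom_surjective hd4
  set H := N.sz
  have hRc : push φ T.R = (C (aug T.E + aug T.O) : Lam (ZMod p) ℤ) := by
    ext y
    rw [push_c, C_c]
    by_cases hy : y = 0
    · subst hy
      rw [if_pos rfl, ← map_add, ← R_eq, aug_apply]
      refine Finset.sum_congr rfl fun x _ => ?_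
      by_cases hx : T.R.c x = 0
      · simp [hx]
      · simp [hφp x (hR x hx)]
    · rw [if_neg hy]
      refine Finset.sum_eq_zero fun x _ => ?_
      by_cases hx : T.R.c x = 0
      · simp [hx]
      · rw [if_neg]; rw [hφp x (hR x hx)]; exact Ne.symm hy
  have hTR : T.R * T.R + T.S * inv T.S = C (μ ^ 2) + C ν * all := by
    have hS := A.sym h.mem
    have h1 : (T * T).R = C (μ ^ 2) + C ν * all := by
      rw [R_eq (T * T), H.hE, H.hO, add_assoc, ← mul_add, ev_add_od]
    rw [← h1, mul_R, hS.twS, S_eq, map_add]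
  have hpush := congrArg (push φ) hTR
  rw [map_add, map_mul, map_mul, map_add, map_mul, hRc, push_inv, push_C, push_C] at hpush
  have h0 := congrArg (fun f => f.c 0) hpush
  simp only [add_c, mul_inv_c, C_mul_c, ← map_mul] at h0
  rw [C_c, C_c, if_pos rfl, if_pos rfl] at h0
  set m := (push φ (all : Lam (Zm n) ℤ)).c 0 with hm
  have hpm : (p : ℤ) * m = 4 * n := by
    have := aug_push φ (all : Lam (Zm n) ℤ)
    rw [aug_all, aug_apply, Finset.sum_congr rfl (fun y _ => push_all φ hsurj y)] at this
    simpa [ZMod.card] using this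
  have hcs := sq_sum_le_card_mul_sum_sq (s := (Finset.univ : Finset (ZMod p))) (f := (push φ T.S).c)
  have hsum : ∑ y, (push φ T.S).c y = aug T.P + aug T.Q := by
    rw [← aug_apply, aug_push, S_eq, map_add]
  rw [hsum, Finset.card_univ, ZMod.card] at hcs
  have h1 := H.h1
  have h2 := H.h2
  have h3 := H.h3
  have h4 := H.h4
  have e1 := h.e_pos hn
  have s1 := h.s_pos
  have o0 := H.o0
  have p0 := H.p0
  have q0 := H.q0
  have hpos := N.pos
  have hk := N.hk
  have hν := N.hν
  have hδ := N.hδ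
  have two := N.two
  clear_value H
  clear hpush hTR hRc
  generalize aug T.E = e at *
  generalize aug T.O = o at *
  generalize aug T.P = P at *
  generalize aug T.Q = Q at *
  generalize ∑ x, (push φ T.S).c x ^ 2 = ss at *
  have hp2 : (2 : ℤ) ≤ p := by exact_mod_cast hp.two_le
  have hn' : (3 : ℤ) ≤ n := by exact_mod_cast hn
  have key : (n : ℤ) * (4 * s + δ - μ ^ 2) = s * (2 * s + δ) := by rw [← hν, hk]; ring
  have hrS : (e + o) ^ 2 + (P + Q) ^ 2 = μ ^ 2 + 4 * n * ν := by linear_combination h1 + 2 * h2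
  have hrS2 : (e + o) * (P + Q) = 2 * n * ν := by linear_combination h3 + h4
  have hle : ((p : ℤ) - 1) * ((e + o) ^ 2 - μ ^ 2) ≤ 0 := by
    have : (p : ℤ) * ((e + o) * (e + o) + ss) = p * μ ^ 2 + ν * (4 * n) := by rw [h0, ← hpm]; ring
    nlinarith
  have hr : e + o ≤ μ := by
    have : (e + o) ^ 2 - μ ^ 2 ≤ 0 := by
      by_contra hc; push Not at hc
      nlinarith
    nlinarith
  have hS : 2 * (e + o) ≤ P + Q := by
    have : (P + Q) * (2 * (e + o)) ≤ (P + Q) * (P + Q) := by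
      have h5 : (e + o) ^ 2 ≤ μ ^ 2 := by gcongr
      linarith
    exact le_of_mul_le_mul_left this (by omega)
  have hs0 : 0 ≤ s := by
    rcases hpos with hpos | hpos | hpos | hpos <;> omega
  rcases hpos with ⟨h6, h7, h8, h9⟩ | ⟨h6, h7, h8, h9⟩ | ⟨h6, h7, h8, h9⟩ | ⟨h6, h7, h8, h9⟩
  · rcases hδ with rfl | rfl <;> omega
  · obtain rfl : δ = -μ := by omega
    obtain rfl : μ = s := by omega
    exact fin1 hn' two key
  · obtain rfl : δ = μ := by omega
    exact fin2 hn' (by omega) (by omega) key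
  · obtain rfl : δ = μ := by omega
    exact fin2 hn' (by omega) (by omega) key
end kill

set_option linter.unusedSectionVars false
set_option linter.unusedVariables false
set_option linter.unusedSimpArgs false
open Lam El

section num

lemma core_pos {n h c t : ℤ} (hn : 3 ≤ n) (h0 : 0 ≤ h) (hc0 : 0 ≤ c) (ht : c * (n + 10 * h) ≤ t) : 0 ≤ t :=
  (mul_nonneg hc0 (by omega)).trans ht

lemma coreE {n h c μ : ℤ} (hn : 3 ≤ n) (h0 : 0 ≤ h) (hc : c = n - h) (hc0 : 0 ≤ c) (two : 2 ≤ μ)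
    (h1 : c * (n + 10 * h) ≤ 14 * (h * μ)) (h2 : μ * (n * μ + h) = 2 * c * (n + h)) : False := by
  have hcpos : 0 < c := by
    rcases hc0.lt_or_eq with h' | h'
    · exact h'
    · rw [← h'] at h2
      have : 0 < μ * (n * μ + h) := by positivity
      omega
  have hpos : 0 < h := by
    rcases h0.lt_or_eq with h | h
    · exact h
    · subst h
      have : 0 < c * n := by positivity
      simp only [mul_zero, add_zero, zero_mul] at h1; omega
  have h3 : (n * μ + h) * (n + 10 * h) ≤ 28 * h * (n + h) := by
    refine le_of_mul_le_mul_left ?_ (show 0 < μ by omega)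
    have := mul_le_mul_of_nonneg_left h1 (show 0 ≤ 2 * (n + h) by omega)
    calc μ * ((n * μ + h) * (n + 10 * h)) = (μ * (n * μ + h)) * (n + 10 * h) := by ring
      _ = 2 * (n + h) * (c * (n + 10 * h)) := by rw [h2]; ring
      _ ≤ _ := this
      _ = _ := by ring
  have hμ5 : μ < 5 := by
    by_contra hge; push Not at hge
    have : 5 * (n * n + 10 * (n * h)) ≤ μ * (n * n + 10 * (n * h)) :=
      mul_le_mul_of_nonneg_right hge (by positivity)
    have hhn : h ≤ n := by omega
    have : h * h ≤ h * n := mul_le_mul_of_nonneg_left hhn h0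
    have : 0 < n * n := by positivity
    nlinarith
  obtain rfl : h = n - c := by omega
  have hμ : μ = 2 ∨ μ = 3 ∨ μ = 4 := by omega
  rcases hμ with rfl | rfl | rfl
  · have e1 : n * (3 - 2 * c) = c * (1 - c) := by linarith
    have : c < 2 := by
      by_contra hge; push Not at hge
      nlinarith
    interval_cases c
    omega
  · have e1 : 4 * n * (3 - c) = c * (3 - 2 * c) := by linarith
    have : c < 5 := by
      by_contra hge; push Not at hge
      nlinarith
    interval_cases c <;> omega
  · have e1 : 4 * n * (5 - c) = 2 * c * (2 - c) := by linarith
    have : c < 8 := by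
      by_contra hge; push Not at hge
      nlinarith
    interval_cases c <;> omega

lemma coreO {n h c μ : ℤ} (hn : 3 ≤ n) (h0 : 0 ≤ h) (hc : c = n - h) (hc0 : 0 ≤ c) (two : 2 ≤ μ)
    (h1 : c * (n + 10 * h) + 4 * μ ^ 2 ≤ 6 * (h * μ)) (h2 : (n + 1) * μ ^ 2 + 3 * (h * μ) = 2 * c * (n + h)) : False := by
  have h3 : ((n + 1) * μ + 3 * h) * (n + 10 * h) ≤ 12 * h * (n + h) := by
    refine le_of_mul_le_mul_left ?_ (show 0 < μ by omega)
    have h1' : c * (n + 10 * h) ≤ 6 * (h * μ) := by nlinarith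
    have := mul_le_mul_of_nonneg_left h1' (show 0 ≤ 2 * (n + h) by omega)
    calc μ * (((n + 1) * μ + 3 * h) * (n + 10 * h)) = ((n + 1) * μ ^ 2 + 3 * (h * μ)) * (n + 10 * h) := by ring
      _ = 2 * (n + h) * (c * (n + 10 * h)) := by rw [h2]; ring
      _ ≤ _ := this
      _ = _ := by ring
  have : 2 * ((n + 1) * (n + 10 * h)) ≤ μ * ((n + 1) * (n + 10 * h)) :=
    mul_le_mul_of_nonneg_right two (by positivity)
  have : 0 ≤ h * n := by positivity
  have : 0 < n * n := by positivity
  nlinarith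

lemma coreP {n h c μ : ℤ} (hn : 3 ≤ n) (h0 : 0 ≤ h) (hc : c = n - h) (hc0 : 0 ≤ c) (two : 2 ≤ μ)
    (h1 : c * (n + 10 * h) + 9 * μ ^ 2 ≤ 4 * (h * μ)) (h2 : n * μ ^ 2 - h * μ = 2 * c * (n + h)) : False := by
  have h3 : (n * μ - h) * (n + 10 * h) ≤ 8 * h * (n + h) := by
    refine le_of_mul_le_mul_left ?_ (show 0 < μ by omega)
    have h1' : c * (n + 10 * h) ≤ 4 * (h * μ) := by nlinarith
    have := mul_le_mul_of_nonneg_left h1' (show 0 ≤ 2 * (n + h) by omega)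
    calc μ * ((n * μ - h) * (n + 10 * h)) = (n * μ ^ 2 - h * μ) * (n + 10 * h) := by ring
      _ = 2 * (n + h) * (c * (n + 10 * h)) := by rw [h2]; ring
      _ ≤ _ := this
      _ = _ := by ring
  have h4 : 9 * μ ≤ 4 * h := by
    refine le_of_mul_le_mul_right ?_ (show 0 < μ by omega)
    have := mul_nonneg hc0 (show 0 ≤ n + 10 * h by omega)
    nlinarith
  have hhn : h ≤ n := by omega
  have a1 : h * h ≤ h * n := mul_le_mul_of_nonneg_left hhn h0
  have a2 : 0 < n * n := by positivity
  have a3 : 0 ≤ h * n := by positivity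
  have hμ : μ < 3 := by
    by_contra hge; push Not at hge
    have : 3 * (n * (n + 10 * h)) ≤ μ * (n * (n + 10 * h)) := mul_le_mul_of_nonneg_right hge (by positivity)
    nlinarith
  obtain rfl : μ = 2 := by omega
  have h5 : 2 * n - h = c * (n + h) := by linarith
  have : c < 2 := by
    by_contra hge; push Not at hge
    nlinarith
  interval_cases c <;> omega

lemma sgn_mul {x δ μ : ℤ} (hδ : δ = μ ∨ δ = -μ) : x * δ = |x| * μ ∨ x * δ = -(|x| * μ) := by
  rcases hδ with rfl | rfl <;> rcases abs_cases x with ⟨h, _⟩ | ⟨h, _⟩ <;> rw [h] <;> simp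

lemma star_num {n s δ μ e o P Q ν mx : ℤ} (hn : 3 ≤ n) (two : 2 ≤ μ) (hδ : δ = μ ∨ δ = -μ)
    (hν : n * ν = s * (2 * s + δ)) (hk : 4 * s + δ = μ ^ 2 + ν) (hpos : Pos e o P Q s δ)
    (e0 : 0 ≤ e) (o0 : 0 ≤ o) (e1 : e ≤ 2 * n) (o1 : o ≤ 2 * n)
    (p0 : 0 ≤ P) (q0 : 0 ≤ Q) (p1 : P ≤ 2 * n) (q1 : Q ≤ 2 * n)
    (m1 : 0 ≤ mx) (m2 : 2 * o - 2 * n ≤ mx)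
    (star : 9 * (n * (2 * e + o + mx) + P ^ 2 + Q ^ 2) ≤ 4 * (n * μ ^ 2) + 18 * (n * ν)) : False := by
  have hdd : δ ^ 2 = μ ^ 2 := by rcases hδ with rfl | rfl <;> ring
  have key : n * μ ^ 2 = 2 * n ^ 2 - 2 * (n - s) ^ 2 + (n - s) * δ := by
    have : μ ^ 2 = 4 * s + δ - ν := by omega
    rw [this]; linear_combination -hν
  have hμμ : 0 < μ ^ 2 := by positivity
  have m3 : n * (2 * e + o) + n * mx = n * (2 * e + o + mx) := by ring
  have m4 : n * 0 ≤ n * mx := mul_le_mul_of_nonneg_left m1 (by omega)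
  have m5 : n * (2 * o - 2 * n) ≤ n * mx := mul_le_mul_of_nonneg_left m2 (by omega)
  rcases hpos with ⟨rfl, rfl, rfl, rfl⟩ | ⟨rfl, rfl, rfl, rfl⟩ | hpos
  · have hx := sgn_mul (x := n - Q) hδ
    have hsq : (n - Q) ^ 2 = |n - Q| ^ 2 := (sq_abs _).symm
    have h0 := abs_nonneg (n - Q)
    have hle : |n - Q| ≤ n := by rw [abs_le]; omega
    have m6 : n * |n - Q| ≤ n * (n - Q) + n * mx := by
      rcases abs_cases (n - Q) with ⟨h, _⟩ | ⟨h, _⟩ <;> rw [h] <;> linarith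
    generalize |n - Q| = h at *
    have hc0 : 0 ≤ n - h := by omega
    rcases hx with hx | hx
    · have := core_pos (t := -(14 * (h * μ))) hn h0 hc0 (by nlinarith)
      have hm : 0 ≤ h * μ := by positivity
      have hz : h * μ = 0 := by omega
      have : h = 0 := by
        rcases mul_eq_zero.1 hz with h | h <;> omega
      subst this
      nlinarith
    · exact coreE hn h0 rfl hc0 two (by nlinarith) (by linear_combination key + hx - 2 * hsq)
  · have hx := sgn_mul (x := n - Q - δ) hδ
    have hsq : (n - Q - δ) ^ 2 = |n - Q - δ| ^ 2 := (sq_abs _).symm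
    have h0 := abs_nonneg (n - Q - δ)
    have hle : |n - Q - δ| ≤ n := by rw [abs_le]; omega
    have m6 : n * |n - Q - δ| ≤ n * (n - Q - δ) + n * mx := by
      rcases abs_cases (n - Q - δ) with ⟨h, _⟩ | ⟨h, _⟩ <;> rw [h] <;> linarith
    generalize |n - Q - δ| = h at *
    have hc0 : 0 ≤ n - h := by omega
    rcases hx with hx | hx
    · exact coreO hn h0 rfl hc0 two (by nlinarith) (by linear_combination key - 3 * hx - hdd - 2 * hsq)
    · have hm : 0 ≤ h * μ := by positivity
      have := core_pos (t := -(4 * μ ^ 2) - 6 * (h * μ)) hn h0 hc0 (by nlinarith)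
      omega
  · have hPQ : P ^ 2 + Q ^ 2 = 2 * s ^ 2 + 2 * s * δ + μ ^ 2 := by
      rcases hpos with ⟨_, _, rfl, rfl⟩ | ⟨_, _, rfl, rfl⟩ <;> rw [← hdd] <;> ring
    have hes : e = s := by rcases hpos with h | h <;> exact h.1
    have hos : o = s := by rcases hpos with h | h <;> exact h.2.1
    subst hes; subst hos
    have hx := sgn_mul (x := n - o) hδ
    have hsq : (n - o) ^ 2 = |n - o| ^ 2 := (sq_abs _).symm
    have h0 := abs_nonneg (n - o)
    have hle : |n - o| ≤ n := by rw [abs_le]; omega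
    have m6 : n * |n - o| ≤ n * (n - o) + n * mx := by
      rcases abs_cases (n - o) with ⟨h, _⟩ | ⟨h, _⟩ <;> rw [h] <;> linarith
    generalize |n - o| = h at *
    have hc0 : 0 ≤ n - h := by omega
    rcases hx with hx | hx
    · exact coreP hn h0 rfl hc0 two (by nlinarith) (by linear_combination key + hx - 2 * hsq)
    · have hm : 0 ≤ h * μ := by positivity
      have := core_pos (t := -(9 * μ ^ 2) - 4 * (h * μ)) hn h0 hc0 (by nlinarith)
      omega
end num

set_option linter.unusedSectionVars false
set_option linter.unusedVariables false
set_option linter.unusedSimpArgs false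
open Lam El

section star
variable {n : ℕ} [NeZero n] {A : SR n} {p : ℕ}

/-- sum over the subgroup of order `p` -/
noncomputable def NN (n : ℕ) [NeZero n] (p : ℕ) : Lam (Zm n) ℤ := ∑ i ∈ Finset.range p, d (uu p) ^ i

lemma NN_fix {f : Lam (Zm n) ℤ} (h : d (uu p) * f = f) : NN n p * f = (p : Lam (Zm n) ℤ) * f := by
  have : ∀ i : ℕ, d (uu p) ^ i * f = f := by
    intro i
    induction i with
    | zero => simp
    | succ i ih => rw [pow_succ, mul_assoc, h, ih]
  rw [NN, Finset.sum_mul, Finset.sum_congr rfl (fun i _ => this i)]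
  simp

lemma NN_U (hd : p ∣ 4 * n) : d (uu p) * NN n p = NN n p := by
  have h := mul_geom_sum (d (uu p) : Lam (Zm n) ℤ) p
  rw [d_pow, nsmul_eq_mul, p_mul_uu hd, d_zero, sub_self] at h
  rw [NN]
  linear_combination h

lemma NN_inv (hd : p ∣ 4 * n) : NN n p * inv (NN n p) = (p : Lam (Zm n) ℤ) * NN n p := by
  have h := NN_fix (inv_periodic (NN_U (n := n) hd))
  have h2 := congrArg inv h
  rw [map_mul, map_mul, Lam.inv_inv, map_natCast] at h2
  rw [← h2, mul_comm]

lemma NN_c (x : Zm n) : (NN n p).c x = ∑ i ∈ Finset.range p, if x = i • (uu p : Zm n) then 1 else 0 := by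
  rw [NN, sum_c]
  refine Finset.sum_congr rfl fun i _ => ?_
  rw [d_pow, d_c]

lemma NN_c0 (hp : p.Prime) (hd : p ∣ 4 * n) : (NN n p).c 0 = 1 := by
  rw [NN_c, Finset.sum_eq_single 0]
  · simp
  · intro i hi h0
    rw [if_neg]
    intro h
    have := addOrderOf_dvd_of_nsmul_eq_zero h.symm
    rw [addOrderOf_uu hp hd] at this
    exact h0 (Nat.eq_zero_of_dvd_of_lt this (Finset.mem_range.1 hi))
  · intro h; simp at h; exact absurd h hp.ne_zero

lemma odd_zz (hp : p.Prime) (h2 : p ≠ 2) : (p : Zm n) * zz = zz := by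
  obtain ⟨k, hk⟩ := hp.odd_of_ne_two h2
  have := two_zz (n := n)
  rw [hk]; push_cast
  linear_combination (k : Zm n) * this

lemma NN_cz (hp : p.Prime) (h2 : p ≠ 2) (hd : p ∣ 4 * n) : (NN n p).c zz = 0 := by
  rw [NN_c, Finset.sum_eq_zero]
  intro i _
  rw [if_neg]
  intro h
  apply zz_ne (n := n)
  rw [← odd_zz hp h2, h, nsmul_eq_mul]
  linear_combination (i : Zm n) * p_mul_uu (n := n) hd

lemma NN_ev (hp : p.Prime) (h2 : p ≠ 2) (hd : p ∣ n) : IsEv (NN n p) := by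
  intro x hx
  rw [NN_c, Finset.sum_eq_zero]
  intro i _
  rw [if_neg]
  rintro rfl
  rw [nsmul_eq_mul, map_mul, par_uu hp h2 hd, mul_zero] at hx
  exact zero_ne_one hx

lemma aug_NN : aug (NN n p) = p := by
  rw [NN, map_sum, Finset.sum_congr rfl (fun i _ => by rw [map_pow, aug_d, one_pow])]
  simp

lemma cs_bin {g b : Lam (Zm n) ℤ} (hb : Bin b) (h : ∀ x, g.c x * b.c x = g.c x) :
    aug g ^ 2 ≤ (∑ x, g.c x ^ 2) * aug b := by
  have := Finset.sum_mul_sq_le_sq_mul_sq (Finset.univ) g.c b.c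
  rw [Finset.sum_congr rfl (fun x _ => h x)] at this
  have e : ∑ x, b.c x ^ 2 = aug b := Finset.sum_congr rfl fun x _ => by
    rcases hb x with h | h <;> simp [h]
  rw [e] at this
  exact this

lemma bin_ev_all : Bin (ev all : Lam (Zm n) ℤ) := by
  intro x; simp only [ev, all_c]; split_ifs <;> simp
lemma bin_od_all : Bin (od all : Lam (Zm n) ℤ) := by
  intro x; simp only [od, all_c]; split_ifs <;> simp

lemma lb (hp : p.Prime) (h2 : p ≠ 2) (hd : p ∣ n) {f : Lam (Zm n) ℤ} (hf : IsEv f ∨ IsOd f) :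
    p * aug f ^ 2 ≤ n * (NN n p * (1 + Z) * (f * inv f)).c 0 := by
  have hd4 : p ∣ 4 * n := hd.mul_left 4
  set g := NN n p * (1 + Z) * f with hg
  have h1Z : IsEv (1 + Z : Lam (Zm n) ℤ) := by
    have : (1 : Lam (Zm n) ℤ) = C 1 := by rw [map_one]
    rw [this]; exact (isEv_C 1).add isEv_Z
  have hw : IsEv (NN n p * (1 + Z)) := (NN_ev hp h2 hd).mul h1Z
  have hcs : aug g ^ 2 ≤ (∑ x, g.c x ^ 2) * (2 * n) := by
    rcases hf with hf | hf
    · have hge : IsEv g := hw.mul hf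
      rw [← aug_ev_all (n := n)]
      refine cs_bin bin_ev_all fun x => ?_
      rcases par_cases x with hx | hx
      · simp [ev, hx]
      · simp [hge x hx]
    · have hge : IsOd g := hw.mul_od hf
      rw [← aug_od_all (n := n)]
      refine cs_bin bin_od_all fun x => ?_
      rcases par_cases x with hx | hx
      · simp [hge x hx]
      · simp [od, hx]
  have hgg : g * inv g = ((2 * p : ℕ) : Lam (Zm n) ℤ) * (NN n p * (1 + Z) * (f * inv f)) := by
    rw [hg, map_mul, map_mul, map_add, map_one, inv_Z]
    push_cast
    linear_combination (f * inv f * (1 + Z) * (1 + Z)) * NN_inv (n := n) hd4 + (p * NN n p * f * inv f) * Z_mul_Z (n := n) (k := ℤ)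
  have h0 := congrArg (fun f => f.c 0) hgg
  simp only [mul_inv_c, natCast_mul_c] at h0
  rw [h0] at hcs
  have ha : aug g = 2 * p * aug f := by
    rw [hg, map_mul, map_mul, map_add, map_one, aug_Z, aug_NN]; ring
  rw [ha] at hcs
  have hp0 : (0 : ℤ) < p := by exact_mod_cast hp.pos
  generalize (NN n p * (1 + Z) * (f * inv f)).c 0 = Y at *
  push_cast at hcs
  refine le_of_mul_le_mul_left (a := 4 * (p : ℤ)) ?_ (by omega)
  linarith

/-- the defect of `E` -/
def NE (T : El n ℤ) : ℤ := aug T.E - (T.E ^ 2).c zz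

lemma one_add_Z_ev_all : (1 + Z) * (ev all : Lam (Zm n) ℤ) = 2 * ev all := by
  have : Z * (ev all : Lam (Zm n) ℤ) = ev all := by
    ext x; simp [ev, par_zz]
  rw [add_mul, one_mul, this, two_mul]

lemma NN_ev_all (hp : p.Prime) (h2 : p ≠ 2) (hd : p ∣ n) : d (uu p) * (ev all : Lam (Zm n) ℤ) = ev all := by
  ext x; simp [ev, par_uu hp h2 hd]

lemma mulc_add_Z (f : Lam (Zm n) ℤ) : ((1 + Z) * f).c 0 = f.c 0 + f.c zz := by
  rw [add_mul, one_mul, add_c, Z_mul_c, zero_add]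

lemma TT.beta (hn : 3 ≤ n) {T : El n ℤ} (h : TT A T) {μ s δ ν : ℤ} (N : NumD T μ s δ ν) (hp : p.Prime) (h2 : p ≠ 2)
    (hd : p ∣ n) (hE : d (uu p) * T.E = T.E) (hO : d (uu p) * ((1 + Z) * T.O) = (1 + Z) * T.O) :
    p * (n * (2 * aug T.E - NE T + aug T.O + (T.O ^ 2).c zz)) + p * (aug T.P ^ 2 + aug T.Q ^ 2) ≤
      n * μ ^ 2 + 2 * p * (n * ν) := by
  have hd4 : p ∣ 4 * n := hd.mul_left 4
  have hS := A.sym h.mem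
  have H := N.sz
  have hX := H.hE
  rw [hS.sq_E] at hX
  have hY : NN n p * (1 + Z) * (T.P * inv T.P) + NN n p * (1 + Z) * (T.Q * inv T.Q) +
      (p : Lam (Zm n) ℤ) * ((1 + Z) * T.E ^ 2) + (p : Lam (Zm n) ℤ) * ((1 + Z) * T.O ^ 2) =
      C (μ ^ 2) * ((1 + Z) * NN n p) + C ν * (((2 * p : ℕ) : Lam (Zm n) ℤ) * ev all) := by
    have a1 : NN n p * T.E = (p : Lam (Zm n) ℤ) * T.E := NN_fix hE
    have a2 : NN n p * ((1 + Z) * T.O) = (p : Lam (Zm n) ℤ) * ((1 + Z) * T.O) := NN_fix hO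
    have a3 : NN n p * (ev all) = (p : Lam (Zm n) ℤ) * ev all := NN_fix (NN_ev_all hp h2 hd)
    push_cast
    linear_combination (NN n p * (1 + Z)) * hX - (1 + Z) * T.E * a1 - T.O * a2 + (C ν * (1 + Z)) * a3
      + C ν * (p : Lam (Zm n) ℤ) * one_add_Z_ev_all (n := n)
  have h0 := congrArg (fun f => f.c 0) hY
  simp only [add_c, natCast_mul_c, C_mul_c, mulc_add_Z, NN_c0 hp hd4, NN_cz hp h2 hd4] at h0
  have hEE : (T.E ^ 2).c 0 = aug T.E := by
    rw [pow_two]; nth_rewrite 2 [← hS.E]; exact h.set.E.sq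
  have hOO : (T.O ^ 2).c 0 = aug T.O := by
    rw [pow_two]; nth_rewrite 2 [← hS.O]; exact h.set.O.sq
  rw [hEE, hOO] at h0
  have l1 := lb hp h2 hd (f := T.P) (Or.inl (isEv_ev _))
  have l2 := lb hp h2 hd (f := T.Q) (Or.inr (isOd_od _))
  have hall : (ev all : Lam (Zm n) ℤ).c 0 = 1 := by simp [ev]
  rw [hall] at h0
  rw [NE]
  generalize (NN n p * (1 + Z) * (T.P * inv T.P)).c 0 = y1 at *
  generalize (NN n p * (1 + Z) * (T.Q * inv T.Q)).c 0 = y2 at *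
  push_cast at h0
  have h1 := congrArg (fun t => (n : ℤ) * t) h0
  linarith

lemma gam {T : El n ℤ} (h : IsSet T) : 0 ≤ (T.O ^ 2).c zz ∧ 2 * aug T.O - 2 * n ≤ (T.O ^ 2).c zz := by
  rw [pow_two, mul_c]
  constructor
  · exact Finset.sum_nonneg fun x _ => mul_nonneg (h.O.nonneg _) (h.O.nonneg _)
  · have e : 2 * aug T.O - 2 * n = ∑ x, (T.O.c x + T.O.c (zz - x) - (od all : Lam (Zm n) ℤ).c x) := by
      rw [Finset.sum_sub_distrib, Finset.sum_add_distrib]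
      have e1 : ∑ x, T.O.c (zz - x) = aug T.O :=
        Fintype.sum_equiv (Equiv.subLeft zz) _ _ (fun w => by simp)
      have e2 : ∑ x, (od all : Lam (Zm n) ℤ).c x = 2 * n := aug_od_all
      rw [e1, e2, ← aug_apply]; ring
    rw [e]
    refine Finset.sum_le_sum fun x _ => ?_
    rcases par_cases x with hx | hx
    · have h1 : T.O.c x = 0 := isOd_od _ x hx
      have h2 : T.O.c (zz - x) = 0 := isOd_od _ _ (by rw [map_sub, par_zz, hx, sub_zero])
      simp [h1, h2, od, hx]
    · have h3 : (od all : Lam (Zm n) ℤ).c x = 1 := by simp [od, hx]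
      rw [h3]
      rcases h.O x with h1 | h1 <;> rcases h.O (zz - x) with h2 | h2 <;> simp [h1, h2]

lemma lam_two_cancel {f : Lam (Zm n) ℤ} (h : 2 * f = 0) : f = 0 := by
  ext x
  have := congrArg (fun f => f.c x) h
  simp only [ofNat_mul_c, zero_c] at this
  rw [zero_c]; omega

/-- consequences of multiplying by `1 - z` -/
lemma TT.oneSub {T : El n ℤ} (h : TT A T) {α ν : ℤ} (H : Sizes T α ν) :
    (1 - Z) * T.E * T.P = 0 ∧ (1 - Z) * T.E * T.O = 0 ∧
    (1 - Z) * (T.E ^ 2 + T.O ^ 2 + T.P * inv T.P) = C α * (1 - Z) := by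
  have hS := A.sym h.mem
  have hQ := hS.Q
  have hQi := hS.Qi
  have za : Z * (ev all : Lam (Zm n) ℤ) = ev all := by ext x; simp [ev, par_zz]
  have zo : Z * (od all : Lam (Zm n) ℤ) = od all := by ext x; simp [od, par_zz]
  have h1 := H.hE; have h2 := H.hO; have h3 := H.hP
  rw [hS.sq_E] at h1
  rw [hS.sq_O] at h2
  rw [hS.sq_P] at h3
  refine ⟨lam_two_cancel ?_, lam_two_cancel ?_, ?_⟩
  · linear_combination (1 - Z) * h3 - C ν * za + 2 * T.O * hQ
  · linear_combination (1 - Z) * h2 - C ν * zo + T.P * hQi + inv T.P * hQ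
  · linear_combination (1 - Z) * h1 - C ν * za + inv T.Q * hQ

lemma TT.cube {T : El n ℤ} (h : TT A T) {α ν : ℤ} (H : Sizes T α ν) :
    (1 - Z) * T.E ^ 3 = C α * ((1 - Z) * T.E) := by
  obtain ⟨a1, a2, a3⟩ := h.oneSub H
  linear_combination T.E * a3 - inv T.P * a1 - T.O * a2

lemma TT.ne_le {T : El n ℤ} (h : TT A T) {α ν : ℤ} (H : Sizes T α ν) (ha : 0 ≤ α) (hp : p.Prime) (h2 : p ≠ 2)
    (hd : p ∣ n) (hE : d (uu p) * T.E = T.E) : p * NE T ≤ α := by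
  have hd4 : p ∣ 4 * n := hd.mul_left 4
  have hS := A.sym h.mem
  have hc := h.cube H
  have hZ := Z_mul_Z (n := n) (k := ℤ)
  set W := (1 - Z) * T.E ^ 2 with hW
  have hWi : inv W = W := by rw [hW, map_mul, map_sub, map_one, inv_Z, map_pow, hS.E]
  have hWW : W * inv W = C (2 * α) * W := by
    rw [hWi, hW, map_mul, map_ofNat]
    linear_combination 2 * T.E * hc + T.E ^ 4 * hZ
  have hEE : (T.E ^ 2).c 0 = aug T.E := by
    rw [pow_two]; nth_rewrite 2 [← hS.E]; exact h.set.E.sq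
  have hW0 : W.c 0 = NE T := by
    rw [hW, sub_mul, one_mul, sub_c, Z_mul_c, zero_add, hEE, NE]
  set V := NN n p * (1 - Z) with hV
  have hVV : V * inv V = ((2 * p : ℕ) : Lam (Zm n) ℤ) * V := by
    rw [hV, map_mul, map_sub, map_one, inv_Z]
    push_cast
    linear_combination (1 - Z) ^ 2 * NN_inv (n := n) hd4 + p * NN n p * hZ
  have hVW : V * W = ((2 * p : ℕ) : Lam (Zm n) ℤ) * W := by
    rw [hV, hW]
    push_cast
    linear_combination (1 - Z) ^ 2 * T.E * NN_fix hE + p * T.E ^ 2 * hZ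
  have hV0 : V.c 0 = 1 := by
    rw [hV, mul_comm, sub_mul, one_mul, sub_c, Z_mul_c, zero_add, NN_c0 hp hd4, NN_cz hp h2 hd4, sub_zero]
  have e1 := congrArg (fun f => f.c 0) hWW
  have e2 := congrArg (fun f => f.c 0) hVV
  have e3 := congrArg (fun f => f.c 0) hVW
  simp only [mul_inv_c, natCast_mul_c, C_mul_c, hW0, hV0] at e1 e2 e3
  rw [mul_c] at e3
  have hcs := Finset.sum_mul_sq_le_sq_mul_sq (Finset.univ) V.c (fun y => W.c (0 - y))
  have e4 : ∑ y, W.c (0 - y) ^ 2 = ∑ y, W.c y ^ 2 :=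
    Fintype.sum_equiv (Equiv.neg _) _ _ (fun w => by simp)
  rw [e3, e2, e4, e1] at hcs
  have hp0 : (0 : ℤ) < p := by exact_mod_cast hp.pos
  push_cast at hcs
  generalize NE T = t at *
  have h5 : p * t ^ 2 ≤ α * t := by
    refine le_of_mul_le_mul_left (a := 4 * (p : ℤ)) ?_ (by omega)
    linarith
  rcases le_or_gt t 0 with ht | ht
  · nlinarith
  · exact le_of_mul_le_mul_right (by linarith) ht

/-- numerical contradiction -/
lemma TT.kill3 (hn : 3 ≤ n) {T : El n ℤ} (h : TT A T) {μ s δ ν : ℤ} (N : NumD T μ s δ ν) (hp : p.Prime) (h2 : p ≠ 2)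
    (hd : p ∣ n) (hE : d (uu p) * T.E = T.E) (hO : d (uu p) * ((1 + Z) * T.O) = (1 + Z) * T.O)
    (h9 : 9 * (μ ^ 2 + p * NE T) ≤ 4 * (p * μ ^ 2)) : False := by
  have H := N.sz
  have hb := h.beta hn N hp h2 hd hE hO
  obtain ⟨g1, g2⟩ := gam h.set
  have hp0 : (0 : ℤ) < p := by exact_mod_cast hp.pos
  have hn' : (3 : ℤ) ≤ n := by exact_mod_cast hn
  refine star_num hn' N.two N.hδ N.hν N.hk N.pos H.e0 H.o0 H.e1 H.o1 H.p0 H.q0 H.p1 H.q1 g1 g2 ?_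
  refine le_of_mul_le_mul_left (a := (p : ℤ)) ?_ hp0
  have := mul_le_mul_of_nonneg_left h9 (show (0 : ℤ) ≤ n by omega)
  linarith

lemma TT.kill5 (hn : 3 ≤ n) {T : El n ℤ} (h : TT A T) (hp : p.Prime) (h5 : 5 ≤ p)
    (hd : p ∣ n) (hE : d (uu p) * T.E = T.E) (hO : d (uu p) * ((1 + Z) * T.O) = (1 + Z) * T.O) : False := by
  obtain ⟨μ, s, δ, ν, N⟩ := h.num hn
  have h1 := h.ne_le N.sz (by positivity) hp (by omega) hd hE
  refine h.kill3 hn N hp (by omega) hd hE hO ?_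
  have : (5 : ℤ) ≤ p := by exact_mod_cast h5
  have : 0 ≤ μ ^ 2 := by positivity
  nlinarith
end star

set_option linter.unusedSectionVars false
set_option linter.unusedVariables false
set_option linter.unusedSimpArgs false
open Lam El

section three
variable {n : ℕ} [NeZero n] {A : SR n}

/-- indicator of the `m`-torsion -/
def II (m : ℕ) : Lam (Zm n) ℤ := ⟨fun x => if (m : Zm n) * x = 0 then 1 else 0⟩

lemma aug_II {m : ℕ} (hm : m ∣ 4 * n) : aug (II m : Lam (Zm n) ℤ) = m := by
  have hm0 : m ≠ 0 := by rintro rfl; exact four_ne (n := n) (Nat.eq_zero_of_zero_dvd hm)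
  have h1 := sum_card_addOrderOf_eq_card_nsmul_eq_zero (G := Zm n) hm0
  have h2 : ∀ d ∈ Nat.divisors m, (Finset.univ.filter fun x : Zm n => addOrderOf x = d).card = d.totient := by
    intro d hd
    exact IsAddCyclic.card_addOrderOf_eq_totient
      (by rw [ZMod.card (4 * n)]; exact (Nat.dvd_of_mem_divisors hd).trans hm)
  rw [aug_apply]
  have h3 : ∑ x, (II m : Lam (Zm n) ℤ).c x = ((Finset.univ.filter fun x : Zm n => m • x = 0).card : ℤ) := by
    simp [II, nsmul_eq_mul]
  rw [h3, ← h1, ← Nat.sum_totient m]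
  congr 1
  rw [Nat.sum_totient]
  conv_rhs => rw [← Nat.sum_totient m]
  refine Finset.sum_congr (by ext; simp [hm0]) (fun d hd => h2 d (by simpa [hm0] using hd))

lemma mul_II {m : ℕ} {f : Lam (Zm n) ℤ} (h : ∀ x, f.c x ≠ 0 → (m : Zm n) * x = 0) : f * II m = C (aug f) * II m := by
  ext x
  rw [mul_c, C_mul_c, aug_apply, Finset.sum_mul]
  refine Finset.sum_congr rfl fun y _ => ?_
  by_cases hy : f.c y = 0
  · simp [hy]
  · simp [II, mul_sub, h y hy]

lemma eq_unit_of_tors {b : ℕ} {x : Zm n} (h1 : ((3 ^ (b + 1) : ℕ) : Zm n) * x = 0) (h2 : ((3 ^ b : ℕ) : Zm n) * x ≠ 0) :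
    3 ^ (b + 1) ∣ 4 * n ∧ ∃ u : (Zm n)ˣ, x = u * ((4 * n / 3 ^ (b + 1) : ℕ) : Zm n) := by
  obtain ⟨d, hd, u, hu, rfl⟩ := ZMod.eq_unit_mul_divisor x
  obtain ⟨v, rfl⟩ := hu
  obtain ⟨e, he⟩ := hd
  have hd0 : 0 < d := by
    rcases Nat.eq_zero_or_pos d with h | h
    · exact absurd he (by rw [h, zero_mul]; exact four_ne)
    · exact h
  have key : ∀ m : ℕ, (m : Zm n) * (v * (d : Zm n)) = 0 ↔ e ∣ m := by
    intro m
    have : (m : Zm n) * (v * (d : Zm n)) = v * ((m * d : ℕ) : Zm n) := by push_cast; ring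
    rw [this, Units.mul_right_eq_zero, natCast_eq_zero_iff', he, mul_comm d e]
    exact Nat.mul_dvd_mul_iff_right hd0
  rw [key] at h1
  rw [Ne, key] at h2
  obtain ⟨j, hj, rfl⟩ := (Nat.dvd_prime_pow Nat.prime_three).1 h1
  have : j = b + 1 := by
    by_contra hne
    exact h2 (pow_dvd_pow 3 (by omega))
  subst this
  have hq : 4 * n / 3 ^ (b + 1) = d := by rw [he, Nat.mul_div_cancel _ (by positivity)]
  exact ⟨⟨d, by rw [he]; ring⟩, v, by rw [hq]⟩

lemma cube_root {t μ : ℤ} (h : t ^ 3 = μ ^ 2 * t) : t = 0 ∨ t = μ ∨ t = -μ := by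
  have : t * ((t - μ) * (t + μ)) = 0 := by linear_combination h
  rcases mul_eq_zero.1 this with h | h
  · exact Or.inl h
  · rcases mul_eq_zero.1 h with h | h
    · right; left; omega
    · right; right; omega

lemma no_mu_three {n s δ ν : ℤ} (hn : 3 ≤ n) (h3 : 3 ∣ n) (hδ : δ = 3 ∨ δ = -3)
    (hν : n * ν = s * (2 * s + δ)) (hk : 4 * s + δ = 3 ^ 2 + ν) : False := by
  obtain ⟨m, rfl⟩ := h3
  have hs : (3 : ℤ) ∣ s := by
    have h : (3 : ℤ) ∣ s ^ 2 := by
      rcases hδ with rfl | rfl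
      · exact ⟨s ^ 2 - m * ν + s, by linarith⟩
      · exact ⟨s ^ 2 - m * ν - s, by linarith⟩
    exact Int.prime_three.dvd_of_dvd_pow h
  obtain ⟨t, rfl⟩ := hs
  have hm : 1 ≤ m := by omega
  obtain ⟨v, hv, hvo⟩ : ∃ v : ℤ, (4 * m - 3) ^ 2 - v ^ 2 = 8 ∧ v % 2 = 1 := by
    rcases hδ with rfl | rfl
    · exact ⟨4 * (m - t) - 1, by nlinarith, by omega⟩
    · exact ⟨4 * (m - t) + 1, by nlinarith, by omega⟩
  have hv1 : |v| % 2 = 1 := by rcases abs_choice v with h | h <;> rw [h] <;> omega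
  rw [← sq_abs v] at hv
  have hv0 := abs_nonneg v
  generalize |v| = w at *
  have h1 : w < 4 * m - 3 := by nlinarith
  have h2 : w ≤ 4 * m - 5 := by omega
  have h4 : 4 * (4 * m - 4) ≤ 8 := by nlinarith
  have h5 : m = 1 := by omega
  subst h5
  nlinarith

/-- restriction to the odd part -/
def resK (f : Lam (Zm n) ℤ) : Lam (Zm n) ℤ := ⟨fun x => if (qq n 2 : Zm n) ∣ x then f.c x else 0⟩
/-- supported on the odd part -/
def SuK (f : Lam (Zm n) ℤ) : Prop := ∀ x, f.c x ≠ 0 → (qq n 2 : Zm n) ∣ x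

lemma SuK.mul {f g : Lam (Zm n) ℤ} (hf : SuK f) (hg : SuK g) : SuK (f * g) := by
  intro x hx
  rw [mul_c] at hx
  obtain ⟨y, _, hy⟩ := Finset.exists_ne_zero_of_sum_ne_zero hx
  have := dvd_add (hf y (left_ne_zero_of_mul hy)) (hg _ (right_ne_zero_of_mul hy))
  simpa using this

lemma not_qq_zz : ¬ (qq n 2 : Zm n) ∣ zz := fun h => zz_ne (eq_zero_of_qq_dvd Nat.prime_two h (by push_cast; exact two_zz))

lemma SuK.eq_zero {f : Lam (Zm n) ℤ} (hf : SuK f) (h : (1 - Z) * f = 0) : f = 0 := by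
  ext x
  have h1 := congrArg (fun g => g.c x) h
  simp only [sub_mul, one_mul, sub_c, Z_mul_c, zero_c] at h1
  rw [zero_c]
  by_contra hx
  have h2 := hf x hx
  have h3 := hf (x + zz) (by intro h; rw [h] at h1; exact hx (by linarith))
  exact not_qq_zz ((dvd_add_right h2).1 h3)

lemma qq_zz_split {x : Zm n} (h : (qq n 2 : Zm n) ∣ x) : ¬ (qq n 2 : Zm n) ∣ x + zz := fun h3 =>
  not_qq_zz ((dvd_add_right h).1 h3)

lemma zSub_res {E : Lam (Zm n) ℤ} (hE : RatL E) : (1 - Z) * resK ((1 - Z) * E) = (1 - Z) * E := by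
  ext x
  simp only [sub_mul, one_mul, sub_c, Z_mul_c, resK]
  have hz : x + zz + zz = x := by rw [add_assoc, zz_add, add_zero]
  rw [hz]
  by_cases h1 : (qq n 2 : Zm n) ∣ x
  · rw [if_pos h1, if_neg (qq_zz_split h1), sub_zero]
  · by_cases h2 : (qq n 2 : Zm n) ∣ x + zz
    · rw [if_neg h1, if_pos h2]; ring
    · rw [if_neg h1, if_neg h2]
      rw [hE.coset Nat.prime_two (by omega) (x := x) (y := x + zz) (by push_cast; rw [mul_add, two_zz, add_zero]) h1 h2]
      ring

lemma tors_of_K (h23 : ∀ p : ℕ, p.Prime → p ∣ n → p = 2 ∨ p = 3) : ∃ m : ℕ, ∀ x : Zm n, (qq n 2 : Zm n) ∣ x → ((3 ^ m : ℕ) : Zm n) * x = 0 := by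
  have hr : (4 * n / qq n 2) = 3 ^ (4 * n / qq n 2).primeFactorsList.length := by
    apply Nat.eq_prime_pow_of_unique_prime_dvd
    · exact (Nat.div_pos (Nat.le_of_dvd (Nat.pos_of_ne_zero four_ne) (qq_dvd 2)) (by unfold qq; positivity)).ne'
    · intro p hp hpd
      have h2 : p ≠ 2 := by
        rintro rfl
        have := Nat.coprime_ordCompl Nat.prime_two (four_ne (n := n))
        exact (Nat.Prime.coprime_iff_not_dvd Nat.prime_two).1 this hpd
      have h4 : p ∣ 4 * n := hpd.trans (Nat.div_dvd_of_dvd (qq_dvd 2))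
      have hpn : p ∣ n := by
        rcases (Nat.Prime.dvd_mul hp).1 h4 with h | h
        · exact absurd ((Nat.prime_dvd_prime_iff_eq hp Nat.prime_two).1 (hp.dvd_of_dvd_pow (show p ∣ 2 ^ 2 from h))) h2
        · exact h
      exact (h23 p hp hpn).resolve_left h2
  refine ⟨(4 * n / qq n 2).primeFactorsList.length, ?_⟩
  · intro x hx
    rw [← hr]
    obtain ⟨t, rfl⟩ := hx
    rw [← mul_assoc, ← Nat.cast_mul, Nat.div_mul_cancel (qq_dvd 2), (natCast_eq_zero_iff' _).2 dvd_rfl, zero_mul]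

lemma TT.kill33 (hn : 3 ≤ n) {T : El n ℤ} (h : TT A T) (hd : 3 ∣ n) (h23 : ∀ p : ℕ, p.Prime → p ∣ n → p = 2 ∨ p = 3)
    (hE : d (uu 3) * T.E = T.E) (hO : d (uu 3) * ((1 + Z) * T.O) = (1 + Z) * T.O) : False := by
  obtain ⟨μ, s, δ, ν, N⟩ := h.num hn
  refine h.kill3 hn N Nat.prime_three (by omega) hd hE hO ?_
  have hS := A.sym h.mem
  have hc := h.cube N.sz
  have hZ := Z_mul_Z (n := n) (k := ℤ)
  have hrat : RatL T.E := h.rat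
  set f := resK ((1 - Z) * T.E) with hf
  have hfz : (1 - Z) * f = (1 - Z) * T.E := zSub_res hrat
  have hfK : SuK f := by
    intro x hx
    by_contra hne
    exact hx (by simp [hf, resK, hne])
  have hfC : SuK (f ^ 3 - C (μ ^ 2) * f) := by
    have h3 : SuK (f ^ 3) := by
      rw [pow_succ, pow_two]; exact (hfK.mul hfK).mul hfK
    intro x hx
    by_contra hne
    apply hx
    have a1 : (f ^ 3).c x = 0 := by by_contra hh; exact hne (h3 x hh)
    have a2 : f.c x = 0 := by by_contra hh; exact hne (hfK x hh)
    rw [sub_c, C_mul_c, a1, a2]; ring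
  have hcub : f ^ 3 = C (μ ^ 2) * f := by
    rw [← sub_eq_zero]
    apply hfC.eq_zero
    apply lam_two_cancel; apply lam_two_cancel
    have e1 : ((1 - Z) * f) ^ 3 = ((1 - Z) * T.E) ^ 3 := by rw [hfz]
    have hZ3 : (1 - Z : Lam (Zm n) ℤ) ^ 3 = 4 * (1 - Z) := by linear_combination (3 - Z) * hZ
    rw [mul_pow, mul_pow, hZ3] at e1
    linear_combination e1 + 4 * hc - 4 * C (μ ^ 2) * hfz
  have hv : ∀ x, f.c x = 0 ∨ f.c x = 1 ∨ f.c x = -1 := by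
    intro x
    simp only [hf, resK, sub_mul, one_mul, sub_c, Z_mul_c]
    split_ifs
    · rcases h.set.E x with h1 | h1 <;> rcases h.set.E (x + zz) with h2 | h2 <;> simp [h1, h2]
    · simp
  have hrf : RatL f := by
    intro u x
    simp only [hf, resK, sub_mul, one_mul, sub_c, Z_mul_c]
    have e1 : (u : Zm n) * x + zz = (u : Zm n) * (x + zz) := by rw [mul_add, unit_zz]
    rw [e1, hrat, hrat]
    simp only [Units.dvd_mul_left]
  have hNE : NE T = ∑ x, f.c x ^ 2 := by
    have e0 : (1 - Z) * f * inv ((1 - Z) * f) = (1 - Z) * T.E * inv ((1 - Z) * T.E) := by rw [hfz]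
    have hEE : (T.E ^ 2).c 0 = aug T.E := by
      rw [pow_two]; nth_rewrite 2 [← hS.E]; exact h.set.E.sq
    have e1 : (1 - Z) * f * inv ((1 - Z) * f) = 2 * ((1 - Z) * (f * inv f)) := by
      rw [map_mul, map_sub, map_one, inv_Z]; linear_combination f * inv f * hZ
    have e2 : (1 - Z) * T.E * inv ((1 - Z) * T.E) = 2 * ((1 - Z) * T.E ^ 2) := by
      rw [map_mul, map_sub, map_one, inv_Z, hS.E]; linear_combination T.E ^ 2 * hZ
    rw [e1, e2] at e0
    have e3 := congrArg (fun g => g.c 0) e0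
    simp only [ofNat_mul_c, sub_mul, one_mul, sub_c, Z_mul_c, zero_add, mul_inv_c, hEE] at e3
    have hfi : SuK (inv f) := fun x hx => (dvd_neg).1 (hfK _ hx)
    have e4 : (f * inv f).c zz = 0 := by
      by_contra hh
      exact not_qq_zz (hfK.mul hfi _ hh)
    rw [e4] at e3
    rw [NE]; linarith
  have hμ := N.two
  by_cases hf0 : ∀ x, f.c x = 0
  · have : NE T = 0 := by rw [hNE]; exact Finset.sum_eq_zero fun x _ => by rw [hf0]; ring
    rw [this]; push_cast; nlinarith [sq_nonneg μ]
  push Not at hf0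
  obtain ⟨y, hy⟩ := hf0
  have hex : ∃ b : ℕ, ∀ x, f.c x ≠ 0 → ((3 ^ b : ℕ) : Zm n) * x = 0 := by
    obtain ⟨m, hm⟩ := tors_of_K h23
    exact ⟨m, fun x hx => hm x (hfK x hx)⟩
  classical
  obtain ⟨b, hb, hbm⟩ : ∃ b : ℕ, (∀ x, f.c x ≠ 0 → ((3 ^ b : ℕ) : Zm n) * x = 0) ∧
      ∀ b' < b, ¬ ∀ x, f.c x ≠ 0 → ((3 ^ b' : ℕ) : Zm n) * x = 0 :=
    ⟨Nat.find hex, Nat.find_spec hex, fun _ => Nat.find_min hex⟩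
  rcases b with _ | b
  · exfalso
    have hfc : f = C (f.c 0) := by
      ext x
      rw [C_c]
      split_ifs with hx
      · rw [hx]
      · by_contra hh
        exact hx (by simpa using hb x hh)
    have hy0 : f.c 0 ≠ 0 := by
      have : y = 0 := by simpa using hb y hy
      rwa [this] at hy
    have e1 := congrArg aug hcub
    rw [hfc] at e1
    simp only [map_pow, map_mul, aug_C] at e1
    rcases cube_root e1 with h1 | h1 | h1 <;> rcases hv 0 with h2 | h2 | h2 <;> omega
  have hb' := hbm b (by omega)
  push Not at hb'
  obtain ⟨x0, hx0, hx0'⟩ := hb'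
  obtain ⟨hdv, u0, hu0⟩ := eq_unit_of_tors (hb x0 hx0) hx0'
  set c := f.c x0 with hcdef
  have hconst : ∀ x, ((3 ^ (b + 1) : ℕ) : Zm n) * x = 0 → ((3 ^ b : ℕ) : Zm n) * x ≠ 0 → f.c x = c := by
    intro x h1 h2
    obtain ⟨_, u, hu⟩ := eq_unit_of_tors h1 h2
    rw [hcdef, hu, hu0, hrf, hrf]
  have hdv' : 3 ^ b ∣ 4 * n := (pow_dvd_pow 3 (by omega)).trans hdv
  set I1 : Lam (Zm n) ℤ := II (3 ^ (b + 1)) with hI1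
  set I0 : Lam (Zm n) ℤ := II (3 ^ b) with hI0
  set g := f - C c * I1 with hg
  have sub01 : ∀ x : Zm n, ((3 ^ b : ℕ) : Zm n) * x = 0 → ((3 ^ (b + 1) : ℕ) : Zm n) * x = 0 := by
    intro x hx
    rw [pow_succ]; push_cast at hx ⊢; linear_combination 3 * hx
  have hgs : ∀ x, g.c x ≠ 0 → ((3 ^ b : ℕ) : Zm n) * x = 0 := by
    intro x hx
    by_contra hne
    apply hx
    rw [hg, sub_c, C_mul_c]
    by_cases h1 : ((3 ^ (b + 1) : ℕ) : Zm n) * x = 0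
    · rw [hconst x h1 hne, hI1, II]; simp only; rw [if_pos h1]; ring
    · have : f.c x = 0 := by by_contra hh; exact h1 (hb x hh)
      rw [this, hI1, II]; simp only; rw [if_neg h1]; ring
  have g0 : g * I0 = C (aug g) * I0 := mul_II hgs
  have g1 : g * I1 = C (aug g) * I1 := mul_II fun x hx => sub01 x (hgs x hx)
  have a1 : aug I1 = 3 ^ (b + 1) := by rw [hI1, aug_II hdv]; push_cast; ring
  have a0 : aug I0 = 3 ^ b := by rw [hI0, aug_II hdv']; push_cast; ring
  have i11 : I1 * I1 = C (3 ^ (b + 1)) * I1 := by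
    rw [← a1]; exact mul_II fun x hx => by
      by_contra hh; exact hx (by rw [hI1, II]; simp only; rw [if_neg hh])
  have i01 : I0 * I1 = C (3 ^ b) * I1 := by
    rw [← a0]; exact mul_II fun x hx => sub01 x (by
      by_contra hh; exact hx (by rw [hI0, II]; simp only; rw [if_neg hh]))
  have hfg : f = g + C c * I1 := by rw [hg]; ring
  have p3 : (3 : ℤ) ^ (b + 1) = 3 * 3 ^ b := by ring
  set J := 3 * I0 - I1 with hJ
  have C3 : (C (3 * 3 ^ b) : Lam (Zm n) ℤ) = 3 * C (3 ^ b) := by rw [map_mul, map_ofNat]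
  have f1 : f * I1 = C (aug g + c * 3 ^ (b + 1)) * I1 := by
    rw [map_add, map_mul, hfg]; linear_combination g1 + C c * i11
  have fJ : f * J = C (aug g) * J := by
    rw [hfg, hJ]
    rw [p3, C3] at i11
    linear_combination 3 * g0 - g1 + 3 * C c * i01 - C c * i11
  have key : ∀ (t : ℤ) (V : Lam (Zm n) ℤ), V.c 0 ≠ 0 → f * V = C t * V → t = 0 ∨ t = μ ∨ t = -μ := by
    intro t V hV hfV
    apply cube_root
    have e : C (t ^ 3) * V = C (μ ^ 2 * t) * V := by
      rw [map_mul, map_pow]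
      linear_combination V * hcub - (f ^ 2 + f * C t + C t ^ 2) * hfV + C (μ ^ 2) * hfV
    have e1 := congrArg (fun g => g.c 0) e
    simp only [C_mul_c] at e1
    exact mul_right_cancel₀ hV e1
  have k1 := key _ I1 (by simp [hI1, II]) f1
  have k2 := key _ J (by rw [hJ, sub_c, ofNat_mul_c]; simp [hI1, hI0, II]) fJ
  have hμb : μ = 3 ^ (b + 1) := by
    have hpos : (0 : ℤ) < 3 ^ (b + 1) := by positivity
    have hodd : (3 : ℤ) ^ (b + 1) % 2 = 1 := Int.odd_iff.1 (Odd.pow (by decide))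
    have hc1 := hv x0
    rw [← hcdef] at hc1
    generalize (3 : ℤ) ^ (b + 1) = q at *
    rcases hc1 with h | h | h
    · exact absurd h hx0
    · rw [h] at k1; omega
    · rw [h] at k1; omega
  have hle : NE T ≤ μ := by
    rw [hNE, hμb, ← a1, aug_apply]
    refine Finset.sum_le_sum fun x _ => ?_
    by_cases hx : f.c x = 0
    · rw [hx, hI1, II]; simp only; split_ifs <;> norm_num
    · have := hb x hx
      rw [hI1, II]; simp only; rw [if_pos this]
      rcases hv x with h | h | h <;> rw [h] <;> norm_num
  have h9 : 9 ≤ μ := by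
    rcases b with _ | b
    · exfalso
      have hμ3 : μ = 3 := by rw [hμb]; norm_num
      have e1 := N.hν; have e2 := N.hk; have e3 := N.hδ
      rw [hμ3] at e2 e3
      exact no_mu_three (n := n) (by exact_mod_cast hn) (by exact_mod_cast hd) e3 e1 e2
    · rw [hμb, pow_succ, pow_succ]
      have : (1 : ℤ) ≤ 3 ^ b := one_le_pow₀ (by norm_num)
      omega
  push_cast
  nlinarith
end three

set_option linter.unusedSectionVars false
set_option linter.unusedVariables false
set_option linter.unusedSimpArgs false
open Lam El

section pow2
variable {n : ℕ} [NeZero n] {A : SR n}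

lemma two_num {n e o p q s δ ν μ v : ℤ} (hn : 3 ≤ n) (h2 : 2 ≤ μ) (hδ : δ = μ ∨ δ = -μ)
    (hν : n * ν = s * (2 * s + δ)) (hk : 4 * s + δ = μ ^ 2 + ν) (hp : Pos e o p q s δ)
    (he1 : e ≤ 2 * n - 1) (hs : p + q ≤ 4 * n - 1) (ho : o = n * v) (hv : v = 0 ∨ v = 1 ∨ v = 2) :
    v = 1 ∧ μ ^ 2 = 2 * n ∧ o = n ∧ s = n := by
  have hd2 : δ ^ 2 = μ ^ 2 := by rcases hδ with h | h <;> rw [h] <;> ring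
  have hδ0 : δ ≠ 0 := by omega
  have hno : ∀ t : ℤ, t ≠ 0 → 3 * n * t = (n + 1) * t ^ 2 → False := by
    intro t ht h
    have h1 : 3 * n = (n + 1) * t := mul_right_cancel₀ ht (by linear_combination h)
    have : (n + 1) * (3 - t) = 3 := by linear_combination h1
    have h3 : (n + 1) ∣ 3 := ⟨_, this.symm⟩
    have := Int.le_of_dvd (by norm_num) h3
    omega
  have hcase : o = s ∨ (o = s + δ ∧ e = s ∧ p = s ∧ q = s) := by
    rcases hp with h | h | h | h
    · left; omega
    · right; omega
    · left; omega
    · left; omega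
  rcases hcase with h | ⟨h, hee, hpp, hqq⟩
  · rcases hv with rfl | rfl | rfl
    · exfalso
      have hs0 : s = 0 := by rw [← h, ho]; ring
      rw [hs0] at hν hk
      have : ν = 0 := by
        have : n * ν = 0 := by linarith
        rcases mul_eq_zero.1 this with h | h <;> omega
      rw [this] at hk
      rcases hδ with rfl | rfl <;> nlinarith
    · have hsn : s = n := by rw [← h, ho]; ring
      refine ⟨rfl, ?_, by rw [ho]; ring, hsn⟩
      subst hsn
      have : ν = 2 * s + δ := mul_left_cancel₀ (by omega : s ≠ 0) hν
      linarith
    · exfalso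
      rcases hp with h | h | h | h <;> omega
  · exfalso
    have hs' : s = n * v - δ := by omega
    have hq : n * (4 * s + δ - μ ^ 2) = s * (2 * s + δ) := by rw [hk, ← hν]; ring
    rw [← hd2, hs'] at hq
    rcases hv with rfl | rfl | rfl
    · exact hno (-δ) (by omega) (by linear_combination hq)
    · have h1 : (n + 1) * δ ^ 2 = 2 * n ^ 2 := by linear_combination -hq
      have h3 : (n + 1) ∣ 2 := ⟨δ ^ 2 - 2 * (n - 1), by linear_combination -h1⟩
      have := Int.le_of_dvd (by norm_num) h3
      omega
    · exact hno δ hδ0 (by linear_combination hq)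

lemma sum_zm (g : Zm n → ℤ) : ∑ x, g x = ∑ i ∈ Finset.range (2 * n), (g ((2 * i : ℕ) : Zm n) + g ((2 * i + 1 : ℕ) : Zm n)) := by
  have h1 : ∑ x, g x = ∑ j ∈ Finset.range (4 * n), g ((j : ℕ) : Zm n) := by
    refine Finset.sum_bij' (fun x _ => x.val) (fun j _ => (j : Zm n)) ?_ ?_ ?_ ?_ ?_
    · intro x _; exact Finset.mem_range.2 (ZMod.val_lt x)
    · intro x _; exact Finset.mem_univ _
    · intro x _; simp
    · intro j hj; exact ZMod.val_natCast_of_lt (Finset.mem_range.1 hj)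
    · intro x _; simp
  have h2 : ∀ m : ℕ, ∑ j ∈ Finset.range (2 * m), g ((j : ℕ) : Zm n) =
      ∑ i ∈ Finset.range m, (g ((2 * i : ℕ) : Zm n) + g ((2 * i + 1 : ℕ) : Zm n)) := by
    intro m
    induction m with
    | zero => simp
    | succ m ih => rw [show 2 * (m + 1) = 2 * m + 1 + 1 by ring, Finset.sum_range_succ, Finset.sum_range_succ, ih,
        Finset.sum_range_succ]; ring
  rw [h1, ← h2]
  exact congrArg (fun m => ∑ j ∈ Finset.range m, g ((j : ℕ) : Zm n)) (by ring)

/-- negacyclic sequences of length divisible by four are not orthogonal to their shift -/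
lemma negacyclic (N : ℕ) (hN : 4 ∣ N) (v : ℕ → ℤ) (hv : ∀ i, v i = 1 ∨ v i = -1) (hs : ∀ i, v (i + N) = - v i)
    (h0 : ∑ i ∈ Finset.range (4 * N), v i * v (i + 1) = 0) : False := by
  have hper : ∀ i, v (N + i) * v (N + i + 1) = v i * v (i + 1) := by
    intro i
    rw [add_comm N i, show i + N + 1 = i + 1 + N by ring, hs, hs]; ring
  have hper2 : ∀ m : ℕ, ∑ i ∈ Finset.range (m * N), v i * v (i + 1) = m * ∑ i ∈ Finset.range N, v i * v (i + 1) := by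
    intro m
    induction m with
    | zero => simp
    | succ m ih =>
      rw [show (m + 1) * N = N + m * N by ring, Finset.sum_range_add]
      simp only [hper]
      rw [ih]; push_cast; ring
  have h1 : ∑ i ∈ Finset.range N, v i * v (i + 1) = 0 := by
    have := hper2 4
    rw [h0] at this; push_cast at this; omega
  have h2 : ∀ m : ℕ, (4 : ℤ) ∣ ∑ i ∈ Finset.range m, v i * v (i + 1) - (2 * ∑ i ∈ Finset.range m, v i - v 0 + v m - m) := by
    intro m
    induction m with
    | zero => simp
    | succ m ih =>
      rw [Finset.sum_range_succ, Finset.sum_range_succ]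
      push_cast
      rcases hv m with h | h <;> rcases hv (m + 1) with h' | h' <;> rw [h, h'] <;> rw [h] at ih <;> omega
  have h3 : ∀ m : ℕ, (2 : ℤ) ∣ ∑ i ∈ Finset.range m, v i - m := by
    intro m
    induction m with
    | zero => simp
    | succ m ih =>
      rw [Finset.sum_range_succ]
      push_cast
      rcases hv m with h | h <;> rw [h] <;> omega
  have h4 := h2 N
  have h5 := h3 N
  rw [h1] at h4
  have h6 := hs 0
  rw [zero_add] at h6
  rw [h6] at h4
  rcases hv 0 with h | h <;> rw [h] at h4 <;> omega

lemma dvd_n_of {k : ℕ} (hk : n = 2 ^ k) {x : Zm n} (hx : 4 * x ≠ 0) : x ∣ (n : Zm n) := by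
  obtain ⟨d, hd, u, hu, rfl⟩ := ZMod.eq_unit_mul_divisor x
  have h4 : 4 * n = 2 ^ (k + 2) := by rw [hk]; ring
  have hd' : d ∣ 2 ^ (k + 2) := h4 ▸ hd
  obtain ⟨j, hj, rfl⟩ := (Nat.dvd_prime_pow Nat.prime_two).1 hd'
  have hjk : j ≤ k := by
    by_contra hlt
    apply hx
    have : (((4 * 2 ^ j : ℕ)) : Zm n) = 0 := by
      rw [natCast_eq_zero_iff', h4, show 4 * 2 ^ j = 2 ^ (j + 2) by ring]
      exact pow_dvd_pow 2 (by omega)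
    push_cast at this ⊢
    linear_combination u * this
  rw [hu.mul_left_dvd]
  have : 2 ^ j ∣ n := by rw [hk]; exact pow_dvd_pow 2 hjk
  obtain ⟨t, ht⟩ := this
  exact ⟨t, by rw [← Nat.cast_mul, ← ht]⟩

lemma od_mul_ev_all {f : Lam (Zm n) ℤ} (h : IsOd f) : f * ev all = C (aug f) * od all := by
  have := mul_all f
  have h2 := congrArg od this
  have hf : od f = f := by ext x; rcases par_cases x with hx | hx <;> simp [od, hx, h x]
  have hf' : ev f = 0 := by ext x; rcases par_cases x with hx | hx <;> simp [ev, hx, h x]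
  rw [od_mul, od_mul, hf, hf', zero_mul, zero_add, ev_C, od_C, zero_mul, add_zero] at h2
  exact h2

lemma od_mul_od_all {f : Lam (Zm n) ℤ} (h : IsOd f) : f * od all = C (aug f) * ev all := by
  have := mul_all f
  have h2 := congrArg ev this
  have hf : od f = f := by ext x; rcases par_cases x with hx | hx <;> simp [od, hx, h x]
  have hf' : ev f = 0 := by ext x; rcases par_cases x with hx | hx <;> simp [ev, hx, h x]
  rw [ev_mul, ev_mul, hf, hf', zero_mul, zero_add, ev_C, od_C, zero_mul, add_zero] at h2
  exact h2

lemma ev_mul_ev_all {f : Lam (Zm n) ℤ} (h : IsEv f) : f * ev all = C (aug f) * ev all := by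
  have := mul_all f
  have h2 := congrArg ev this
  have hf : ev f = f := by ext x; rcases par_cases x with hx | hx <;> simp [ev, hx, h x]
  have hf' : od f = 0 := by ext x; rcases par_cases x with hx | hx <;> simp [od, hx, h x]
  rw [ev_mul, ev_mul, hf, hf', zero_mul, add_zero, ev_C, od_C, zero_mul, add_zero] at h2
  exact h2

/-- disjointness from the `z`-translate -/
lemma half_cover {f : Lam (Zm n) ℤ} (hf : Bin f) (he : IsEv f) (h : aug f - (f * inv f).c zz = n) :
    aug f = n ∧ (1 + Z) * f = ev all := by
  have h1 : (f * inv f).c zz = ∑ x, f.c x * f.c (x + zz) := by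
    rw [mul_c]
    refine Finset.sum_congr rfl fun x _ => ?_
    rw [inv_c, neg_sub, sub_eq_add_neg, neg_zz]
  have h2 : ∑ x, f.c (x + zz) = aug f := Fintype.sum_equiv (Equiv.addRight zz) _ _ (fun w => rfl)
  have h3 : ∑ x, (ev all : Lam (Zm n) ℤ).c x = 2 * n := aug_ev_all
  have hterm : ∀ x, 0 ≤ (ev all : Lam (Zm n) ℤ).c x - (f.c x + f.c (x + zz) - f.c x * f.c (x + zz)) ∧
      0 ≤ f.c x * f.c (x + zz) := by
    intro x
    rcases par_cases x with hx | hx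
    · have : (ev all : Lam (Zm n) ℤ).c x = 1 := by simp [ev, hx]
      rw [this]
      rcases hf x with h1 | h1 <;> rcases hf (x + zz) with h2 | h2 <;> rw [h1, h2] <;> norm_num
    · have e1 := he x hx
      have e2 := he (x + zz) (by rw [map_add, hx, par_zz, add_zero])
      rw [e1, e2]; simp [ev, hx]
  have hS : ∑ x, ((ev all : Lam (Zm n) ℤ).c x - (f.c x + f.c (x + zz) - f.c x * f.c (x + zz))) =
      2 * n - (2 * aug f - (f * inv f).c zz) := by
    rw [Finset.sum_sub_distrib, Finset.sum_sub_distrib, Finset.sum_add_distrib, h1, h2, h3, ← aug_apply]; ring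
  have hS0 : 0 ≤ 2 * (n : ℤ) - (2 * aug f - (f * inv f).c zz) := by
    rw [← hS]; exact Finset.sum_nonneg fun x _ => (hterm x).1
  have hT0 : 0 ≤ (f * inv f).c zz := by rw [h1]; exact Finset.sum_nonneg fun x _ => (hterm x).2
  have ha0 : (f * inv f).c zz = 0 := by omega
  refine ⟨by omega, ?_⟩
  have hz1 : ∀ x, f.c x * f.c (x + zz) = 0 := by
    intro x
    rw [h1] at ha0
    exact (Finset.sum_eq_zero_iff_of_nonneg fun x _ => (hterm x).2).1 ha0 x (Finset.mem_univ _)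
  have hz2 : ∀ x, (ev all : Lam (Zm n) ℤ).c x - (f.c x + f.c (x + zz) - f.c x * f.c (x + zz)) = 0 := by
    intro x
    have hS' : ∑ x, ((ev all : Lam (Zm n) ℤ).c x - (f.c x + f.c (x + zz) - f.c x * f.c (x + zz))) = 0 := by
      rw [hS]; omega
    exact (Finset.sum_eq_zero_iff_of_nonneg fun x _ => (hterm x).1).1 hS' x (Finset.mem_univ _)
  ext x
  rw [one_add_Z_mul_c]
  have := hz2 x
  rw [hz1 x] at this
  omega

lemma TT.kill2 (hn : 3 ≤ n) {T : El n ℤ} (h : TT A T) {k : ℕ} (hk : n = 2 ^ k) (hE : Z * T.E = T.E) : False := by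
  obtain ⟨μ, s, δ, ν, N⟩ := h.num hn
  have hS := A.sym h.mem
  have hZ := Z_mul_Z (n := n) (k := ℤ)
  have H := N.sz
  have hn' : (3 : ℤ) ≤ n := by exact_mod_cast hn
  have h4 : 4 * n = 2 ^ (k + 2) := by rw [hk]; ring
  have hrat : RatL T.E := h.rat
  have hOr := A.ratO hn h.mem h.rat
  -- odd elements are units
  have hun : ∀ x : Zm n, par x = 1 → IsUnit x := by
    intro x hx
    obtain ⟨d, hd, u, hu, rfl⟩ := ZMod.eq_unit_mul_divisor x
    have hd' : d ∣ 2 ^ (k + 2) := h4 ▸ hd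
    obtain ⟨j, hj, rfl⟩ := (Nat.dvd_prime_pow Nat.prime_two).1 hd'
    rcases j with _ | j
    · simpa using hu
    · exfalso
      rw [(par_zero_iff _).2 ⟨u * ((2 ^ j : ℕ) : Zm n), by push_cast; ring⟩] at hx
      exact zero_ne_one hx
  set v := ((1 + Z) * T.O).c 1 with hvdef
  have hOc : ∀ x, par x = 1 → ((1 + Z) * T.O).c x = v := by
    intro x hx
    obtain ⟨u, rfl⟩ := hun x hx
    have := hOr u 1
    rw [mul_one] at this
    exact this
  have hOod : IsOd T.O := isOd_od _
  have hOv : (1 + Z) * T.O = C v * od all := by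
    ext x
    rw [C_mul_c]
    rcases par_cases x with hx | hx
    · rw [one_add_Z_mul_c, hOod x hx, hOod (x + zz) (by rw [map_add, hx, par_zz, add_zero])]; simp [od, hx]
    · rw [hOc x hx]; simp [od, hx]
  have hv : v = 0 ∨ v = 1 ∨ v = 2 := by
    rw [hvdef, one_add_Z_mul_c]
    rcases h.set.O 1 with h1 | h1 <;> rcases h.set.O (1 + zz) with h2 | h2 <;> rw [h1, h2] <;> norm_num
  have ho : aug T.O = n * v := by
    have := congrArg aug hOv
    rw [map_mul, map_mul, map_add, map_one, aug_Z, aug_C, aug_od_all] at this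
    linarith
  obtain ⟨hv1, hμ, hon, hsn⟩ := two_num hn' N.two N.hδ N.hν N.hk N.pos (h.e_lt hn) h.s_lt ho hv
  rw [hv1, map_one, one_mul] at hOv
  have hXE := H.hE
  rw [hS.sq_E] at hXE
  have hXQ := H.hQ
  rw [hS.sq_Q] at hXQ
  have hPev : IsEv T.P := isEv_ev _
  have hQod : IsOd T.Q := isOd_od _
  have hQi : Z * inv T.Q = inv T.Q := hS.Qi
  -- coefficients at 0 and z
  have hcov := half_cover h.set.P hPev (by
    have c0 := congrArg (fun f => f.c 0) hXE
    have c1 := congrArg (fun f => f.c zz) hXE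
    simp only [add_c, C_mul_c, C_c, if_true, zz_ne, if_false] at c0 c1
    have hEE : (T.E ^ 2).c 0 = aug T.E := by
      rw [pow_two]; nth_rewrite 2 [← hS.E]; exact h.set.E.sq
    have hOO : (T.O ^ 2).c 0 = aug T.O := by
      rw [pow_two]; nth_rewrite 2 [← hS.O]; exact h.set.O.sq
    have hper : ∀ f g : Lam (Zm n) ℤ, Z * f = f → (f * g).c zz = (f * g).c 0 := by
      intro f g hf
      conv_rhs => rw [← hf, mul_assoc, Z_mul_c, zero_add]
    have hE2 : (T.E ^ 2).c zz = (T.E ^ 2).c 0 := by rw [pow_two]; exact hper _ _ hE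
    have hQ2 : (T.Q * inv T.Q).c zz = (T.Q * inv T.Q).c 0 := hper _ _ hS.Q
    have hO2 : (T.O ^ 2).c zz = 0 := by
      have e : (1 + Z) * T.O ^ 2 = C (aug T.O) * ev all := by
        rw [← od_mul_od_all hOod]; linear_combination T.O * hOv
      have e1 := congrArg (fun f => f.c 0) e
      simp only [one_add_Z_mul_c, C_mul_c, hOO, zero_add] at e1
      have : (ev all : Lam (Zm n) ℤ).c 0 = 1 := by simp [ev]
      rw [this] at e1; linarith
    have e0 : (ev all : Lam (Zm n) ℤ).c 0 = 1 := by simp [ev]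
    have e1 : (ev all : Lam (Zm n) ℤ).c zz = 1 := by simp [ev]
    rw [hEE, hOO, h.set.P.sq, h.set.Q.sq, e0] at c0
    rw [hE2, hEE, hO2, hQ2, h.set.Q.sq, e1] at c1
    linarith)
  obtain ⟨hpn, hPv⟩ := hcov
  -- size of n
  have hn8 : 8 ∣ n := by
    rcases k with _ | _ | _ | k
    · omega
    · omega
    · exfalso
      rw [hk] at hμ
      push_cast at hμ
      have h1 : μ < 3 := by nlinarith
      have h2 := N.two
      have : μ = 2 := by omega
      rw [this] at hμ
      norm_num at hμ
    · rw [hk]; exact ⟨2 ^ k, by ring⟩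
  obtain ⟨m, hm⟩ := hn8
  set Y : Lam (Zm n) ℤ := d (n : Zm n) with hY
  have hYY : Y * Y = Z := by rw [hY, d_mul_d, Z, zz_eq]; congr 1; ring
  have parn : par (n : Zm n) = 0 := by
    rw [par_zero_iff]; exact ⟨((4 * m : ℕ) : Zm n), by
      rw [show (2 : Zm n) * ((4 * m : ℕ) : Zm n) = ((8 * m : ℕ) : Zm n) by push_cast; ring]
      exact congrArg _ hm⟩
  have Yc : ∀ (f : Lam (Zm n) ℤ) x, (Y * f).c x = f.c (x - n) := fun f x => by rw [hY, d_mul_c]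
  have Yev : Y * ev all = ev all := by ext x; rw [Yc]; simp [ev, parn]
  have Yod : Y * od all = od all := by ext x; rw [Yc]; simp [od, parn]
  have hn0 : (n : Zm n) ≠ 0 := by
    rw [Ne, natCast_eq_zero_iff']; intro hh; have := Nat.le_of_dvd (by omega) hh; omega
  have h3n : (n : Zm n) + zz ≠ 0 := by
    rw [zz_eq]; intro hh
    have : ((3 * n : ℕ) : Zm n) = 0 := by push_cast; linear_combination hh
    rw [natCast_eq_zero_iff'] at this
    have := Nat.le_of_dvd (by omega) this; omega
  set ε := T.E.c 0 - T.E.c n with hε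
  set D : Lam (Zm n) ℤ := (1 - Y) * (1 + Z) with hD
  have hEz : ∀ x, T.E.c (x + zz) = T.E.c x := fun x => by conv_rhs => rw [← hE, Z_mul_c]
  have Dc : ∀ x, D.c x = (if x = 0 then 1 else 0) + (if x = zz then 1 else 0) - (if x = (n : Zm n) then 1 else 0) -
      (if x = (n : Zm n) + zz then 1 else 0) := by
    intro x
    have : D = 1 + Z - (Y + Y * Z) := by rw [hD]; ring
    rw [this, hY, Z, d_mul_d]
    simp only [sub_c, add_c, d_c, one_c]; ring
  have zn : (zz : Zm n) = n + n := by rw [zz_eq, two_mul]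
  have f0 : (n : Zm n) + n + n + n = 0 := by have := four_n (n := n); linear_combination this
  have hnzz : (n : Zm n) ≠ zz := by intro hh; rw [zn] at hh; exact hn0 (by linear_combination -hh)
  have D0 : D.c 0 = 1 := by
    rw [Dc, if_pos rfl, if_neg zz_ne.symm, if_neg hn0.symm, if_neg h3n.symm]; ring
  have hED : (1 - Y) * T.E = C ε * D := by
    ext x
    rw [sub_mul, one_mul, sub_c, Yc, C_mul_c, Dc]
    have hdec : 4 * x ≠ 0 → T.E.c (x - n) = T.E.c x := by
      intro hx
      have hx' : 4 * (x - n) ≠ 0 := by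
        intro hh; apply hx; linear_combination hh + four_n (n := n)
      have d1 := dvd_n_of hk hx
      have d2 := dvd_n_of hk hx'
      refine hrat.eq_of_dvd ?_ ?_
      · have := dvd_add (dvd_refl (x - n)) d2; simpa using this
      · exact dvd_sub (dvd_refl x) d1
    have e3 : T.E.c ((n : Zm n) + zz) = T.E.c n := hEz _
    have e2 : T.E.c zz = T.E.c 0 := by have := hEz 0; rwa [zero_add] at this
    have en : T.E.c (-n) = T.E.c n := by
      rw [← e3]; congr 1; rw [zn]; linear_combination -f0
    by_cases x0 : x = 0
    · subst x0
      rw [if_pos rfl, if_neg zz_ne.symm, if_neg hn0.symm, if_neg h3n.symm, zero_sub, en, hε]; ring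
    by_cases x1 : x = zz
    · subst x1
      rw [if_neg x0, if_pos rfl, if_neg hnzz.symm, if_neg (by intro hh; exact hn0 (by linear_combination -hh))]
      have : (zz : Zm n) - n = n := by rw [zn]; ring
      rw [this, e2, hε]; ring
    by_cases x2 : x = (n : Zm n)
    · subst x2
      rw [if_neg x0, if_neg x1, if_pos rfl, if_neg (by intro hh; exact zz_ne (n := n) (by linear_combination -hh)), sub_self, hε]
      ring
    by_cases x3 : x = (n : Zm n) + zz
    · subst x3
      rw [if_neg x0, if_neg x1, if_neg x2, if_pos rfl, add_sub_cancel_left, e3, e2, hε]; ring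
    rw [if_neg x0, if_neg x1, if_neg x2, if_neg x3, hdec]
    · ring
    · intro h4x
      have h22 : 2 * (2 * x) = 0 := by linear_combination h4x
      rcases (two_mul_eq_zero _).1 h22 with h5 | h5
      · rcases (two_mul_eq_zero _).1 h5 with h6 | h6
        · exact x0 h6
        · exact x1 h6
      · rw [zz_eq] at h5
        rcases (two_mul_eq_iff _ _).1 h5 with h6 | h6
        · exact x2 h6
        · exact x3 h6
  have hEQ : (1 - Y) * (T.E * T.Q) = 0 := by
    apply lam_two_cancel
    have e : T.O * ((1 + Z) * T.P) = C (aug T.O) * od all := by rw [hPv]; exact od_mul_ev_all hOod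
    linear_combination (1 - Y) * hXQ - (1 - Y) * e + C (aug T.O) * Yod - C ν * Yod
  have hmain : D * T.E ^ 2 + D * (T.Q * inv T.Q) = C (μ ^ 2) * D := by
    have e1 : T.O * ((1 + Z) * T.O) = C (aug T.O) * ev all := by rw [hOv]; exact od_mul_od_all hOod
    have e2 : inv T.P * ((1 + Z) * T.P) = C (aug (inv T.P)) * ev all := by rw [hPv]; exact ev_mul_ev_all hPev.inv
    have e3 := one_add_Z_ev_all (n := n)
    rw [hD]
    linear_combination (1 - Y) * (1 + Z) * hXE - (1 - Y) * e1 - (1 - Y) * e2 + C (aug T.O) * Yev +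
      C (aug (inv T.P)) * Yev + C ν * (1 - Y) * e3 - 2 * C ν * Yev
  by_cases hε0 : ε = 0
  · rw [hε0, map_zero, zero_mul] at hED
    have hDE : D * T.E ^ 2 = 0 := by rw [hD]; linear_combination (1 + Z) * T.E * hED
    have hDQ : (1 - Y) * (T.Q * inv T.Q) = C (n : ℤ) * D := by
      rw [← sub_eq_zero]
      apply lam_two_cancel
      rw [hDE, zero_add, hμ, map_mul, map_ofNat] at hmain
      have hQ := hS.Q
      rw [hD] at hmain ⊢
      linear_combination hmain - (1 - Y) * inv T.Q * hQ
    set w := (1 - Y) * T.Q with hw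
    have Yi : inv Y = Y * Z := by
      rw [hY, inv_d, Z, d_mul_d]; congr 1; rw [zn]; linear_combination -f0
    have hww : w * inv w = C (2 * n : ℤ) * D := by
      rw [hw, map_mul, map_sub, map_one, Yi, map_mul, map_ofNat]
      have h1 : Y * D = - D + C 0 := by
        rw [hD, map_zero]; linear_combination -(1 + Z) * hYY - hZ
      rw [map_zero] at h1
      linear_combination (1 - Y) * hDQ - (1 - Y) * Y * T.Q * hQi - C (n : ℤ) * h1
    have wc : ∀ x, w.c x = T.Q.c x - T.Q.c (x - n) := by
      intro x; rw [hw, sub_mul, one_mul, sub_c, Yc]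
    have wneg : ∀ x, w.c (x + n) = - w.c x := by
      intro x
      have : T.Q.c (x + n) = T.Q.c (x - n) := by
        conv_rhs => rw [← hS.Q, Z_mul_c, zn]
        congr 1; ring
      rw [wc, wc, this, add_sub_cancel_right]; ring
    have wev : ∀ x, par x = 0 → w.c x = 0 := by
      intro x hx
      rw [wc, hQod x hx, hQod (x - n) (by rw [map_sub, hx, parn, sub_zero]), sub_zero]
    have wle : ∀ x, w.c x ^ 2 ≤ (od all : Lam (Zm n) ℤ).c x := by
      intro x
      rcases par_cases x with hx | hx
      · rw [wev x hx]; simp [od, hx]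
      · have : (od all : Lam (Zm n) ℤ).c x = 1 := by simp [od, hx]
        rw [this, wc]
        rcases h.set.Q x with h1 | h1 <;> rcases h.set.Q (x - n) with h2 | h2 <;> rw [h1, h2] <;> norm_num
    have wsum : ∑ x, w.c x ^ 2 = ∑ x, (od all : Lam (Zm n) ℤ).c x := by
      rw [← mul_inv_c, hww, C_mul_c, D0, mul_one]
      exact aug_od_all.symm
    have wpm : ∀ x, par x = 1 → w.c x = 1 ∨ w.c x = -1 := by
      intro x hx
      have := (Finset.sum_eq_sum_iff_of_le (fun x _ => wle x)).1 wsum x (Finset.mem_univ _)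
      have e1 : (od all : Lam (Zm n) ℤ).c x = 1 := by simp [od, hx]
      rw [e1] at this
      have e2 : (w.c x - 1) * (w.c x + 1) = 0 := by linear_combination this
      rcases mul_eq_zero.1 e2 with h3 | h3
      · left; omega
      · right; omega
    have w2 : ∑ x, w.c x * w.c (x + 2) = 0 := by
      have e1 := congrArg (fun f => f.c (-2)) hww
      simp only [C_mul_c] at e1
      have small : ∀ j : ℕ, j < 4 * n → 0 < j → (j : Zm n) ≠ 0 := by
        intro j h1 h2 hh
        rw [natCast_eq_zero_iff'] at hh
        have := Nat.le_of_dvd h2 hh; omega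
      have eD : D.c (-2) = 0 := by
        rw [Dc, if_neg, if_neg, if_neg, if_neg]
        · ring
        · intro hh; refine small (3 * n + 2) (by omega) (by omega) ?_
          rw [zz_eq] at hh; push_cast; linear_combination -hh
        · intro hh; refine small (n + 2) (by omega) (by omega) ?_
          push_cast; linear_combination -hh
        · intro hh; refine small (2 * n + 2) (by omega) (by omega) ?_
          rw [zz_eq] at hh; push_cast; linear_combination -hh
        · intro hh; refine small 2 (by omega) (by omega) ?_
          push_cast; linear_combination -hh
      rw [eD, mul_zero, mul_c] at e1
      rw [← e1]
      refine Finset.sum_congr rfl fun x _ => ?_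
      rw [inv_c]; congr 2; ring
    have podd : ∀ i : ℕ, par ((2 * i + 1 : ℕ) : Zm n) = 1 := fun i =>
      (par_one_iff _).2 ⟨(i : Zm n), by push_cast; ring⟩
    refine negacyclic (4 * m) ⟨m, rfl⟩ (fun i => w.c ((2 * i + 1 : ℕ) : Zm n)) (fun i => wpm _ (podd i)) ?_ ?_
    · intro i
      have hcast : ((8 * m : ℕ) : Zm n) = (n : Zm n) := (congrArg (Nat.cast : ℕ → Zm n) hm).symm
      show w.c _ = - w.c _
      rw [← wneg, ← hcast]; congr 1; push_cast; ring
    · rw [sum_zm] at w2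
      rw [show 4 * (4 * m) = 2 * n by omega]
      rw [← w2]
      refine Finset.sum_congr rfl fun i _ => ?_
      rw [wev ((2 * i : ℕ) : Zm n) ((par_zero_iff _).2 ⟨(i : Zm n), by push_cast; ring⟩), zero_mul, zero_add]
      congr 2; push_cast; ring
  · have hQ0 : (1 - Y) * T.Q = 0 := by
      have e1 : C ε * ((1 - Y) * T.Q) = 0 := by
        apply lam_two_cancel
        have hQ := hS.Q
        rw [hD] at hED
        linear_combination hEQ - T.Q * hED - C ε * (1 - Y) * hQ
      ext x
      have e2 := congrArg (fun f => f.c x) e1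
      simp only [C_mul_c, zero_c] at e2
      rw [zero_c]
      exact (mul_eq_zero.1 e2).resolve_left hε0
    have e1 : C (4 * ε ^ 2) * D = C (μ ^ 2) * D := by
      rw [← hmain, map_mul, map_pow, map_ofNat]
      rw [hD] at hED ⊢
      linear_combination -(1 + Z) * inv T.Q * hQ0 - (1 + Z) * T.E * hED - C ε * (1 + Z) ^ 2 * hED -
        C ε ^ 2 * (1 - Y) * (1 + Z) * 2 * hZ - C ε ^ 2 * (1 - Y) * (1 - Z) * hZ
    have e2 := congrArg (fun f => f.c 0) e1
    simp only [C_mul_c, D0, mul_one] at e2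
    have e3 : ε = 1 ∨ ε = -1 := by
      rcases h.set.E 0 with h1 | h1 <;> rcases h.set.E (n : Zm n) with h2 | h2 <;> rw [h1, h2] at hε <;> omega
    have e4 : ε ^ 2 = 1 := by rcases e3 with h | h <;> rw [h] <;> norm_num
    rw [e4, hμ] at e2
    omega

theorem SR.main (A : SR n) (hn : 3 ≤ n) (g h : Zm n × Bool) (hg : g ≠ (0, false)) (hh : h ≠ (0, false)) : A.r g h := by
  by_contra hne
  rcases A.tri hn ⟨g, h, hg, hh, hne⟩ with ⟨T, p, hT, hp, hd, h2, hR⟩ | ⟨h1, h2⟩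
  · exact hT.kill1 hn hp hd hR
  · by_cases h5 : ∃ p : ℕ, p.Prime ∧ p ∣ n ∧ 5 ≤ p
    · obtain ⟨p, hp, hd, h5⟩ := h5
      obtain ⟨T, hT, hE, hO⟩ := h1 p hp hd (by omega)
      exact hT.kill5 hn hp h5 hd hE hO
    · have h23 : ∀ p : ℕ, p.Prime → p ∣ n → p = 2 ∨ p = 3 := by
        intro p hp hd
        have hlt : p < 5 := by by_contra hh; exact h5 ⟨p, hp, hd, by omega⟩
        have := hp.two_le
        interval_cases p
        · left; rfl
        · right; rfl
        · exact absurd hp (by norm_num)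
      by_cases h3 : 3 ∣ n
      · obtain ⟨T, hT, hE, hO⟩ := h1 3 Nat.prime_three h3 (by omega)
        exact hT.kill33 hn h3 h23 hE hO
      · have hall : ∀ p : ℕ, p.Prime → p ∣ n → p = 2 := by
          intro p hp hd
          rcases h23 p hp hd with h | h
          · exact h
          · exact absurd (h ▸ hd) h3
        obtain ⟨T, hT, hE⟩ := h2 hall
        exact hT.kill2 hn (Nat.eq_prime_pow_of_unique_prime_dvd (NeZero.ne n) (fun {d} a b => hall d a b)) hE

end pow2

section level
variable {n : ℕ} [NeZero n]

/-- left division `g⁻¹ h` in the semidihedral group -/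
def gdiv (g h : Zm n × Bool) : Zm n × Bool :=
  if g.2 then (((sgU : (Zm n)ˣ) : Zm n) * (h.1 - g.1), !h.2) else (h.1 - g.1, h.2)

lemma gdiv_zero (h : Zm n × Bool) : gdiv (0, false) h = h := by simp [gdiv]

lemma gdiv_self (h : Zm n × Bool) : gdiv h h = (0, false) := by
  obtain ⟨x, i⟩ := h
  cases i <;> simp [gdiv]

lemma ginv_eq (g : Zm n × Bool) : ginv g = gdiv g (0, false) := by
  obtain ⟨x, i⟩ := g
  cases i <;> simp [gdiv, ginv]

lemma El.mul_val {k : Type} [CommRing k] (y y' : El n k) (g : Zm n × Bool) :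
    (y * y').val g = ∑ h, y.val h * y'.val (gdiv h g) := by
  obtain ⟨x, i⟩ := g
  rw [Fintype.sum_prod_type]
  simp only [Fintype.sum_bool, Finset.sum_add_distrib]
  cases i
  · simp [gdiv, mul_R, Lam.mul_c]; ring
  · simp [gdiv, mul_S, Lam.mul_c]; ring

/-- A regular action of the semidihedral group inside `X`. -/
structure RegData (n : ℕ) [NeZero n] (X Ω : Type*) [Group X] [MulAction X Ω] where
  ω : Ω
  e : Zm n × Bool → X
  bij : Function.Bijective (fun g => e g • ω)
  one : e (0, false) = 1
  div : ∀ g h, e g * e (gdiv g h) = e h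
  prim : ∀ s : Setoid Ω, (∀ (x : X) α β, s α β → s (x • α) (x • β)) → (∃ α β, α ≠ β ∧ s α β) →
    ∀ α β, s α β

namespace RegData
variable {X Ω : Type*} [Group X] [MulAction X Ω] (D : RegData n X Ω)

/-- coordinates of a point -/
noncomputable def q : Ω ≃ Zm n × Bool := (Equiv.ofBijective _ D.bij).symm

lemma e_q (α : Ω) : D.e (D.q α) • D.ω = α := (Equiv.ofBijective _ D.bij).apply_symm_apply α
lemma q_e (g) : D.q (D.e g • D.ω) = g := (Equiv.ofBijective _ D.bij).symm_apply_apply g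
lemma q_ω : D.q D.ω = (0, false) := by
  have := D.q_e (0, false); rwa [D.one, one_smul] at this

/-- the orbit relation of the stabilizer -/
def rel (g h : Zm n × Bool) : Prop := ∃ x : X, x • D.ω = D.ω ∧ x • D.e g • D.ω = D.e h • D.ω

lemma rel_eqv : Equivalence D.rel where
  refl g := ⟨1, by simp⟩
  symm := by
    rintro g h ⟨x, h1, h2⟩
    exact ⟨x⁻¹, by rw [inv_smul_eq_iff, h1], by rw [inv_smul_eq_iff, h2]⟩
  trans := by
    rintro g h l ⟨x, h1, h2⟩ ⟨z, h3, h4⟩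
    exact ⟨z * x, by rw [mul_smul, h1, h3], by rw [mul_smul, h2, h4]⟩

lemma e_div (g h : Zm n × Bool) : D.e (gdiv g h) = (D.e g)⁻¹ * D.e h := by
  rw [← D.div g h]; group

lemma rel_div (x : X) (α β : Ω) :
    D.rel (gdiv (D.q α) (D.q β)) (gdiv (D.q (x • α)) (D.q (x • β))) := by
  refine ⟨(D.e (D.q (x • α)))⁻¹ * x * D.e (D.q α), ?_, ?_⟩
  · rw [mul_smul, mul_smul, e_q, inv_smul_eq_iff, e_q]
  · rw [e_div, e_div, mul_smul, mul_smul, mul_smul, mul_smul, smul_inv_smul, e_q, e_q]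

variable {k : Type} [CommRing k]

/-- the invariant kernel attached to an element -/
noncomputable def F (y : El n k) (α β : Ω) : k := y.val (gdiv (D.q α) (D.q β))

lemma F_smul {y : El n k} (h : Mem D.rel y) (x : X) (α β : Ω) : D.F y (x • α) (x • β) = D.F y α β :=
  (h _ _ (D.rel_div x α β)).symm

lemma F_ω (y : El n k) (g) : D.F y D.ω (D.e g • D.ω) = y.val g := by
  rw [F, q_ω, q_e, gdiv_zero]

lemma mul_mem {y y' : El n k} (h : Mem D.rel y) (h' : Mem D.rel y') : Mem D.rel (y * y') := by
  rintro g g' ⟨x, h1, h2⟩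
  rw [El.mul_val, El.mul_val]
  have key : ∀ g γ, y.val γ * y'.val (gdiv γ g) =
      D.F y D.ω (D.e γ • D.ω) * D.F y' (D.e γ • D.ω) (D.e g • D.ω) := by
    intro g γ
    rw [F_ω, F, q_e, q_e]
  simp only [key]
  refine Fintype.sum_equiv ((D.q.symm.trans (MulAction.toPerm x)).trans D.q) _ _ ?_
  intro γ
  have : D.e (((D.q.symm.trans (MulAction.toPerm x)).trans D.q) γ) • D.ω = x • D.e γ • D.ω := by
    simp only [Equiv.trans_apply, MulAction.toPerm_apply]
    rw [e_q]; congr 1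
  rw [this]
  rw [← D.F_smul h x, ← D.F_smul h' x, h1, h2]

lemma star (g h) (hr : D.rel g h) : D.rel (ginv g) (ginv h) := by
  obtain ⟨x, h1, h2⟩ := hr
  rw [ginv_eq, ginv_eq]
  have := D.rel_div x (D.e g • D.ω) D.ω
  rwa [h1, h2, q_e, q_e, q_ω] at this

/-- connectivity -/
lemma conn {y : El n k} (h : Mem D.rel y) (g) (hg : g ≠ (0, false)) (hy : y.val g ≠ 0)
    (f : Zm n × Bool → Zm n) (hf : ∀ u v, y.val (gdiv u v) ≠ 0 → f u = f v) (u v) : f u = f v := by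
  let s : Setoid Ω :=
    { r := fun α β => ∀ f : Ω → Zm n, (∀ α β, D.F y α β ≠ 0 → f α = f β) → f α = f β
      iseqv := ⟨fun _ _ _ => rfl, fun h f hf => (h f hf).symm, fun h h' f hf => (h f hf).trans (h' f hf)⟩ }
  have hs := D.prim s (by
    intro x α β hab f hf
    refine hab (fun α => f (x • α)) ?_
    intro α β hF
    exact hf _ _ (by rwa [D.F_smul h])) ⟨D.ω, D.e g • D.ω, by
      intro hh
      have := congrArg D.q hh
      rw [q_ω, q_e] at this
      exact hg this.symm, fun f hf => hf _ _ (by rwa [F_ω])⟩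
  have := hs (D.e u • D.ω) (D.e v • D.ω) (fun α => f (D.q α)) (fun α β hF => hf _ _ hF)
  simpa only [q_e] using this

/-- The Schur ring of a primitive group. -/
noncomputable def toSR (hn : 3 ≤ n) : SR n where
  r := D.rel
  eqv := D.rel_eqv
  one_cls := by
    rintro g ⟨x, h1, h2⟩
    rw [D.one, one_smul, h1] at h2
    have := congrArg D.q h2
    rw [q_ω, q_e] at this
    exact this.symm
  mul_mem := fun y y' h h' => D.mul_mem h h'
  star_mem := D.star
  prim1 := by
    intro k _ y u hu hm hR hS
    let s : Setoid Ω :=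
      { r := fun α β => ∀ γ, D.F y α γ = D.F y β γ
        iseqv := ⟨fun _ _ => rfl, fun h f => (h f).symm, fun h h' f => (h f).trans (h' f)⟩ }
    have hs := D.prim s (by
      intro x α β hab γ
      rw [← smul_inv_smul x γ, D.F_smul hm, D.F_smul hm]
      exact hab _) ⟨D.ω, D.e (u, false) • D.ω, by
        intro hh
        have := congrArg D.q hh
        rw [q_ω, q_e] at this
        apply hu; simpa using this.symm, by
        intro γ
        rw [F, F, q_ω, q_e, gdiv_zero]
        obtain ⟨v, i⟩ := D.q γ
        cases i
        · have := congrArg (fun f => f.c v) hR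
          simp only [d_mul_c] at this
          simp [gdiv, this]
        · have := congrArg (fun f => f.c v) hS
          simp only [d_mul_c] at this
          simp [gdiv, this]⟩
    refine ⟨y.val (0, false), fun g => ?_⟩
    have := hs D.ω (D.e g • D.ω) (D.e g • D.ω)
    rw [F_ω, F, gdiv_self] at this
    exact this
  prim2 := by
    intro k _ y hm hS
    refine ⟨y.R.c 0, ?_⟩
    ext x
    rw [C_c]
    split_ifs with hx
    · rw [hx]
    · by_contra hne
      have := D.conn hm (x, false) (by simpa using hx) hne (fun g => if g.2 then 1 else 0) (by
        rintro ⟨u, i⟩ ⟨v, j⟩ huv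
        cases i <;> cases j <;> simp [gdiv, hS] at huv ⊢) (0, true) (0, false)
      have h1 : ((1 : ℕ) : Zm n) = 0 := by simpa using this
      rw [natCast_eq_zero_iff'] at h1
      have := Nat.le_of_dvd one_pos h1
      omega
  prim3 := by
    intro k _ y x hm hy
    by_contra hne
    have := D.conn hm (x, true) (by simp) hne (fun g => if g.2 then 2 * g.1 - 2 * x else 2 * g.1) (by
      rintro ⟨u, i⟩ ⟨v, j⟩ huv
      have h1 : gdiv (u, i) (v, j) = (x, true) := by
        by_contra h; exact huv (hy _ h)
      cases i <;> cases j <;> simp [gdiv] at h1 ⊢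
      · rw [← h1]; ring
      · rw [← h1, sgU_val]; linear_combination (u - v) * four_n (n := n)) (1, false) (0, false)
    have h1 : ((2 : ℕ) : Zm n) = 0 := by simpa using this
    rw [natCast_eq_zero_iff'] at h1
    have := Nat.le_of_dvd two_pos h1
    omega

lemma two_trans (D : RegData n X Ω) (hn : 3 ≤ n) : IsTwoTransitive X Ω := by
  have key : ∀ α β : Ω, α ≠ D.ω → β ≠ D.ω → ∃ x : X, x • D.ω = D.ω ∧ x • α = β := by
    intro α β ha hb
    have ne : ∀ α, α ≠ D.ω → D.q α ≠ (0, false) := by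
      intro α ha hh
      rw [← D.q_ω] at hh
      exact ha (D.q.injective hh)
    obtain ⟨x, h1, h2⟩ := (D.toSR hn).main hn (D.q α) (D.q β) (ne α ha) (ne β hb)
    rw [e_q, e_q] at h2
    exact ⟨x, h1, h2⟩
  intro α β α' β' h h'
  have hg : ∀ α β, α ≠ β → (D.e (D.q α))⁻¹ • α = D.ω ∧ (D.e (D.q α))⁻¹ • β ≠ D.ω := by
    intro α β h
    have e1 : (D.e (D.q α))⁻¹ • α = D.ω := by rw [inv_smul_eq_iff, e_q]
    refine ⟨e1, fun h2 => h ?_⟩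
    rw [← e1] at h2
    exact (smul_left_cancel _ h2).symm
  obtain ⟨a1, a2⟩ := hg α β h
  obtain ⟨b1, b2⟩ := hg α' β' h'
  obtain ⟨x, x1, x2⟩ := key _ _ a2 b2
  refine ⟨D.e (D.q α') * x * (D.e (D.q α))⁻¹, ?_, ?_⟩
  · rw [mul_smul, mul_smul, a1, x1, e_q]
  · rw [mul_smul, mul_smul, x2, smul_inv_smul]

end RegData

open Pointwise in
lemma prim_of_noblock {X Ω : Type*} [Group X] [MulAction X Ω]
    (hB : ¬ ∃ B : Set Ω, MulAction.IsBlock X B ∧ B.Nontrivial ∧ B ≠ Set.univ)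
    (s : Setoid Ω) (hs : ∀ (x : X) α β, s α β → s (x • α) (x • β)) (h : ∃ α β, α ≠ β ∧ s α β)
    (γ δ : Ω) : s γ δ := by
  obtain ⟨α, β, hne, hab⟩ := h
  have hiff : ∀ (x : X) β γ, γ ∈ x • {δ | s β δ} ↔ s (x • β) γ := by
    intro x β γ
    rw [Set.mem_smul_set_iff_inv_smul_mem, Set.mem_setOf_eq]
    constructor
    · intro h; have := hs x _ _ h; rwa [smul_inv_smul] at this
    · intro h; have := hs x⁻¹ _ _ h; rwa [inv_smul_smul] at this
  have huniv : {δ | s α δ} = Set.univ := by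
    by_contra hu
    refine hB ⟨{δ | s α δ}, ?_, ⟨α, s.refl α, β, hab, hne⟩, hu⟩
    rw [MulAction.isBlock_iff_smul_eq_smul_of_nonempty]
    rintro x y ⟨γ, h1, h2⟩
    rw [hiff] at h1 h2
    ext δ
    rw [hiff, hiff]
    have h3 := s.trans h1 (s.symm h2)
    exact ⟨fun h => s.trans (s.symm h3) h, fun h => s.trans h3 h⟩
  have h1 : s α γ := by have : γ ∈ {δ | s α δ} := huniv ▸ Set.mem_univ _; exact this
  have h2 : s α δ := by have : δ ∈ {δ | s α δ} := huniv ▸ Set.mem_univ _; exact this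
  exact s.trans (s.symm h1) h2

end level

theorem stmt18 {X Ω : Type*} [Group X] [Finite X] [MulAction X Ω]
    (hfaith : ∀ g : X, (∀ ω : Ω, g • ω = ω) → g = 1)
    (n : ℕ) (hn : 3 ≤ n) (G : Subgroup X) (hSD : IsSemidihedral n G)
    (hreg : ∀ α β : Ω, ∃! g : G, (g : X) • α = β) :
    IsTwoTransitive X Ω ∨
    ∃ B : Set Ω, MulAction.IsBlock X B ∧ B.Nontrivial ∧ B ≠ Set.univ := by
  haveI : NeZero n := ⟨by omega⟩
  rcases isEmpty_or_nonempty Ω with hE | ⟨⟨ω⟩⟩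
  · left; intro α; exact hE.elim α
  by_cases hB : ∃ B : Set Ω, MulAction.IsBlock X B ∧ B.Nontrivial ∧ B ≠ Set.univ
  · exact Or.inr hB
  left
  obtain ⟨hcard, a, b, ha, hb, hab, hcl⟩ := hSD
  let pw : Zm n → G := fun x => a ^ x.val
  have pw_cast : ∀ j : ℕ, pw (j : Zm n) = a ^ j := by
    intro j
    show a ^ (j : ZMod (4 * n)).val = a ^ j
    rw [ZMod.val_natCast, ← ha, pow_mod_orderOf]
  have cast_val : ∀ x : Zm n, ∃ j : ℕ, (j : Zm n) = x := fun x => ⟨ZMod.val x, ZMod.natCast_zmod_val x⟩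
  have pw_add : ∀ x y, pw (x + y) = pw x * pw y := by
    intro x y
    obtain ⟨i, rfl⟩ := cast_val x
    obtain ⟨j, rfl⟩ := cast_val y
    rw [← Nat.cast_add, pw_cast, pw_cast, pw_cast, pow_add]
  have hbb : b * b = 1 := by rw [← pow_two, ← hb, pow_orderOf_eq_one]
  have hbi : b⁻¹ = b := inv_eq_of_mul_eq_one_left hbb
  have pw_sg : ∀ x, b * pw x = pw (((sgU : (Zm n)ˣ) : Zm n) * x) * b := by
    intro x
    obtain ⟨j, rfl⟩ := cast_val x
    have e1 : ((sgU : (Zm n)ˣ) : Zm n) = ((2 * n - 1 : ℕ) : Zm n) := by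
      rw [sgU_val, Nat.cast_sub (by omega)]; push_cast; ring
    rw [e1, ← Nat.cast_mul, pw_cast, pw_cast, pow_mul, ← hab]
    have : (b⁻¹ * a * b) ^ j = b⁻¹ * a ^ j * b := by
      have := conj_pow (i := j) (a := b⁻¹) (b := a)
      rwa [_root_.inv_inv] at this
    rw [this, hbi, mul_assoc, hbb, mul_one]
  let e : Zm n × Bool → G := fun g => pw g.1 * (if g.2 then b else 1)
  have pw0 : pw 0 = 1 := by have := pw_cast 0; simpa using this
  have e_div : ∀ g h, e g * e (gdiv g h) = e h := by
    rintro ⟨x, i⟩ ⟨y, j⟩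
    have e1 : pw x * pw (y - x) = pw y := by rw [← pw_add]; congr 1; ring
    cases i
    · simp only [e, gdiv]
      simp only [Bool.false_eq_true, if_false, mul_one]
      rw [← mul_assoc, e1]
    · have e2 : ∀ z, e (x, true) * (pw (((sgU : (Zm n)ˣ) : Zm n) * (y - x)) * z) = pw y * (b * z) := by
        intro z
        show pw x * (if true then b else 1) * (_ * z) = _
        rw [if_pos rfl, ← mul_assoc, mul_assoc (pw x), pw_sg, sg_sg, ← mul_assoc, e1, mul_assoc]
      have e3 : e (gdiv (x, true) (y, j)) = pw (((sgU : (Zm n)ˣ) : Zm n) * (y - x)) * (if !j then b else 1) := rfl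
      rw [e3, e2]
      show _ = pw y * (if j then b else 1)
      congr 1
      cases j
      · simp [hbb]
      · simp
  have e_one : e (0, false) = 1 := by simp [e, pw0]
  -- surjectivity
  have e_inv : ∀ g h, ∃ l, e l = (e g)⁻¹ * e h := fun g h =>
    ⟨gdiv g h, by rw [← e_div g h]; group⟩
  have hinv : ∀ g, ∃ l, e l = (e g)⁻¹ := by
    intro g
    obtain ⟨l, hl⟩ := e_inv g (0, false)
    exact ⟨l, by rw [hl, e_one, mul_one]⟩
  let H : Subgroup G :=
    { carrier := Set.range e
      one_mem' := ⟨_, e_one⟩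
      inv_mem' := by
        rintro _ ⟨g, rfl⟩
        exact hinv g
      mul_mem' := by
        rintro _ _ ⟨g, rfl⟩ ⟨h, rfl⟩
        obtain ⟨l, hl⟩ := hinv g
        obtain ⟨m, hm⟩ := e_inv l h
        exact ⟨m, by rw [hm, hl, _root_.inv_inv]⟩ }
  have hH : H = ⊤ := by
    rw [eq_top_iff, ← hcl, Subgroup.closure_le]
    rintro x (rfl | rfl)
    · refine ⟨((1 : ℕ), false), ?_⟩
      show pw ((1 : ℕ) : Zm n) * _ = _
      rw [pw_cast]; simp
    · refine ⟨(0, true), ?_⟩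
      show pw 0 * _ = _
      rw [pw0]; simp
  have e_surj : Function.Surjective e := by
    intro x
    have : x ∈ H := hH ▸ Subgroup.mem_top x
    exact this
  have e_bij : Function.Bijective e := by
    haveI : Fintype G := Fintype.ofFinite G
    rw [Fintype.bijective_iff_surjective_and_card]
    refine ⟨e_surj, ?_⟩
    rw [← Nat.card_eq_fintype_card (α := G), hcard, Fintype.card_prod, Fintype.card_bool, ZMod.card]
    ring
  have o_bij : Function.Bijective (fun g : G => (g : X) • ω) := by
    constructor
    · intro g h hgh
      exact (hreg ω ((h : X) • ω)).unique hgh rfl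
    · intro β
      obtain ⟨g, hg, -⟩ := hreg ω β
      exact ⟨g, hg⟩
  let D : RegData n X Ω :=
    { ω := ω
      e := fun g => (e g : X)
      bij := o_bij.comp e_bij
      one := by rw [e_one]; rfl
      div := fun g h => by rw [← e_div g h]; rfl
      prim := prim_of_noblock hB }
  exact D.two_trans hn
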